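/- arXiv:1904.10765 — 4 statements merged into one kernel-verified Lean document; each statement's English description precedes it below -/
import Mathlib

section
/- For every centrally symmetric convex body K in ℝ³ there exist three planes H₁, H₂, H₃ through the origin such that the planes split K into 8 pieces of equal volume, and for each i the planar section K ∩ H_i is split into 4 parts of equal area by the other two planes. -/
namespace EqP
open Finset

abbrev Lb := Fin 3 × Bool

def lneg (x : Lb) : Lb := (x.1, !x.2)
def la (x : Lb) : Lb :=
  match x with
  | (0, b) => (0, !b)
  | (1, b) => (2, !b)
  | (2, b) => (1, b)
def lsw (x : Lb) : Lb :=
  match x with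
  | (0, b) => (0, b)
  | (1, b) => (2, b)
  | (2, b) => (1, b)

/-- indicator that the edge `x y` has labels `{A, B}` -/
def ce (A B x y : Lb) : ZMod 2 := if (x = A ∧ y = B) ∨ (x = B ∧ y = A) then 1 else 0

def cyc (c : Lb → Lb → ZMod 2) (x y z w : Lb) : ZMod 2 := c x y + c y z + c z w + c w x

def NP (x y z w : Lb) : ZMod 2 :=
  if x = (0, true) ∨ y = (0, true) ∨ z = (0, true) ∨ w = (0, true) then
    cyc (ce (1, true) (2, true)) x y z w else 0

def NM (x y z w : Lb) : ZMod 2 :=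
  if x = (0, false) ∨ y = (0, false) ∨ z = (0, false) ∨ w = (0, false) then
    cyc (ce (1, false) (2, true)) x y z w else 0

def psi (x y : Lb) : ZMod 2 := ce (1, true) (2, true) x y + ce (0, false) (2, true) x y

def phi (x : Lb) : ZMod 2 :=
  if x.1 = 2 ∨ x = (0, true) then 1 else 0

def chi (x : Lb) : ZMod 2 := if x = (2, true) then 1 else 0

lemma ce_symm (A B x y : Lb) : ce A B x y = ce A B y x := by
  unfold ce; congr 1; simp only [eq_iff_iff]; tauto

lemma psi_symm (x y : Lb) : psi x y = psi y x := by
  unfold psi; rw [ce_symm, ce_symm (0, false)]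

lemma ce_la (x y : Lb) : ce (1, true) (2, true) (la x) (la y) = ce (1, false) (2, true) x y := by
  revert x y; decide

lemma la_eq (x : Lb) : la x = (0, true) ↔ x = (0, false) := by revert x; decide
lemma lsw_eq (x : Lb) : lsw x = (0, true) ↔ x = (0, true) := by revert x; decide
lemma ce_lsw (x y : Lb) : ce (1, true) (2, true) (lsw x) (lsw y) = ce (1, true) (2, true) x y := by
  revert x y; decide

lemma NP_la (x y z w : Lb) : NP (la x) (la y) (la z) (la w) = NM x y z w := by
  simp only [NP, NM, la_eq, cyc, ce_la]

lemma NP_lsw (x y z w : Lb) : NP (lsw x) (lsw y) (lsw z) (lsw w) = NP x y z w := by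
  simp only [NP, lsw_eq, cyc, ce_lsw]

lemma NP_rev (x y z w : Lb) : NP w z y x = NP x y z w := by
  simp only [NP, cyc]
  congr 1
  · simp only [eq_iff_iff]; tauto
  · rw [ce_symm _ _ w z, ce_symm _ _ z y, ce_symm _ _ y x, ce_symm _ _ x w]; ring

set_option synthInstance.maxHeartbeats 1000000 in
set_option synthInstance.maxSize 10000 in
set_option maxRecDepth 100000 in
set_option maxHeartbeats 4000000 in
lemma cell (x y z w : Lb) (h1 : y ≠ lneg x) (h2 : z ≠ lneg x) (h3 : w ≠ lneg x)
    (h4 : z ≠ lneg y) (h5 : w ≠ lneg y) (h6 : w ≠ lneg z) :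
    NP x y z w + NM x y z w = cyc psi x y z w := by
  revert x y z w; decide

set_option synthInstance.maxHeartbeats 1000000 in
set_option synthInstance.maxSize 10000 in
set_option maxRecDepth 100000 in
set_option maxHeartbeats 4000000 in
/-- if there is no `±0` label on the square then the `cyc` vanishes. -/
lemma cell0 (x y z w : Lb) (h1 : y ≠ lneg x) (h2 : z ≠ lneg x) (h3 : w ≠ lneg x)
    (h4 : z ≠ lneg y) (h5 : w ≠ lneg y) (h6 : w ≠ lneg z)
    (hx : x.1 ≠ 0) (hy : y.1 ≠ 0) (hz : z.1 ≠ 0) (hw : w.1 ≠ 0) :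
    cyc (ce (1, true) (2, true)) x y z w = 0 := by
  revert x y z w; decide


lemma two0 : (2 : ZMod 2) = 0 := rfl

lemma face_pos (S : Set Lb) (H : ∀ x ∈ S, ∀ y ∈ S, y ≠ lneg x) (h0 : ((0, true) : Lb) ∈ S)
    (x y z w : Lb) (hx : x ∈ S) (hy : y ∈ S) (hz : z ∈ S) (hw : w ∈ S) :
    NP x y z w = cyc (ce (1, true) (2, true)) x y z w := by
  unfold NP
  split_ifs with h
  · rfl
  · have key : ∀ t ∈ S, t ≠ (0, true) → t.1 ≠ 0 := by
      intro t ht h1 h2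
      have h3 := H _ h0 t ht
      apply h3
      rcases t with ⟨t1, t2⟩
      simp only at h2
      subst h2
      cases t2
      · rfl
      · exact absurd rfl h1
    push Not at h
    exact (cell0 x y z w (H _ hx _ hy) (H _ hx _ hz) (H _ hx _ hw) (H _ hy _ hz) (H _ hy _ hw)
      (H _ hz _ hw) (key x hx h.1) (key y hy h.2.1) (key z hz h.2.2.1) (key w hw h.2.2.2)).symm

lemma face_zero (S : Set Lb) (h0 : ((0, true) : Lb) ∉ S)
    (x y z w : Lb) (hx : x ∈ S) (hy : y ∈ S) (hz : z ∈ S) (hw : w ∈ S) :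
    NP x y z w = 0 := by
  unfold NP
  rw [if_neg]
  rintro (h | h | h | h) <;> subst h <;> exact h0 (by assumption)

lemma cube (v : ℕ → ℕ → ℕ → Lb) (i j k : ℕ)
    (H : ∀ a b c a' b' c', a ≤ 1 → b ≤ 1 → c ≤ 1 → a' ≤ 1 → b' ≤ 1 → c' ≤ 1 →
      v (i + a') (j + b') (k + c') ≠ lneg (v (i + a) (j + b) (k + c))) :
    (NP (v (i+1) j k) (v (i+1) (j+1) k) (v (i+1) (j+1) (k+1)) (v (i+1) j (k+1))
      + NP (v i j k) (v i (j+1) k) (v i (j+1) (k+1)) (v i j (k+1)))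
    + (NP (v i (j+1) k) (v (i+1) (j+1) k) (v (i+1) (j+1) (k+1)) (v i (j+1) (k+1))
      + NP (v i j k) (v (i+1) j k) (v (i+1) j (k+1)) (v i j (k+1)))
    + (NP (v i j (k+1)) (v (i+1) j (k+1)) (v (i+1) (j+1) (k+1)) (v i (j+1) (k+1))
      + NP (v i j k) (v (i+1) j k) (v (i+1) (j+1) k) (v i (j+1) k)) = 0 := by
  let S : Set Lb := {x | ∃ a b c, a ≤ 1 ∧ b ≤ 1 ∧ c ≤ 1 ∧ x = v (i + a) (j + b) (k + c)}
  have HS : ∀ x ∈ S, ∀ y ∈ S, y ≠ lneg x := by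
    rintro x ⟨a, b, c, ha, hb, hc, rfl⟩ y ⟨a', b', c', ha', hb', hc', rfl⟩
    exact H a b c a' b' c' ha hb hc ha' hb' hc'
  have m000 : v i j k ∈ S := ⟨0, 0, 0, by simp, by simp, by simp, rfl⟩
  have m001 : v i j (k+1) ∈ S := ⟨0, 0, 1, by simp, by simp, by simp, rfl⟩
  have m010 : v i (j+1) k ∈ S := ⟨0, 1, 0, by simp, by simp, by simp, rfl⟩
  have m011 : v i (j+1) (k+1) ∈ S := ⟨0, 1, 1, by simp, by simp, by simp, rfl⟩
  have m100 : v (i+1) j k ∈ S := ⟨1, 0, 0, by simp, by simp, by simp, rfl⟩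
  have m101 : v (i+1) j (k+1) ∈ S := ⟨1, 0, 1, by simp, by simp, by simp, rfl⟩
  have m110 : v (i+1) (j+1) k ∈ S := ⟨1, 1, 0, by simp, by simp, by simp, rfl⟩
  have m111 : v (i+1) (j+1) (k+1) ∈ S := ⟨1, 1, 1, by simp, by simp, by simp, rfl⟩
  generalize v i j k = x000 at *
  generalize v i j (k+1) = x001 at *
  generalize v i (j+1) k = x010 at *
  generalize v i (j+1) (k+1) = x011 at *
  generalize v (i+1) j k = x100 at *
  generalize v (i+1) j (k+1) = x101 at *
  generalize v (i+1) (j+1) k = x110 at *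
  generalize v (i+1) (j+1) (k+1) = x111 at *
  by_cases h0 : ((0, true) : Lb) ∈ S
  · rw [face_pos S HS h0 _ _ _ _ m100 m110 m111 m101, face_pos S HS h0 _ _ _ _ m000 m010 m011 m001,
      face_pos S HS h0 _ _ _ _ m010 m110 m111 m011, face_pos S HS h0 _ _ _ _ m000 m100 m101 m001,
      face_pos S HS h0 _ _ _ _ m001 m101 m111 m011, face_pos S HS h0 _ _ _ _ m000 m100 m110 m010]
    have hs := ce_symm (1, true) (2, true)
    generalize ce (1, true) (2, true) = c at hs
    simp only [cyc]
    rw [hs x111 x101, hs x101 x100, hs x011 x001, hs x001 x000, hs x111 x011, hs x011 x010,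
      hs x110 x010, hs x010 x000, hs x101 x001]
    linear_combination (c x000 x001 + c x000 x010 + c x000 x100 + c x001 x011 + c x001 x101 +
      c x010 x011 + c x010 x110 + c x100 x101 + c x100 x110 + c x011 x111 + c x101 x111 +
      c x110 x111) * two0
  · rw [face_zero S h0 _ _ _ _ m100 m110 m111 m101, face_zero S h0 _ _ _ _ m000 m010 m011 m001,
      face_zero S h0 _ _ _ _ m010 m110 m111 m011, face_zero S h0 _ _ _ _ m000 m100 m101 m001,
      face_zero S h0 _ _ _ _ m001 m101 m111 m011, face_zero S h0 _ _ _ _ m000 m100 m110 m010]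
    simp

lemma tele (g : ℕ → ZMod 2) (N : ℕ) : ∑ i ∈ range N, (g (i + 1) + g i) = g N + g 0 := by
  induction N with
  | zero => simp; linear_combination -(g 0) * two0
  | succ N ih => rw [sum_range_succ, ih]; linear_combination (g N) * two0

lemma psi_sum4 (x y : Lb) (h : y ≠ lneg x) :
    psi x y + psi (la x) (la y) + psi (la (la x)) (la (la y)) +
      psi (la (la (la x))) (la (la (la y))) = phi y + phi x := by
  revert x y; decide

lemma psi_sum2 (x y : Lb) (h : y ≠ lneg x) :
    psi x y + psi (lsw (la x)) (lsw (la y)) = chi y + chi x := by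
  revert x y; decide

lemma phi_la (x : Lb) : phi (la x) + phi x = 1 := by revert x; decide
lemma chi_sa (x : Lb) : chi (lsw (la x)) + chi x = 0 := by revert x; decide

theorem comb (n m : ℕ) (v : ℕ → ℕ → ℕ → Lb) (w : ℕ → Lb)
    (H : ∀ i j k, i < 4 * n → j < m → k < n →
      ∀ a b c a' b' c', a ≤ 1 → b ≤ 1 → c ≤ 1 → a' ≤ 1 → b' ≤ 1 → c' ≤ 1 →
      v (i + a') (j + b') (k + c') ≠ lneg (v (i + a) (j + b) (k + c)))
    (hn : 0 < n) (hm : 0 < m)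
    (hper : ∀ j k, j ≤ m → k ≤ n → v (4 * n) j k = v 0 j k)
    (htop : ∀ i j, i ≤ 4 * n → j ≤ m → v i j n = la (v i j 0))
    (hin : ∀ i k, i ≤ 4 * n → k ≤ n → v i 0 k = w (i + k))
    (hout : ∀ i k, i ≤ 2 * n → k ≤ n → v (i + 2 * n) m (n - k) = lsw (v i m k)) : False := by
  let X : ℕ → ℕ → ℕ → ZMod 2 := fun i j k =>
    NP (v i j k) (v i (j+1) k) (v i (j+1) (k+1)) (v i j (k+1))
  let Y : ℕ → ℕ → ℕ → ZMod 2 := fun i j k =>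
    NP (v i j k) (v (i+1) j k) (v (i+1) j (k+1)) (v i j (k+1))
  let Z : ℕ → ℕ → ℕ → ZMod 2 := fun i j k =>
    NP (v i j k) (v (i+1) j k) (v (i+1) (j+1) k) (v i (j+1) k)
  have tot : ∑ i ∈ range (4 * n), ∑ j ∈ range m, ∑ k ∈ range n,
      ((X (i+1) j k + X i j k) + (Y i (j+1) k + Y i j k) + (Z i j (k+1) + Z i j k)) = 0 := by
    apply sum_eq_zero; intro i hi
    apply sum_eq_zero; intro j hj
    apply sum_eq_zero; intro k hk
    exact cube v i j k (H i j k (mem_range.1 hi) (mem_range.1 hj) (mem_range.1 hk))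
  simp only [sum_add_distrib] at tot
  have eX : ∑ i ∈ range (4 * n), ∑ j ∈ range m, ∑ k ∈ range n, X (i+1) j k +
      ∑ i ∈ range (4 * n), ∑ j ∈ range m, ∑ k ∈ range n, X i j k = 0 := by
    rw [← sum_add_distrib, tele (fun i => ∑ j ∈ range m, ∑ k ∈ range n, X i j k)]
    have : ∑ j ∈ range m, ∑ k ∈ range n, X (4 * n) j k = ∑ j ∈ range m, ∑ k ∈ range n, X 0 j k := by
      apply sum_congr rfl; intro j hj
      apply sum_congr rfl; intro k hk
      have hj := mem_range.1 hj
      have hk := mem_range.1 hk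
      simp only [X]
      rw [hper _ _ (by omega) (by omega), hper _ _ (by omega) (by omega),
        hper _ _ (by omega) (by omega), hper _ _ (by omega) (by omega)]
    simp only [this]
    linear_combination (∑ j ∈ range m, ∑ k ∈ range n, X 0 j k) * two0
  have eY : ∑ i ∈ range (4 * n), ∑ j ∈ range m, ∑ k ∈ range n, Y i (j+1) k +
      ∑ i ∈ range (4 * n), ∑ j ∈ range m, ∑ k ∈ range n, Y i j k = 0 := by
    have e1 : ∀ i ∈ range (4 * n), ∑ j ∈ range m, ∑ k ∈ range n, Y i (j+1) k +
        ∑ j ∈ range m, ∑ k ∈ range n, Y i j k = ∑ k ∈ range n, Y i m k := by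
      intro i hi
      have hi := mem_range.1 hi
      rw [← sum_add_distrib, tele (fun j => ∑ k ∈ range n, Y i j k)]
      have : ∑ k ∈ range n, Y i 0 k = 0 := by
        apply sum_eq_zero; intro k hk
        have hk := mem_range.1 hk
        simp only [Y]
        rw [hin _ _ (by omega) (by omega), hin _ _ (by omega) (by omega),
          hin _ _ (by omega) (by omega), hin _ _ (by omega) (by omega)]
        have e : i + 1 + k = i + (k + 1) := by ring
        rw [e]
        simp only [NP, cyc]
        split_ifs
        · rw [ce_symm _ _ (w (i + 1 + (k+1))), ce_symm _ _ (w (i + (k+1))) (w (i + k))]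
          linear_combination (ce (1, true) (2, true) (w (i + k)) (w (i + (k+1))) +
            ce (1, true) (2, true) (w (i + (k+1))) (w (i + 1 + (k+1)))) * two0
        · rfl
      rw [this, add_zero]
    rw [← sum_add_distrib, sum_congr rfl e1]
    have e4 : 4 * n = 2 * n + 2 * n := by ring
    rw [e4, sum_range_add, ← sum_add_distrib]
    apply sum_eq_zero; intro i hi
    have hi := mem_range.1 hi
    rw [← sum_range_reflect (fun k => Y (2 * n + i) m k), ← sum_add_distrib]
    apply sum_eq_zero; intro k hk
    have hk := mem_range.1 hk
    have : Y (2 * n + i) m (n - 1 - k) = Y i m k := by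
      simp only [Y]
      have a1 : 2 * n + i = i + 2 * n := by ring
      have a2 : i + 2 * n + 1 = (i + 1) + 2 * n := by ring
      have a3 : n - 1 - k = n - (k + 1) := by omega
      have a4 : n - (k + 1) + 1 = n - k := by omega
      rw [a1, a2, a3, a4, hout _ _ (by omega) (by omega), hout _ _ (by omega) (by omega),
        hout _ _ (by omega) (by omega), hout _ _ (by omega) (by omega), NP_lsw, NP_rev]
    rw [this]
    linear_combination (Y i m k) * two0
  have eZ : ∑ i ∈ range (4 * n), ∑ j ∈ range m, ∑ k ∈ range n, Z i j (k+1) +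
      ∑ i ∈ range (4 * n), ∑ j ∈ range m, ∑ k ∈ range n, Z i j k = 1 := by
    rw [← sum_add_distrib]
    have e1 : ∀ i ∈ range (4 * n), ∑ j ∈ range m, ∑ k ∈ range n, Z i j (k+1) +
        ∑ j ∈ range m, ∑ k ∈ range n, Z i j k =
        ∑ j ∈ range m, ((psi (v i (j+1) 0) (v (i+1) (j+1) 0) + psi (v i j 0) (v (i+1) j 0)) +
          (psi (v (i+1) j 0) (v (i+1) (j+1) 0) + psi (v i j 0) (v i (j+1) 0))) := by
      intro i hi
      have hi := mem_range.1 hi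
      rw [← sum_add_distrib]
      apply sum_congr rfl; intro j hj
      have hj := mem_range.1 hj
      rw [← sum_add_distrib, tele (fun k => Z i j k)]
      simp only [Z]
      rw [htop _ _ (by omega) (by omega), htop _ _ (by omega) (by omega),
        htop _ _ (by omega) (by omega), htop _ _ (by omega) (by omega), NP_la, add_comm]
      have h := H i j 0 hi hj hn
      rw [cell]
      · simp only [cyc]
        rw [psi_symm (v (i+1) (j+1) 0), psi_symm (v i (j+1) 0) (v i j 0)]
        ring
      · exact h 0 0 0 1 0 0 (by simp) (by simp) (by simp) (by simp) (by simp) (by simp)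
      · exact h 0 0 0 1 1 0 (by simp) (by simp) (by simp) (by simp) (by simp) (by simp)
      · exact h 0 0 0 0 1 0 (by simp) (by simp) (by simp) (by simp) (by simp) (by simp)
      · exact h 1 0 0 1 1 0 (by simp) (by simp) (by simp) (by simp) (by simp) (by simp)
      · exact h 1 0 0 0 1 0 (by simp) (by simp) (by simp) (by simp) (by simp) (by simp)
      · exact h 1 1 0 0 1 0 (by simp) (by simp) (by simp) (by simp) (by simp) (by simp)
    rw [sum_congr rfl e1]
    have e2 : ∀ i, ∑ j ∈ range m,
        ((psi (v i (j+1) 0) (v (i+1) (j+1) 0) + psi (v i j 0) (v (i+1) j 0)) +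
          (psi (v (i+1) j 0) (v (i+1) (j+1) 0) + psi (v i j 0) (v i (j+1) 0))) =
        (psi (v i m 0) (v (i+1) m 0) + psi (v i 0 0) (v (i+1) 0 0)) +
          (∑ j ∈ range m, psi (v (i+1) j 0) (v (i+1) (j+1) 0) +
            ∑ j ∈ range m, psi (v i j 0) (v i (j+1) 0)) := by
      intro i
      rw [sum_add_distrib, tele (fun j => psi (v i j 0) (v (i+1) j 0)), sum_add_distrib]
    simp only [e2]
    rw [sum_add_distrib, tele (fun i => ∑ j ∈ range m, psi (v i j 0) (v i (j+1) 0))]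
    have e3 : ∑ j ∈ range m, psi (v (4 * n) j 0) (v (4 * n) (j+1) 0) =
        ∑ j ∈ range m, psi (v 0 j 0) (v 0 (j+1) 0) := by
      apply sum_congr rfl; intro j hj
      have hj := mem_range.1 hj
      rw [hper _ _ (by omega) (by omega), hper _ _ (by omega) (by omega)]
    simp only [e3]
    rw [sum_add_distrib]
    have e5 : ∑ i ∈ range (4 * n), psi (v i 0 0) (v (i+1) 0 0) = 1 := by
      have e : ∀ i ∈ range (4 * n), psi (v i 0 0) (v (i+1) 0 0) = psi (w i) (w (i+1)) := by
        intro i hi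
        have hi := mem_range.1 hi
        rw [hin _ _ (by omega) (by omega), hin _ _ (by omega) (by omega)]; rfl
      rw [sum_congr rfl e]
      have hw : ∀ i, i ≤ 4 * n → w (n + i) = la (w i) := by
        intro i hi
        have h1 := htop i 0 hi (by omega)
        rw [hin _ _ hi (by omega), hin _ _ hi (by omega)] at h1
        rw [add_comm]; simpa using h1
      have e4 : 4 * n = n + (n + (n + n)) := by ring
      rw [e4, sum_range_add, sum_range_add, sum_range_add, ← sum_add_distrib, ← sum_add_distrib,
        ← sum_add_distrib]
      have : ∀ i ∈ range n, psi (w i) (w (i+1)) + (psi (w (n+i)) (w (n+i+1)) +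
          (psi (w (n+(n+i))) (w (n+(n+i)+1)) + psi (w (n+(n+(n+i)))) (w (n+(n+(n+i))+1)))) =
          phi (w (i+1)) + phi (w i) := by
        intro i hi
        have hi := mem_range.1 hi
        rw [← psi_sum4]
        · have r : ∀ x, n + x + 1 = n + (x + 1) := by intro x; ring
          simp only [r]
          rw [hw (n+(n+(i+1))) (by omega), hw (n+(n+i)) (by omega), hw (n+(i+1)) (by omega),
            hw (n+i) (by omega), hw (i+1) (by omega), hw i (by omega)]
          ring
        · have h := H i 0 0 (by omega) hm hn 0 0 0 1 0 0 (by simp) (by simp) (by simp) (by simp)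
            (by simp) (by simp)
          simp only [add_zero] at h
          rw [hin _ _ (by omega) (by omega), hin _ _ (by omega) (by omega)] at h
          exact h
      rw [sum_congr rfl this, tele (fun i => phi (w i))]
      have := hw 0 (by omega)
      rw [add_zero] at this
      rw [this, phi_la]
    have e6 : ∑ i ∈ range (4 * n), psi (v i m 0) (v (i+1) m 0) = 0 := by
      have e4 : 4 * n = 2 * n + 2 * n := by ring
      have hb : ∀ i, i ≤ 2 * n → v (2 * n + i) m 0 = lsw (la (v i m 0)) := by
        intro i hi
        rw [← htop i m (by omega) le_rfl, ← hout i n hi le_rfl, add_comm, Nat.sub_self]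
      rw [e4, sum_range_add, ← sum_add_distrib]
      have : ∀ i ∈ range (2 * n), psi (v i m 0) (v (i+1) m 0) +
          psi (v (2*n+i) m 0) (v (2*n+i+1) m 0) = chi (v (i+1) m 0) + chi (v i m 0) := by
        intro i hi
        have hi := mem_range.1 hi
        rw [← psi_sum2]
        · rw [add_assoc (2 * n), hb i (by omega), hb (i+1) (by omega)]
        · have h := H i (m-1) 0 (by omega) (by omega) hn 0 1 0 1 1 0 (by simp) (by simp) (by simp)
            (by simp) (by simp) (by simp)
          have hm' : m - 1 + 1 = m := by omega
          simpa [hm'] using h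
      rw [sum_congr rfl this, tele (fun i => chi (v i m 0))]
      have := hb 0 (by omega)
      rw [add_zero] at this
      simp only [this, chi_sa]
    rw [e5, e6]
    linear_combination (∑ j ∈ range m, psi (v 0 j 0) (v 0 (j+1) 0)) * two0
  rw [eX, eY, eZ] at tot
  simp at tot

end EqP

namespace EqP
open Finset

lemma la4 (x : Lb) : la (la (la (la x))) = x := by revert x; decide
lemma lsw2 (x : Lb) : lsw (lsw x) = x := by revert x; decide
lemma la_sw_la (x : Lb) : la (lsw (la x)) = lsw x := by revert x; decide

lemma labeling (n m : ℕ) (hn : 0 < n) (hm : 0 < m) (V : ℕ → ℕ → ℕ → Lb → Prop)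
    (V0 : ℕ → Lb → Prop)
    (ex : ∀ i j k, i ≤ 4 * n → j ≤ m → k ≤ n → ∃ c, V i j k c)
    (ex0 : ∀ x, ∃ c, V0 x c)
    (V0a : ∀ x c, V0 x c → V0 (x + n) (la c))
    (Vin : ∀ i k c, i ≤ 4 * n → k ≤ n → V0 (i + k) c → V i 0 k c)
    (Vper : ∀ j k c, V 0 j k c → V (4 * n) j k c)
    (Vtop : ∀ i j c, V i j 0 c → V i j n (la c))
    (Vout : ∀ i k c, i ≤ 2 * n → k ≤ n → V i m k c → V (i + 2 * n) m (n - k) (lsw c))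
    (Vadj : ∀ i j k, i < 4 * n → j < m → k < n →
      ∀ a b c a' b' c', a ≤ 1 → b ≤ 1 → c ≤ 1 → a' ≤ 1 → b' ≤ 1 → c' ≤ 1 →
      ∀ x y, V (i + a) (j + b) (k + c) x → V (i + a') (j + b') (k + c') y → y ≠ lneg x) :
    False := by
  have ex' : ∃ l : ℕ → ℕ → ℕ → Lb, ∀ i j k, i ≤ 4 * n → j ≤ m → k ≤ n → V i j k (l i j k) := by
    have : ∀ i j k, ∃ c, i ≤ 4 * n → j ≤ m → k ≤ n → V i j k c := by
      intro i j k
      by_cases h : i ≤ 4 * n ∧ j ≤ m ∧ k ≤ n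
      · obtain ⟨c, hc⟩ := ex i j k h.1 h.2.1 h.2.2
        exact ⟨c, fun _ _ _ => hc⟩
      · exact ⟨(0, true), fun h1 h2 h3 => absurd ⟨h1, h2, h3⟩ h⟩
    choose l hl using this
    exact ⟨l, hl⟩
  obtain ⟨l, hl⟩ := ex'
  choose l0 hl0 using ex0
  let A : ℕ → ℕ → ℕ → Lb := fun i j k => if k = n then la (l i j 0) else l i j k
  have hA : ∀ i j k, i ≤ 4 * n → j ≤ m → k ≤ n → V i j k (A i j k) := by
    intro i j k hi hj hk
    simp only [A]
    split_ifs with h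
    · subst h; exact Vtop _ _ _ (hl i j 0 hi hj (by omega))
    · exact hl i j k hi hj hk
  have A0 : ∀ i j, A i j n = la (A i j 0) := by
    intro i j
    have : ¬ (0 = n) := by omega
    simp [A, this]
  let w : ℕ → Lb := fun x => la^[x / n] (l0 (x % n))
  have wn : ∀ x, w (x + n) = la (w x) := by
    intro x
    simp only [w]
    rw [Nat.add_div_right _ hn, Nat.add_mod_right, Function.iterate_succ_apply']
  have w4 : ∀ x, w (4 * n + x) = w x := by
    intro x
    have : 4 * n + x = x + n + n + n + n := by ring
    rw [this, wn, wn, wn, wn, la4]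
  have hw : ∀ x, V0 x (w x) := by
    intro x
    have : ∀ q y, V0 (y + n * q) (la^[q] (l0 y)) := by
      intro q y
      induction q with
      | zero => simpa using hl0 y
      | succ q ih =>
        rw [Function.iterate_succ_apply']
        have := V0a _ _ ih
        rwa [show y + n * q + n = y + n * (q + 1) by ring] at this
    have h := this (x / n) (x % n)
    rwa [Nat.mod_add_div] at h
  let v : ℕ → ℕ → ℕ → Lb := fun i j k =>
    if j = 0 then w (i + k)
    else if j = m then
      (if i % (4 * n) < 2 * n then A (i % (4 * n)) m k else lsw (A (i % (4 * n) - 2 * n) m (n - k)))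
    else A (i % (4 * n)) j k
  have hper' : ∀ j k, v (4 * n) j k = v 0 j k := by
    intro j k
    simp only [v, Nat.mod_self, Nat.zero_mod, w4, zero_add]
    try rfl
  have hmod : ∀ i, i < 4 * n → i % (4 * n) = i := fun i hi => Nat.mod_eq_of_lt hi
  have hv1 : ∀ i j k, i < 4 * n → j ≤ m → k ≤ n → V i j k (v i j k) := by
    intro i j k hi hj hk
    simp only [v]
    rw [hmod i hi]
    split_ifs with h1 h2 h3
    · subst h1; exact Vin _ _ _ hi.le hk (hw _)
    · subst h2; exact hA _ _ _ hi.le le_rfl hk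
    · subst h2
      have := Vout (i - 2 * n) (n - k) _ (by omega) (by omega)
        (hA (i - 2 * n) j (n - k) (by omega) le_rfl (by omega))
      rwa [show i - 2 * n + 2 * n = i by omega, show n - (n - k) = k by omega] at this
    · exact hA _ _ _ hi.le hj hk
  have hv : ∀ i j k, i ≤ 4 * n → j ≤ m → k ≤ n → V i j k (v i j k) := by
    intro i j k hi hj hk
    rcases hi.lt_or_eq with h | h
    · exact hv1 i j k h hj hk
    · subst h
      rw [hper']
      exact Vper _ _ _ (hv1 0 j k (by omega) hj hk)
  refine comb n m v w ?_ hn hm (fun j k _ _ => hper' j k) ?_ ?_ ?_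
  · intro i j k hi hj hk a b c a' b' c' ha hb hc ha' hb' hc'
    exact Vadj i j k hi hj hk a b c a' b' c' ha hb hc ha' hb' hc' _ _
      (hv _ _ _ (by omega) (by omega) (by omega)) (hv _ _ _ (by omega) (by omega) (by omega))
  · intro i j hi hj
    simp only [v]
    split_ifs with h1 h2 h3
    · rw [wn, add_zero]
    · exact A0 _ _
    · rw [Nat.sub_self, Nat.sub_zero, A0, la_sw_la]
    · exact A0 _ _
  · intro i k hi hk
    simp [v]
  · intro i k hi hk
    have hm0 : m ≠ 0 := by omega
    rcases hi.lt_or_eq with h | h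
    · simp only [v, if_neg hm0, if_true]
      rw [hmod i (by omega), hmod (i + 2 * n) (by omega), if_neg (by omega), if_pos (by omega),
        show i + 2 * n - 2 * n = i by omega, show n - (n - k) = k by omega]
    · subst h
      rw [show 2 * n + 2 * n = 4 * n by ring, hper']
      simp only [v, if_neg hm0, if_true]
      rw [hmod (2 * n) (by omega), if_neg (by omega : ¬ (2 * n < 2 * n)), Nat.zero_mod,
        if_pos (by omega), Nat.sub_self, lsw2]

def comp (f g : ℝ → ℝ → ℝ → ℝ) (s r t : ℝ) (c : Lb) : ℝ :=
  (if c.2 then 1 else -1) * (if c.1 = 0 then f s r t else if c.1 = 1 then g s r t else g s r (t+1))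

theorem core (f g : ℝ → ℝ → ℝ → ℝ)
    (hf : Continuous fun x : ℝ × ℝ × ℝ => f x.1 x.2.1 x.2.2)
    (hg : Continuous fun x : ℝ × ℝ × ℝ => g x.1 x.2.1 x.2.2)
    (fper : ∀ s r t, f (s + 4) r t = f s r t) (gper : ∀ s r t, g (s + 4) r t = g s r t)
    (ft : ∀ s r t, f s r (t + 1) = - f s r t) (gt : ∀ s r t, g s r (t + 2) = - g s r t)
    (f0 : ∀ s t, f s 0 t = f 0 0 (s + t)) (g0 : ∀ s t, g s 0 t = g 0 0 (s + t))
    (f1 : ∀ s t, f (s + 2) 1 t = - f s 1 (-t)) (g1 : ∀ s t, g (s + 2) 1 t = - g s 1 (-t)) :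
    ∃ s r t, f s r t = 0 ∧ g s r t = 0 ∧ g s r (t + 1) = 0 := by
  by_contra! hno
  -- the compact box
  let B : Set (ℝ × ℝ × ℝ) := Set.Icc 0 5 ×ˢ (Set.Icc 0 2 ×ˢ Set.Icc 0 5)
  have hB : IsCompact B := isCompact_Icc.prod (isCompact_Icc.prod isCompact_Icc)
  let C : ℝ × ℝ × ℝ → Lb → ℝ := fun x c => comp f g x.1 x.2.1 x.2.2 c
  have hC : ∀ c, Continuous fun x => C x c := by
    intro c
    simp only [C, comp]
    have hg' : Continuous fun x : ℝ × ℝ × ℝ => g x.1 x.2.1 (x.2.2 + 1) :=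
      hg.comp (by fun_prop : Continuous fun x : ℝ × ℝ × ℝ => (x.1, x.2.1, x.2.2 + 1))
    split_ifs <;> fun_prop
  let h : ℝ × ℝ × ℝ → ℝ := fun x => max |f x.1 x.2.1 x.2.2| (max |g x.1 x.2.1 x.2.2| |g x.1 x.2.1 (x.2.2+1)|)
  have hh : Continuous h := by
    have hg' : Continuous fun x : ℝ × ℝ × ℝ => g x.1 x.2.1 (x.2.2 + 1) :=
      hg.comp (by fun_prop : Continuous fun x : ℝ × ℝ × ℝ => (x.1, x.2.1, x.2.2 + 1))
    exact hf.abs.max (hg.abs.max hg'.abs)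
  have hpos : ∀ x, 0 < h x := by
    intro x
    simp only [h, lt_max_iff, abs_pos]
    by_contra! hc
    exact hno _ _ _ hc.1 hc.2.1 hc.2.2
  have hBne : B.Nonempty := ⟨(0, 0, 0), by simp [B]⟩
  obtain ⟨x0, -, hx0⟩ := hB.exists_isMinOn hBne hh.continuousOn
  set δ := h x0 with hδ
  have δpos : 0 < δ := hpos x0
  have hex : ∀ x ∈ B, ∃ c, δ ≤ C x c := by
    intro x hx
    have h1 : δ ≤ h x := hx0 hx
    simp only [h, le_max_iff, le_abs] at h1
    rcases h1 with (h1 | h1) | (h1 | h1) | (h1 | h1)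
    · exact ⟨(0, true), by simpa [C, comp] using h1⟩
    · exact ⟨(0, false), by simpa [C, comp] using h1⟩
    · exact ⟨(1, true), by simpa [C, comp] using h1⟩
    · exact ⟨(1, false), by simpa [C, comp] using h1⟩
    · exact ⟨(2, true), by simpa [C, comp] using h1⟩
    · exact ⟨(2, false), by simpa [C, comp] using h1⟩
  have hCneg : ∀ x c, C x (lneg c) = - C x c := by
    intro x c
    rcases c with ⟨c1, c2⟩
    fin_cases c1 <;> cases c2 <;> simp [C, comp, lneg]
  have huc : ∃ η > 0, ∀ c, ∀ x ∈ B, ∀ y ∈ B, dist x y < η → dist (C x c) (C y c) < δ := by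
    have : ∀ c, ∃ η > 0, ∀ x ∈ B, ∀ y ∈ B, dist x y < η → dist (C x c) (C y c) < δ := by
      intro c
      have := hB.uniformContinuousOn_of_continuous (hC c).continuousOn
      rw [Metric.uniformContinuousOn_iff] at this
      exact this δ δpos
    choose η hη hη' using this
    refine ⟨Finset.univ.inf' Finset.univ_nonempty η, ?_, ?_⟩
    · exact (Finset.lt_inf'_iff _).2 fun c _ => hη c
    · intro c x hx y hy hxy
      exact hη' c x hx y hy (hxy.trans_le (Finset.inf'_le _ (Finset.mem_univ c)))
  obtain ⟨η, ηpos, huc⟩ := huc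
  obtain ⟨n, hn⟩ := exists_nat_gt (1 / η)
  have hnpos' : (0 : ℝ) < n := (one_div_pos.2 ηpos).trans hn
  have hnpos : 0 < n := by exact_mod_cast hnpos'
  have hn1 : 1 / (n : ℝ) < η := by
    rw [div_lt_iff₀ hnpos']; rw [div_lt_iff₀ ηpos] at hn; linarith
  let P : ℕ → ℕ → ℕ → ℝ × ℝ × ℝ := fun i j k => ((i : ℝ) / n, (j : ℝ) / n, (k : ℝ) / n)
  have PB : ∀ i j k, i ≤ 4 * n → j ≤ n → k ≤ n → P i j k ∈ B := by
    intro i j k hi hj hk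
    have hi' : (i : ℝ) ≤ 4 * n := by exact_mod_cast hi
    have hj' : (j : ℝ) ≤ n := by exact_mod_cast hj
    have hk' : (k : ℝ) ≤ n := by exact_mod_cast hk
    simp only [P, B, Set.mem_prod, Set.mem_Icc]
    refine ⟨⟨by positivity, ?_⟩, ⟨by positivity, ?_⟩, ⟨by positivity, ?_⟩⟩ <;>
      rw [div_le_iff₀ hnpos'] <;> linarith
  have ctop : ∀ s r t c, comp f g s r (t + 1) (la c) = comp f g s r t c := by
    intro s r t c
    have e : t + 1 + 1 = t + 2 := by ring
    rcases c with ⟨c1, c2⟩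
    fin_cases c1 <;> cases c2 <;> simp [comp, la, ft, e, gt]
  have cper : ∀ s r t c, comp f g (s + 4) r t c = comp f g s r t c := by
    intro s r t c
    simp [comp, fper, gper]
  have c0 : ∀ s t c, comp f g s 0 t c = comp f g 0 0 (s + t) c := by
    intro s t c
    simp only [comp]
    rw [f0 s, g0 s, g0 s, add_assoc]
  have cout : ∀ s t c, comp f g (s + 2) 1 (1 - t) (lsw c) = comp f g s 1 t c := by
    intro s t c
    have a1 : f (s + 2) 1 (1 - t) = f s 1 t := by
      rw [f1, show t = -(1 - t) + 1 by ring, ft]; ring_nf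
    have a2 : g (s + 2) 1 (1 - t) = g s 1 (t + 1) := by
      rw [g1, show t + 1 = -(1 - t) + 2 by ring, gt]
    have a3 : g (s + 2) 1 (1 - t + 1) = g s 1 t := by
      rw [g1]
      conv_rhs => rw [show t = -(1 - t + 1) + 2 by ring, gt]
    rcases c with ⟨c1, c2⟩
    fin_cases c1 <;> cases c2 <;> simp [comp, lsw, a1, a2, a3]
  have hnn : (n : ℝ) / n = 1 := div_self hnpos'.ne'
  refine labeling n n hnpos hnpos (fun i j k c => δ ≤ C (P i j k) c)
    (fun x c => δ ≤ comp f g 0 0 ((x : ℝ) / n) c) ?_ ?_ ?_ ?_ ?_ ?_ ?_ ?_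
  · intro i j k hi hj hk
    exact hex _ (PB i j k hi hj hk)
  · intro x
    -- reduce modulo `n`
    have key : ∀ q y, y < n → ∃ c, δ ≤ comp f g 0 0 (((y + n * q : ℕ) : ℝ) / n) c := by
      intro q y hy
      induction q with
      | zero =>
        obtain ⟨c, hc⟩ := hex _ (PB 0 0 y (by omega) (by omega) hy.le)
        exact ⟨c, by simpa [C, P] using hc⟩
      | succ q ih =>
        obtain ⟨c, hc⟩ := ih
        refine ⟨la c, ?_⟩
        have : ((y + n * (q + 1) : ℕ) : ℝ) / n = ((y + n * q : ℕ) : ℝ) / n + 1 := by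
          push_cast; field_simp; ring
        rw [this, ctop]; exact hc
    have := key (x / n) (x % n) (Nat.mod_lt _ hnpos)
    rwa [Nat.mod_add_div] at this
  · intro x c hc
    have : ((x + n : ℕ) : ℝ) / n = (x : ℝ) / n + 1 := by push_cast; field_simp
    simp only [this, ctop]; exact hc
  · intro i k c hi hk hc
    simp only [C, P]
    rw [Nat.cast_zero, zero_div, c0, ← add_div]
    exact_mod_cast hc
  · intro j k c hc
    simp only [C, P] at hc ⊢
    have : ((4 * n : ℕ) : ℝ) / n = ((0 : ℕ) : ℝ) / n + 4 := by push_cast; field_simp; ring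
    rw [this, cper]; exact hc
  · intro i j c hc
    simp only [C, P] at hc ⊢
    have : (n : ℝ) / n = ((0 : ℕ) : ℝ) / n + 1 := by push_cast; field_simp; ring
    rw [this, ctop]; exact hc
  · intro i k c hi hk hc
    simp only [C, P] at hc ⊢
    have e1 : ((i + 2 * n : ℕ) : ℝ) / n = (i : ℝ) / n + 2 := by push_cast; field_simp
    have e2 : ((n - k : ℕ) : ℝ) / n = 1 - (k : ℝ) / n := by
      rw [Nat.cast_sub hk, sub_div, hnn]
    rw [e1, e2, hnn, cout]
    rwa [hnn] at hc
  · intro i j k hi hj hk a b c a' b' c' ha hb hc ha' hb' hc' x y hx hy hxy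
    subst hxy
    rw [hCneg] at hy
    have hd : dist (P (i + a) (j + b) (k + c)) (P (i + a') (j + b') (k + c')) < η := by
      refine lt_of_le_of_lt ?_ hn1
      have key : ∀ i a a' : ℕ, a ≤ 1 → a' ≤ 1 →
          dist (((i + a : ℕ) : ℝ) / n) (((i + a' : ℕ) : ℝ) / n) ≤ 1 / n := by
        intro i a a' ha ha'
        rw [Real.dist_eq, ← sub_div, abs_div, abs_of_pos hnpos']
        apply div_le_div_of_nonneg_right _ hnpos'.le
        interval_cases a <;> interval_cases a' <;> simp
      simp only [P, Prod.dist_eq]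
      exact max_le (key i a a' ha ha') (max_le (key j b b' hb hb') (key k c c' hc hc'))
    have h1 := huc x _ (PB _ _ _ (by omega) (by omega) (by omega)) _
      (PB _ _ _ (by omega) (by omega) (by omega)) hd
    rw [Real.dist_eq] at h1
    have := (abs_lt.1 h1).2
    linarith

end EqP

namespace EqP
open MeasureTheory Set Filter Topology
open scoped RealInnerProductSpace

abbrev E3 := EuclideanSpace ℝ (Fin 3)

noncomputable def sg (x : ℝ) : ℝ := ((SignType.sign x : SignType) : ℝ)

lemma sg_pos {x : ℝ} (h : 0 < x) : sg x = 1 := by simp [sg, sign_pos h]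
lemma sg_neg' {x : ℝ} (h : x < 0) : sg x = -1 := by simp [sg, sign_neg h]
lemma sg_zero : sg 0 = 0 := by simp [sg]
lemma sg_neg (x : ℝ) : sg (-x) = - sg x := by
  rcases lt_trichotomy x 0 with h | h | h
  · rw [sg_neg' h, sg_pos (by linarith)]; norm_num
  · subst h; simp [sg_zero]
  · rw [sg_pos h, sg_neg' (by linarith)]
lemma sg_mul_pos {c : ℝ} (hc : 0 < c) (x : ℝ) : sg (c * x) = sg x := by
  rcases lt_trichotomy x 0 with h | h | h
  · rw [sg_neg' h, sg_neg' (by nlinarith)]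
  · subst h; simp [sg_zero]
  · rw [sg_pos h, sg_pos (by positivity)]
lemma sg_abs_le (x : ℝ) : |sg x| ≤ 1 := by
  rcases lt_trichotomy x 0 with h | h | h
  · rw [sg_neg' h]; norm_num
  · subst h; simp [sg_zero]
  · rw [sg_pos h]; norm_num
lemma sg_mono : Monotone sg := by
  intro x y h
  rcases lt_trichotomy x 0 with h1 | h1 | h1 <;> rcases lt_trichotomy y 0 with h2 | h2 | h2 <;>
  simp [sg_neg', sg_pos, sg_zero, h1, h2] <;> linarith
lemma sg_meas : Measurable sg := sg_mono.measurable
lemma sg_cont {x : ℝ} (h : x ≠ 0) : ContinuousAt sg x := by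
  rcases lt_or_gt_of_ne h with h | h
  · have : sg =ᶠ[𝓝 x] fun _ => -1 := by
      filter_upwards [Iio_mem_nhds h] with y hy using sg_neg' hy
    exact (continuousAt_congr this).2 continuousAt_const
  · have : sg =ᶠ[𝓝 x] fun _ => 1 := by
      filter_upwards [Ioi_mem_nhds h] with y hy using sg_pos hy
    exact (continuousAt_congr this).2 continuousAt_const
lemma sg_sq {x : ℝ} (h : x ≠ 0) : sg x * sg x = 1 := by
  rcases lt_or_gt_of_ne h with h | h
  · rw [sg_neg' h]; norm_num
  · rw [sg_pos h]; norm_num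

structure Body (K : Set E3) : Prop where
  comp : IsCompact K
  conv : Convex ℝ K
  symm : ∀ x ∈ K, -x ∈ K
  nhds0 : K ∈ 𝓝 (0 : E3)

lemma body_of (K : Set E3)
    (hKcomp : IsCompact K) (hKconv : Convex ℝ K) (hKsymm : K = -K)
    (hKint : (interior K).Nonempty) : Body K := by
  have hs : ∀ x ∈ K, -x ∈ K := by
    intro x hx
    rw [hKsymm] at hx
    exact hx
  refine ⟨hKcomp, hKconv, hs, ?_⟩
  obtain ⟨x, hx⟩ := hKint
  have hnx : -x ∈ K := hs x (interior_subset hx)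
  rw [← mem_interior_iff_mem_nhds]
  have := hKconv.combo_interior_self_mem_interior hx hnx (a := 1/2) (b := 1/2) (by norm_num)
    (by norm_num) (by norm_num)
  simpa using this

noncomputable def F (K : Set E3) (u v : E3) : ℝ := ∫ x in K, sg ⟪u,x⟫ * sg ⟪v,x⟫

lemma F_symm (K) (u v) : F K u v = F K v u := by simp only [F, mul_comm]
lemma F_neg_right (K) (u v) : F K u (-v) = - F K u v := by
  simp only [F, inner_neg_left, sg_neg, mul_neg, integral_neg]
lemma F_neg_left (K) (u v) : F K (-u) v = - F K u v := by
  rw [F_symm, F_neg_right, F_symm]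
lemma F_smul (K) (u v) {c : ℝ} (hc : 0 < c) : F K u (c • v) = F K u v := by
  simp only [F, real_inner_smul_left, sg_mul_pos hc]

lemma hyper_null {u : E3} (hu : u ≠ 0) : volume {x : E3 | ⟪u, x⟫ = 0} = 0 := by
  have := Measure.addHaar_submodule (volume : Measure E3) (LinearMap.ker (innerSL ℝ u).toLinearMap)
    (by
      intro h
      have h2 : u ∈ LinearMap.ker (innerSL ℝ u).toLinearMap := by rw [h]; trivial
      simp at h2
      exact hu h2)
  convert this using 2
  ext x; simp

lemma F_meas (u v : E3) : Measurable fun x : E3 => sg ⟪u,x⟫ * sg ⟪v,x⟫ := by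
  apply Measurable.mul
  · exact sg_meas.comp (by fun_prop)
  · exact sg_meas.comp (by fun_prop)

lemma F_bound (u v x : E3) : ‖sg ⟪u,x⟫ * sg ⟪v,x⟫‖ ≤ 1 := by
  rw [norm_mul]
  exact mul_le_one₀ (sg_abs_le _) (norm_nonneg _) (sg_abs_le _)

lemma F_int {K} (hK : Body K) (u v : E3) : IntegrableOn (fun x : E3 => sg ⟪u,x⟫ * sg ⟪v,x⟫) K := by
  apply Measure.integrableOn_of_bounded (M := 1) hK.comp.measure_lt_top.ne
    (F_meas u v).aestronglyMeasurable
  exact Eventually.of_forall fun x => F_bound u v x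

lemma F_cont {K} (hK : Body K) {u v : E3} (hu : u ≠ 0) (hv : v ≠ 0) :
    ContinuousAt (fun w : E3 × E3 => F K w.1 w.2) (u, v) := by
  unfold F
  apply continuousAt_of_dominated (bound := fun _ => 1)
  · exact Eventually.of_forall fun w => (F_meas _ _).aestronglyMeasurable
  · exact Eventually.of_forall fun w => Eventually.of_forall fun x => F_bound _ _ x
  · exact integrableOn_const hK.comp.measure_lt_top.ne
  · apply ae_restrict_of_ae
    have h1 : ∀ᵐ x : E3, ⟪u, x⟫ ≠ 0 := by
      rw [ae_iff]; simpa using hyper_null hu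
    have h2 : ∀ᵐ x : E3, ⟪v, x⟫ ≠ 0 := by
      rw [ae_iff]; simpa using hyper_null hv
    filter_upwards [h1, h2] with x hx1 hx2
    apply ContinuousAt.mul
    · exact ContinuousAt.comp' (f := fun w : E3 × E3 => ⟪w.1, x⟫) (g := sg) (sg_cont hx1) (by fun_prop)
    · exact ContinuousAt.comp' (f := fun w : E3 × E3 => ⟪w.2, x⟫) (g := sg) (sg_cont hx2) (by fun_prop)

lemma vol_pos {K} (hK : Body K) : 0 < (volume : Measure E3).real K := by
  have h1 : 0 < (volume : Measure E3) K := Measure.measure_pos_of_mem_nhds _ hK.nhds0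
  exact ENNReal.toReal_pos h1.ne' hK.comp.measure_lt_top.ne

lemma F_self {K} (hK : Body K) {u : E3} (hu : u ≠ 0) : 0 < F K u u := by
  have : F K u u = ∫ x in K, (1:ℝ) := by
    unfold F
    apply integral_congr_ae
    apply ae_restrict_of_ae
    have h1 : ∀ᵐ x : E3, ⟪u, x⟫ ≠ 0 := by
      rw [ae_iff]; simpa using hyper_null hu
    filter_upwards [h1] with x hx using sg_sq hx
  rw [this]
  simpa using vol_pos hK

lemma F_strict {K} (hK : Body K) {u e : E3} (hu : u ≠ 0) (he : e ≠ 0) (hue : ⟪u, e⟫ = 0) :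
    StrictMono fun τ : ℝ => F K u (e + τ • u) := by
  intro τ τ' hτ
  simp only [F]
  rw [← sub_pos, ← integral_sub (F_int hK _ _) (F_int hK _ _)]
  rw [integral_pos_iff_support_of_nonneg_ae]
  · set U : Set E3 := {x | 0 < ⟪u,x⟫} ∩ {x | ⟪e + τ • u, x⟫ < 0} ∩ {x | 0 < ⟪e + τ' • u, x⟫}
    have hU : IsOpen U := by
      refine (IsOpen.inter (isOpen_lt (by fun_prop) (by fun_prop)) (isOpen_lt (by fun_prop) (by fun_prop))).inter (isOpen_lt (by fun_prop) (by fun_prop))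
    have hne : (U ∩ interior K).Nonempty := by
      set w : E3 := (‖u‖^2)⁻¹ • u + (-(τ+τ')/2 * (‖e‖^2)⁻¹) • e
      have hun : ‖u‖^2 ≠ 0 := by positivity
      have hen : ‖e‖^2 ≠ 0 := by positivity
      have h1 : ⟪u, w⟫ = 1 := by
        simp only [w, inner_add_right, real_inner_smul_right, hue, real_inner_self_eq_norm_sq]
        field_simp; ring
      have h2 : ⟪e, w⟫ = -(τ+τ')/2 := by
        simp only [w, inner_add_right, real_inner_smul_right, real_inner_comm u e, hue, real_inner_self_eq_norm_sq]
        field_simp; ring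
      have hc : ContinuousAt (fun δ : ℝ => δ • w) 0 := by fun_prop
      have hm : interior K ∈ 𝓝 ((0:ℝ) • w) := by
        rw [zero_smul]; exact interior_mem_nhds.2 hK.nhds0
      have := (hc.eventually hm).filter_mono (nhdsWithin_le_nhds (s := Ioi 0))
      obtain ⟨δ, hδ1, hδ2⟩ := (this.and self_mem_nhdsWithin).exists
      have hδ : 0 < δ := hδ2
      refine ⟨δ • w, ⟨⟨?_, ?_⟩, ?_⟩, hδ1⟩
      · simp only [mem_ofPred_eq, real_inner_smul_right, h1]; linarith
      · simp only [mem_ofPred_eq, real_inner_smul_right, inner_add_left, real_inner_smul_left, h1, h2]; nlinarith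
      · simp only [mem_ofPred_eq, real_inner_smul_right, inner_add_left, real_inner_smul_left, h1, h2]; nlinarith
    have hpos : 0 < volume (U ∩ interior K) := (hU.inter isOpen_interior).measure_pos _ hne
    refine lt_of_lt_of_le ?_ (measure_mono (s := U ∩ interior K) ?_)
    · rw [Measure.restrict_apply' hK.comp.measurableSet, inter_eq_left.2]
      · exact hpos
      · exact inter_subset_right.trans interior_subset
    · rintro x ⟨⟨⟨h1, h2⟩, h3⟩, -⟩
      simp only [mem_ofPred_eq] at h1 h2 h3
      simp only [Function.mem_support]
      rw [sg_pos h1, sg_neg' h2, sg_pos h3]; norm_num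
  · apply Eventually.of_forall
    intro x
    simp only [Pi.zero_apply, inner_add_left, real_inner_smul_left]
    rcases lt_trichotomy ⟪u,x⟫ 0 with h | h | h
    · have := sg_mono (a := ⟪e,x⟫ + τ' * ⟪u,x⟫) (b := ⟪e,x⟫ + τ * ⟪u,x⟫) (by nlinarith)
      rw [sg_neg' h]; linarith
    · simp [h, sg_zero]
    · have := sg_mono (a := ⟪e,x⟫ + τ * ⟪u,x⟫) (b := ⟪e,x⟫ + τ' * ⟪u,x⟫) (by nlinarith)
      rw [sg_pos h]; linarith
  · exact (F_int hK _ _).sub (F_int hK _ _)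

lemma perp_ne {u e : E3} (he : e ≠ 0) (hue : ⟪u, e⟫ = 0) (τ : ℝ) : e + τ • u ≠ 0 := by
  intro h
  have : ⟪e + τ • u, e⟫ = 0 := by rw [h]; simp
  rw [inner_add_left, real_inner_smul_left, hue] at this
  simp at this
  exact he this

lemma F_contτ {K} (hK : Body K) {u e : E3} (hu : u ≠ 0) (he : e ≠ 0) (hue : ⟪u, e⟫ = 0) :
    Continuous fun τ : ℝ => F K u (e + τ • u) := by
  rw [continuous_iff_continuousAt]
  intro τ
  exact ContinuousAt.comp' (f := fun τ : ℝ => (u, e + τ • u)) (g := fun w : E3 × E3 => F K w.1 w.2)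
    (F_cont hK hu (perp_ne he hue τ)) (by fun_prop)

lemma F_ex_pos {K} (hK : Body K) {u : E3} (e : E3) (hu : u ≠ 0) : ∃ τ : ℝ, 0 < F K u (e + τ • u) := by
  have hc : ContinuousAt (fun κ : ℝ => F K u (κ • e + u)) 0 := by
    refine ContinuousAt.comp' (f := fun κ : ℝ => (u, κ • e + u)) (g := fun w : E3 × E3 => F K w.1 w.2)
      ?_ (by fun_prop)
    simp only [zero_smul, zero_add]
    exact F_cont hK hu hu
  have h0 : ∀ᶠ κ in 𝓝[>] (0:ℝ), 0 < F K u (κ • e + u) := by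
    apply (hc.eventually (Ioi_mem_nhds (a := 0) ?_)).filter_mono nhdsWithin_le_nhds
    simpa using F_self hK hu
  obtain ⟨κ, h1, h2⟩ := (h0.and self_mem_nhdsWithin).exists
  have h2 : 0 < κ := h2
  refine ⟨κ⁻¹, ?_⟩
  rw [← F_smul K u _ h2, smul_add, smul_smul, mul_inv_cancel₀ h2.ne', one_smul]
  exact h1

lemma F_ex {K} (hK : Body K) {u e : E3} (hu : u ≠ 0) (he : e ≠ 0) (hue : ⟪u, e⟫ = 0) :
    ∃ τ : ℝ, F K u (e + τ • u) = 0 := by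
  obtain ⟨a, ha⟩ := F_ex_pos hK e hu
  obtain ⟨b, hb⟩ := F_ex_pos hK (-e) hu
  have hb' : F K u (e + (-b) • u) < 0 := by
    have : e + (-b) • u = -(-e + b • u) := by
      rw [neg_smul]; abel
    rw [this, F_neg_right]; linarith
  exact mem_range_of_exists_le_of_exists_ge (F_contτ hK hu he hue) ⟨_, hb'.le⟩ ⟨_, ha.le⟩

open Classical in
noncomputable def tau (K : Set E3) (u e : E3) : ℝ :=
  if h : ∃ τ : ℝ, F K u (e + τ • u) = 0 then h.choose else 0

lemma tau_spec {K} (hK : Body K) {u e : E3} (hu : u ≠ 0) (he : e ≠ 0) (hue : ⟪u, e⟫ = 0) :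
    F K u (e + tau K u e • u) = 0 := by
  have h := F_ex hK hu he hue
  unfold tau
  rw [dif_pos h]
  exact h.choose_spec

lemma tau_uniq {K} (hK : Body K) {u e : E3} (hu : u ≠ 0) (he : e ≠ 0) (hue : ⟪u, e⟫ = 0) {τ : ℝ}
    (h : F K u (e + τ • u) = 0) : tau K u e = τ :=
  (F_strict hK hu he hue).injective (by simp only [h, tau_spec hK hu he hue])

lemma tau_neg_right {K} (hK : Body K) {u e : E3} (hu : u ≠ 0) (he : e ≠ 0) (hue : ⟪u, e⟫ = 0) :
    tau K u (-e) = - tau K u e := by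
  apply tau_uniq hK hu (neg_ne_zero.2 he) (by simp [hue])
  rw [neg_smul, ← neg_add, F_neg_right, tau_spec hK hu he hue, neg_zero]

lemma tau_neg_left {K} (hK : Body K) {u e : E3} (hu : u ≠ 0) (he : e ≠ 0) (hue : ⟪u, e⟫ = 0) :
    tau K (-u) e = - tau K u e := by
  apply tau_uniq hK (neg_ne_zero.2 hu) he (by simp [hue])
  rw [smul_neg, neg_smul, neg_neg, F_neg_left, tau_spec hK hu he hue, neg_zero]

lemma implicit_cont {X : Type*} [TopologicalSpace X] (Φ : X → ℝ → ℝ) (t : X → ℝ)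
    (hΦ : ∀ τ, Continuous fun x => Φ x τ) (hm : ∀ x, StrictMono (Φ x)) (ht : ∀ x, Φ x (t x) = 0) :
    Continuous t := by
  rw [continuous_iff_continuousAt]
  intro x
  rw [ContinuousAt, tendsto_order]
  constructor
  · intro a ha
    have h1 : Φ x a < 0 := by rw [← ht x]; exact hm x ha
    filter_upwards [(hΦ a).continuousAt.eventually (Iio_mem_nhds h1)] with y hy
    rw [← (hm y).lt_iff_lt, ht y]; exact hy
  · intro a ha
    have h1 : 0 < Φ x a := by rw [← ht x]; exact hm x ha
    filter_upwards [(hΦ a).continuousAt.eventually (Ioi_mem_nhds h1)] with y hy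
    rw [← (hm y).lt_iff_lt, ht y]; exact hy

lemma tau_cont {K} (hK : Body K) {X : Type*} [TopologicalSpace X] {u e : X → E3}
    (hu : ∀ x, u x ≠ 0) (he : ∀ x, e x ≠ 0) (hue : ∀ x, ⟪u x, e x⟫ = 0) (cu : Continuous u)
    (ce : Continuous e) : Continuous fun x => tau K (u x) (e x) := by
  apply implicit_cont (fun x τ => F K (u x) (e x + τ • u x))
  · intro τ
    rw [continuous_iff_continuousAt]
    intro x
    exact ContinuousAt.comp' (f := fun x => (u x, e x + τ • u x)) (g := fun w : E3 × E3 => F K w.1 w.2)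
      (F_cont hK (hu x) (perp_ne (he x) (hue x) τ)) (by fun_prop)
  · exact fun x => F_strict hK (hu x) (he x) (hue x)
  · exact fun x => tau_spec hK (hu x) (he x) (hue x)

end EqP

namespace EqP
open MeasureTheory Set Filter Topology Real
open scoped RealInnerProductSpace

noncomputable def pt (p q : E3) (t : ℝ) : E3 := cos t • p + sin t • q

noncomputable def om (K : Set E3) (p q : E3) (t : ℝ) : ℝ := (gauge K (pt p q t))⁻¹ ^ 2

def Bas (p q : E3) : Prop := ∀ t, 1 ≤ ‖pt p q t‖

lemma bas_of {p q : E3} (h : ⟪p, q⟫ = 0) (hp : 1 ≤ ⟪p, p⟫) (hq : 1 ≤ ⟪q, q⟫) : Bas p q := by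
  intro t
  have h1 : ‖pt p q t‖^2 = cos t ^2 * ⟪p,p⟫ + sin t ^2 * ⟪q,q⟫ := by
    rw [← real_inner_self_eq_norm_sq]
    simp only [pt, inner_add_left, inner_add_right, real_inner_smul_left, real_inner_smul_right,
      real_inner_comm p q, h]
    ring
  have h2 : (1:ℝ) ≤ ‖pt p q t‖^2 := by
    rw [h1]
    nlinarith [sin_sq_add_cos_sq t, sq_nonneg (cos t), sq_nonneg (sin t)]
  nlinarith [norm_nonneg (pt p q t)]

lemma Bas.ne {p q : E3} (h : Bas p q) (t : ℝ) : pt p q t ≠ 0 := by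
  intro h0
  have := h t
  rw [h0] at this; simp at this; linarith

lemma pt_neg_right (p q : E3) (t : ℝ) : pt p (-q) t = pt p q (-t) := by simp [pt]
lemma pt_neg_neg (p q : E3) (t : ℝ) : pt (-p) (-q) t = - pt p q t := by simp [pt]; abel
lemma pt_add_pi (p q : E3) (t : ℝ) : pt p q (t + π) = - pt p q t := by
  simp [pt, cos_add_pi, sin_add_pi]; abel

lemma Bas.neg_right {p q : E3} (h : Bas p q) : Bas p (-q) := by
  intro t; rw [pt_neg_right]; exact h _
lemma Bas.neg_neg {p q : E3} (h : Bas p q) : Bas (-p) (-q) := by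
  intro t; rw [pt_neg_neg, norm_neg]; exact h _

section
variable {K : Set E3} (hK : Body K)
include hK

lemma absorb : Absorbent ℝ K := absorbent_nhds_zero hK.nhds0

lemma gpos {x : E3} (hx : x ≠ 0) : 0 < gauge K x :=
  (gauge_pos (absorb hK) (NormedSpace.isVonNBounded_of_isBounded ℝ hK.comp.isBounded)).2 hx

lemma gcont : Continuous (gauge K) := continuous_gauge hK.conv hK.nhds0

lemma om_pos {p q : E3} (h : Bas p q) (t : ℝ) : 0 < om K p q t := by
  have := gpos hK (h.ne t)
  unfold om; positivity

lemma om_bound : ∃ C, ∀ p q, Bas p q → ∀ t, om K p q t ≤ C := by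
  obtain ⟨R, hR⟩ := hK.comp.isBounded.subset_closedBall 0
  set R' := max R 1
  have hR1 : (1:ℝ) ≤ R' := le_max_right _ _
  have hR' : K ⊆ Metric.closedBall 0 R' := hR.trans (Metric.closedBall_subset_closedBall (le_max_left _ _))
  refine ⟨R'^2, fun p q h t => ?_⟩
  have h1 := le_gauge_of_subset_closedBall (x := pt p q t) (absorb hK) (by linarith) hR'
  have h2 : 1 / R' ≤ gauge K (pt p q t) := le_trans (by gcongr; exact h t) h1
  unfold om
  have h3 : (gauge K (pt p q t))⁻¹ ≤ R' := by
    rw [inv_le_comm₀ (gpos hK (h.ne t)) (by linarith)]; simpa using h2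
  have h4 : 0 ≤ (gauge K (pt p q t))⁻¹ := inv_nonneg.2 (gauge_nonneg _)
  gcongr

lemma om_cont {X : Type*} [TopologicalSpace X] {p q : X → E3} {t : X → ℝ} (hp : Continuous p)
    (hq : Continuous q) (ht : Continuous t) (h : ∀ x, Bas (p x) (q x)) :
    Continuous fun x => om K (p x) (q x) (t x) := by
  unfold om
  apply Continuous.pow
  apply Continuous.inv₀
  · apply (gcont hK).comp'
    unfold pt; fun_prop
  · intro x; exact (gpos hK ((h x).ne _)).ne'

lemma om_cont1 {p q : E3} (h : Bas p q) : Continuous (om K p q) :=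
  om_cont hK continuous_const continuous_const continuous_id fun _ => h

lemma om_ii {p q : E3} (h : Bas p q) (a b : ℝ) : IntervalIntegrable (om K p q) volume a b :=
  (om_cont1 hK h).intervalIntegrable _ _

omit hK in
lemma om_neg_right (p q : E3) (t : ℝ) : om K p (-q) t = om K p q (-t) := by
  simp [om, pt_neg_right]
lemma om_neg_neg (p q : E3) (t : ℝ) : om K (-p) (-q) t = om K p q t := by
  simp [om, pt_neg_neg, gauge_neg hK.symm]
lemma om_per (p q : E3) : Function.Periodic (om K p q) π := by
  intro t; simp [om, pt_add_pi, gauge_neg hK.symm]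

omit hK in
variable (K) in
noncomputable def S (p q : E3) (t : ℝ) : ℝ := ∫ x in (0:ℝ)..t, om K p q x

lemma S_strict {p q : E3} (h : Bas p q) : StrictMono (S K p q) := by
  intro a b hab
  unfold S
  rw [← intervalIntegral.integral_add_adjacent_intervals (om_ii hK h 0 a) (om_ii hK h a b)]
  have := intervalIntegral.intervalIntegral_pos_of_pos (om_ii hK h a b) (om_pos hK h) hab
  linarith

omit hK in
lemma S_zero (p q : E3) : S K p q 0 = 0 := by simp [S]

lemma S_pi_pos {p q : E3} (h : Bas p q) : 0 < S K p q π := by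
  rw [← S_zero (K := K) p q]; exact S_strict hK h pi_pos

lemma S_add_pi {p q : E3} (h : Bas p q) (t : ℝ) : S K p q (t + π) = S K p q t + S K p q π := by
  unfold S
  rw [(om_per hK p q).intervalIntegral_add_eq_add 0 t (om_ii hK h)]
  simp

lemma S_sub {p q : E3} (h : Bas p q) (a b : ℝ) : ∫ x in a..b, om K p q x = S K p q b - S K p q a := by
  unfold S
  rw [intervalIntegral.integral_interval_sub_left (om_ii hK h _ _) (om_ii hK h _ _)]

lemma S_neg_right {p q : E3} (h : Bas p q) (t : ℝ) : S K p (-q) t = - S K p q (-t) := by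
  unfold S
  simp only [om_neg_right]
  rw [intervalIntegral.integral_comp_neg (fun x => om K p q x), intervalIntegral.integral_symm]
  simp

lemma S_cont {X : Type*} [TopologicalSpace X] {p q : X → E3} {t : X → ℝ} (hp : Continuous p)
    (hq : Continuous q) (ht : Continuous t) (h : ∀ x, Bas (p x) (q x)) :
    Continuous fun x => S K (p x) (q x) (t x) := by
  unfold S
  apply intervalIntegral.continuous_parametric_intervalIntegral_of_continuous _ ht
  exact om_cont hK (p := fun z : X × ℝ => p z.1) (q := fun z : X × ℝ => q z.1) (t := fun z => z.2) (by fun_prop) (by fun_prop)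
    (by fun_prop) fun x => h x.1

lemma T_ex {p q : E3} (h : Bas p q) (c : ℝ) : ∃ t, S K p q t = c := by
  have hc : Continuous (S K p q) :=
    S_cont hK continuous_const continuous_const continuous_id fun _ => h
  exact hc.surjective
    ((om_per hK p q).tendsto_atTop_intervalIntegral_of_pos' (om_ii hK h _ _) (om_pos hK h) pi_pos)
    ((om_per hK p q).tendsto_atBot_intervalIntegral_of_pos' (om_ii hK h _ _) (om_pos hK h) pi_pos) c

omit hK in
open Classical in
variable (K) in
noncomputable def T (p q : E3) (θ : ℝ) : ℝ :=
  if h : ∃ t, S K p q t = θ * S K p q π / 2 then h.choose else 0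

lemma T_spec {p q : E3} (h : Bas p q) (θ : ℝ) : S K p q (T K p q θ) = θ * S K p q π / 2 := by
  have h1 := T_ex hK h (θ * S K p q π / 2)
  unfold T
  rw [dif_pos h1]
  exact h1.choose_spec

lemma T_uniq {p q : E3} (h : Bas p q) {θ t : ℝ} (ht : S K p q t = θ * S K p q π / 2) :
    T K p q θ = t := (S_strict hK h).injective (by rw [T_spec hK h, ht])

lemma T_add_two {p q : E3} (h : Bas p q) (θ : ℝ) : T K p q (θ + 2) = T K p q θ + π := by
  apply T_uniq hK h
  rw [S_add_pi hK h, T_spec hK h]; ring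

lemma T_strict {p q : E3} (h : Bas p q) : StrictMono (T K p q) := by
  intro a b hab
  rw [← (S_strict hK h).lt_iff_lt, T_spec hK h, T_spec hK h]
  have := S_pi_pos hK h
  nlinarith

lemma S_neg_pi {p q : E3} (h : Bas p q) : S K p (-q) π = S K p q π := by
  have := S_add_pi hK h (-π)
  rw [neg_add_cancel, S_zero] at this
  rw [S_neg_right hK h]; linarith

lemma T_neg_right {p q : E3} (h : Bas p q) (θ : ℝ) : T K p (-q) θ = - T K p q (-θ) := by
  apply T_uniq hK h.neg_right
  rw [S_neg_right hK h, S_neg_pi hK h, neg_neg, T_spec hK h]; ring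

lemma T_zero {p q : E3} (h : Bas p q) : T K p q 0 = 0 := by
  apply T_uniq hK h
  rw [S_zero]; ring

omit hK in
lemma pt_rot (p q : E3) (a t : ℝ) : pt (pt p q a) (pt p q (a + π / 2)) t = pt p q (a + t) := by
  simp only [pt, cos_add, sin_add, cos_pi_div_two, sin_pi_div_two]
  module

omit hK in
lemma Bas.rot {p q : E3} (h : Bas p q) (a : ℝ) : Bas (pt p q a) (pt p q (a + π / 2)) := by
  intro t; rw [pt_rot]; exact h _

omit hK in
lemma om_rot (p q : E3) (a t : ℝ) :
    om K (pt p q a) (pt p q (a + π / 2)) t = om K p q (a + t) := by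
  simp only [om, pt_rot]

lemma S_rot {p q : E3} (h : Bas p q) (a t : ℝ) :
    S K (pt p q a) (pt p q (a + π / 2)) t = S K p q (a + t) - S K p q a := by
  rw [← S_sub hK h]
  unfold S
  simp only [om_rot]
  rw [intervalIntegral.integral_comp_add_left (fun x => om K p q x), add_zero]

lemma T_rot {p q : E3} (h : Bas p q) (s θ : ℝ) :
    T K (pt p q (T K p q s)) (pt p q (T K p q s + π / 2)) θ = T K p q (s + θ) - T K p q s := by
  apply T_uniq hK (h.rot _)
  rw [S_rot hK h, S_rot hK h, S_add_pi hK h, add_sub_cancel, T_spec hK h, T_spec hK h]; ring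

lemma T_cont {X : Type*} [TopologicalSpace X] {p q : X → E3} {θ : X → ℝ} (hp : Continuous p)
    (hq : Continuous q) (hθ : Continuous θ) (h : ∀ x, Bas (p x) (q x)) :
    Continuous fun x => T K (p x) (q x) (θ x) := by
  apply implicit_cont (fun x t => S K (p x) (q x) t - θ x * S K (p x) (q x) π / 2)
  · intro τ
    have h1 := S_cont hK hp hq (continuous_const (y := τ)) h
    have h2 := S_cont hK hp hq (continuous_const (y := π)) h
    fun_prop
  · intro x a b hab
    have := S_strict hK (h x) hab
    simpa using this
  · intro x
    simp only [T_spec hK (h x)]; ring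

omit hK in
variable (K) in
noncomputable def G (D M a b : E3) : ℝ :=
  ∫ t in (-π)..π, om K D M t * (sg ⟪a, pt D M t⟫ * sg ⟪b, pt D M t⟫)

omit hK in
lemma G_neg_a (D M a b : E3) : G K D M (-a) b = - G K D M a b := by
  simp only [G, inner_neg_left, sg_neg, neg_mul, mul_neg, intervalIntegral.integral_neg]
omit hK in
lemma G_neg_b (D M a b : E3) : G K D M a (-b) = - G K D M a b := by
  simp only [G, inner_neg_left, sg_neg, mul_neg, intervalIntegral.integral_neg]
omit hK in
lemma G_neg_right (D M a b : E3) : G K D (-M) a b = G K D M a b := by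
  simp only [G, om_neg_right, pt_neg_right]
  rw [intervalIntegral.integral_comp_neg (fun t => om K D M t * (sg ⟪a, pt D M t⟫ * sg ⟪b, pt D M t⟫)), neg_neg]
lemma G_neg_neg (D M a b : E3) : G K (-D) (-M) a b = G K D M a b := by
  simp only [G, om_neg_neg hK, pt_neg_neg, inner_neg_right, sg_neg, neg_mul_neg]
lemma G_neg_left (D M a b : E3) : G K (-D) M a b = G K D M a b := by
  rw [← G_neg_right, G_neg_neg hK]

omit hK in
lemma zeros_null {a b : ℝ} (h : ¬ (a = 0 ∧ b = 0)) : volume {t : ℝ | cos t * a + sin t * b = 0} = 0 := by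
  rcases eq_empty_or_nonempty {t : ℝ | cos t * a + sin t * b = 0} with he | ⟨t0, ht0⟩
  · rw [he]; simp
  · apply Set.Countable.measure_zero
    apply (countable_range (fun k : ℤ => t0 + k * π)).mono
    intro t ht
    simp only [mem_ofPred_eq] at ht ht0
    have hs : sin (t - t0) = 0 := by
      rw [sin_sub]
      by_contra hne
      apply h
      constructor
      · have : a * (sin t * cos t0 - cos t * sin t0) = 0 := by linear_combination sin t * ht0 - sin t0 * ht
        exact (mul_eq_zero.1 this).resolve_right hne
      · have : b * (sin t * cos t0 - cos t * sin t0) = 0 := by linear_combination cos t0 * ht - cos t * ht0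
        exact (mul_eq_zero.1 this).resolve_right hne
    obtain ⟨k, hk⟩ := sin_eq_zero_iff.1 hs
    exact ⟨k, by simp only [hk]; ring⟩

omit hK in
lemma inner_pt (a p q : E3) (t : ℝ) : ⟪a, pt p q t⟫ = cos t * ⟪a, p⟫ + sin t * ⟪a, q⟫ := by
  simp only [pt, inner_add_right, real_inner_smul_right]

omit hK in
lemma G_ae {D M a : E3} (h : ¬ (⟪a, D⟫ = 0 ∧ ⟪a, M⟫ = 0)) : ∀ᵐ t : ℝ, ⟪a, pt D M t⟫ ≠ 0 := by
  rw [ae_iff]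
  simpa [inner_pt] using zeros_null h

omit hK in
lemma sg_pt_meas (D M a : E3) : Measurable fun t => sg ⟪a, pt D M t⟫ := by
  apply sg_meas.fun_comp
  apply Continuous.measurable
  unfold pt; fun_prop

lemma G_cont {X : Type*} [TopologicalSpace X] [FirstCountableTopology X] {D M a b : X → E3}
    (cD : Continuous D) (cM : Continuous M) (ca : Continuous a) (cb : Continuous b)
    (h : ∀ x, Bas (D x) (M x)) (ha : ∀ x, ¬ (⟪a x, D x⟫ = 0 ∧ ⟪a x, M x⟫ = 0))
    (hb : ∀ x, ¬ (⟪b x, D x⟫ = 0 ∧ ⟪b x, M x⟫ = 0)) :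
    Continuous fun x => G K (D x) (M x) (a x) (b x) := by
  rw [continuous_iff_continuousAt]
  intro x
  obtain ⟨C, hC⟩ := om_bound hK
  unfold G
  apply intervalIntegral.continuousAt_of_dominated_interval (bound := fun _ => C)
  · refine Eventually.of_forall fun y => Measurable.aestronglyMeasurable ?_
    exact (om_cont1 hK (h y)).measurable.mul ((sg_pt_meas _ _ _).mul (sg_pt_meas _ _ _))
  · refine Eventually.of_forall fun y => Eventually.of_forall fun t _ => ?_
    rw [norm_mul, norm_mul]
    have h1 : ‖om K (D y) (M y) t‖ ≤ C := by
      rw [Real.norm_of_nonneg (om_pos hK (h y) t).le]; exact hC _ _ (h y) t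
    have h2 : ‖sg ⟪a y, pt (D y) (M y) t⟫‖ * ‖sg ⟪b y, pt (D y) (M y) t⟫‖ ≤ 1 :=
      mul_le_one₀ (sg_abs_le _) (norm_nonneg _) (sg_abs_le _)
    have h3 : 0 ≤ ‖sg ⟪a y, pt (D y) (M y) t⟫‖ * ‖sg ⟪b y, pt (D y) (M y) t⟫‖ := by positivity
    have h4 := norm_nonneg (om K (D y) (M y) t)
    nlinarith
  · exact intervalIntegrable_const
  · filter_upwards [G_ae (ha x), G_ae (hb x)] with t h1 h2 _
    apply ContinuousAt.mul
    · exact (om_cont hK cD cM continuous_const h).continuousAt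
    · apply ContinuousAt.mul
      · refine ContinuousAt.comp' (f := fun y => ⟪a y, pt (D y) (M y) t⟫) (g := sg) (sg_cont h1) ?_
        apply Continuous.continuousAt; unfold pt; fun_prop
      · refine ContinuousAt.comp' (f := fun y => ⟪b y, pt (D y) (M y) t⟫) (g := sg) (sg_cont h2) ?_
        apply Continuous.continuousAt; unfold pt; fun_prop

lemma G_zero {p q a b : E3} (h : Bas p q) {θ : ℝ}
    (ha : ∀ t, ⟪a, pt p q t⟫ = sin (t - T K p q θ))
    (hb : ∀ t, ⟪b, pt p q t⟫ = sin (t - T K p q (θ + 1))) : G K p q a b = 0 := by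
  set t0 := T K p q θ with ht0
  set t1 := T K p q (θ+1) with ht1
  have h01 : t0 < t1 := T_strict hK h (by linarith)
  have h12 : t1 < t0 + π := by
    rw [ht0, ← T_add_two hK h]; exact T_strict hK h (by linarith)
  set f : ℝ → ℝ := fun t => om K p q t * (sg ⟪a, pt p q t⟫ * sg ⟪b, pt p q t⟫) with hf
  have hper : Function.Periodic f π := by
    intro t
    simp only [hf, om_per hK p q t, pt_add_pi, inner_neg_right, sg_neg, neg_mul_neg]
  have hintg : ∀ x y, IntervalIntegrable f volume x y := by
    intro x y
    apply (om_ii hK h x y).mono_fun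
    · refine Measurable.aestronglyMeasurable ?_
      exact (om_cont1 hK h).measurable.mul ((sg_pt_meas _ _ _).mul (sg_pt_meas _ _ _))
    · refine Eventually.of_forall fun t => ?_
      simp only [hf]
      rw [norm_mul, norm_mul]
      have h2 : ‖sg ⟪a, pt p q t⟫‖ * ‖sg ⟪b, pt p q t⟫‖ ≤ 1 :=
        mul_le_one₀ (sg_abs_le _) (norm_nonneg _) (sg_abs_le _)
      have h4 := norm_nonneg (om K p q t)
      nlinarith
  have e1 : G K p q a b = 2 * ∫ t in t0..t0+π, f t := by
    have := hper.intervalIntegral_add_zsmul_eq 2 (-π) hintg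
    have e : -π + (2:ℤ) • π = π := by simp; ring
    rw [e] at this
    rw [G, this, hper.intervalIntegral_add_eq (-π) t0]
    simp
  have e2 : ∫ t in t0..t1, f t = - ∫ t in t0..t1, om K p q t := by
    rw [← intervalIntegral.integral_neg]
    apply intervalIntegral.integral_congr_ae
    have : ∀ᵐ t : ℝ, t ≠ t1 := by simp [ae_iff]
    filter_upwards [this] with t hne ht
    rw [uIoc_of_le h01.le] at ht
    have hlt : t < t1 := lt_of_le_of_ne ht.2 hne
    have s0 : 0 < sin (t - t0) := sin_pos_of_pos_of_lt_pi (by linarith [ht.1]) (by linarith)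
    have s1 : sin (t - t1) < 0 := sin_neg_of_neg_of_neg_pi_lt (by linarith) (by linarith [ht.1])
    simp only [hf, ha, hb, sg_pos s0, sg_neg' s1]; ring
  have e3 : ∫ t in t1..t0+π, f t = ∫ t in t1..t0+π, om K p q t := by
    apply intervalIntegral.integral_congr_ae
    have : ∀ᵐ t : ℝ, t ≠ t0+π := by simp [ae_iff]
    filter_upwards [this] with t hne ht
    rw [uIoc_of_le h12.le] at ht
    have hlt : t < t0+π := lt_of_le_of_ne ht.2 hne
    have s0 : 0 < sin (t - t0) := sin_pos_of_pos_of_lt_pi (by linarith [ht.1]) (by linarith)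
    have s1 : 0 < sin (t - t1) := sin_pos_of_pos_of_lt_pi (by linarith [ht.1]) (by linarith)
    simp only [hf, ha, hb, sg_pos s0, sg_pos s1]; ring
  rw [e1, ← intervalIntegral.integral_add_adjacent_intervals (hintg t0 t1) (hintg t1 _), e2, e3,
    S_sub hK h, S_sub hK h, S_add_pi hK h, ht0, ht1, T_spec hK h, T_spec hK h]
  ring

end
end EqP

namespace EqP
open MeasureTheory Set Filter Topology Real
open scoped RealInnerProductSpace

structure ON (u p q : E3) : Prop where
  uu : ⟪u, u⟫ = 1
  pp : ⟪p, p⟫ = 1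
  qq : ⟪q, q⟫ = 1
  up : ⟪u, p⟫ = 0
  uq : ⟪u, q⟫ = 0
  pq : ⟪p, q⟫ = 0

section
variable {u p q : E3} (h : ON u p q)
include h

lemma ON.bas : Bas p q := bas_of h.pq h.pp.ge h.qq.ge
lemma ON.u_ne : u ≠ 0 := by
  intro h0; have := h.uu; rw [h0] at this; simp at this
lemma ON.u_pt (t : ℝ) : ⟪u, pt p q t⟫ = 0 := by rw [inner_pt, h.up, h.uq]; ring
lemma ON.pt_pt (a b : ℝ) : ⟪pt p q a, pt p q b⟫ = cos (a - b) := by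
  have hqp : ⟪q, p⟫ = 0 := by rw [real_inner_comm]; exact h.pq
  simp only [pt, inner_add_left, inner_add_right, real_inner_smul_left, real_inner_smul_right,
    h.pp, h.qq, h.pq, hqp, cos_sub]
  ring
lemma ON.flip : ON (-u) p (-q) := by
  refine ⟨?_, h.pp, ?_, ?_, ?_, ?_⟩ <;> simp [h.uu, h.qq, h.up, h.uq, h.pq, -inner_self_eq_norm_sq_to_K]
end

variable (K : Set E3)
noncomputable def Dv (p q : E3) (θ : ℝ) : E3 := pt p q (T K p q θ)
noncomputable def Ev (p q : E3) (θ : ℝ) : E3 := pt p q (T K p q θ + π / 2)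
noncomputable def Nv (u p q : E3) (θ : ℝ) : E3 := Ev K p q θ + tau K u (Ev K p q θ) • u
noncomputable def Mv (u p q : E3) (θ : ℝ) : E3 := u - tau K u (Ev K p q θ) • Ev K p q θ
noncomputable def ff (u p q : E3) (θ : ℝ) : ℝ := F K (Nv K u p q θ) (Nv K u p q (θ + 1))
noncomputable def gg (u p q : E3) (θ : ℝ) : ℝ :=
  G K (Dv K p q θ) (Mv K u p q θ) u (Nv K u p q (θ + 1))
variable {K}

section
variable (hK : Body K) {u p q : E3} (h : ON u p q) (θ : ℝ)
include hK h

omit hK in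
lemma u_Ev : ⟪u, Ev K p q θ⟫ = 0 := h.u_pt _
omit hK in
lemma Ev_Ev : ⟪Ev K p q θ, Ev K p q θ⟫ = 1 := by rw [Ev, h.pt_pt, sub_self, cos_zero]
omit hK in
lemma Ev_ne : Ev K p q θ ≠ 0 := h.bas.ne _

lemma Dv_add : Dv K p q (θ + 2) = - Dv K p q θ := by
  rw [Dv, T_add_two hK h.bas, pt_add_pi, Dv]
lemma Ev_add : Ev K p q (θ + 2) = - Ev K p q θ := by
  rw [Ev, T_add_two hK h.bas, add_right_comm, pt_add_pi, Ev]
lemma Nv_add : Nv K u p q (θ + 2) = - Nv K u p q θ := by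
  rw [Nv, Ev_add hK h, tau_neg_right hK h.u_ne (Ev_ne h θ) (u_Ev h θ), Nv]; module
lemma Mv_add : Mv K u p q (θ + 2) = Mv K u p q θ := by
  rw [Mv, Ev_add hK h, tau_neg_right hK h.u_ne (Ev_ne h θ) (u_Ev h θ), Mv]; module

lemma Dv_flip : Dv K p (-q) θ = Dv K p q (-θ) := by
  rw [Dv, T_neg_right hK h.bas, pt_neg_right, neg_neg, Dv]
lemma Ev_flip : Ev K p (-q) θ = - Ev K p q (-θ) := by
  rw [Ev, T_neg_right hK h.bas, pt_neg_right, Ev, ← pt_add_pi, ← neg_neg (pt p q _), ← pt_add_pi,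
    ← pt_add_pi]
  congr 1; ring
lemma Nv_flip : Nv K (-u) p (-q) θ = - Nv K u p q (-θ) := by
  rw [Nv, Ev_flip hK h, tau_neg_right hK (neg_ne_zero.2 h.u_ne) (Ev_ne h _) (by simp [u_Ev h]),
    tau_neg_left hK h.u_ne (Ev_ne h _) (u_Ev h _), Nv]; module
lemma Mv_flip : Mv K (-u) p (-q) θ = - Mv K u p q (-θ) := by
  rw [Mv, Ev_flip hK h, tau_neg_right hK (neg_ne_zero.2 h.u_ne) (Ev_ne h _) (by simp [u_Ev h]),
    tau_neg_left hK h.u_ne (Ev_ne h _) (u_Ev h _), Mv]; module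

lemma ff_add : ff K u p q (θ + 1) = - ff K u p q θ := by
  rw [ff, add_assoc, one_add_one_eq_two, Nv_add hK h, F_neg_right, F_symm, ff]
lemma gg_add : gg K u p q (θ + 2) = - gg K u p q θ := by
  rw [gg, Dv_add hK h, Mv_add hK h, add_right_comm, Nv_add hK h, G_neg_b, G_neg_left hK, gg]
lemma ff_flip : ff K (-u) p (-q) θ = - ff K u p q (-θ) := by
  have := ff_add hK h (-θ - 1)
  rw [sub_add_cancel] at this
  rw [this, ff, Nv_flip hK h, Nv_flip hK h, F_neg_left, F_neg_right, F_symm, ff, sub_add_cancel]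
  rw [neg_neg, neg_neg, neg_add, ← sub_eq_add_neg]
lemma gg_flip : gg K (-u) p (-q) θ = - gg K u p q (-θ) := by
  have := Nv_add hK h (-(θ+1))
  have e : -(θ+1) + 2 = -θ + 1 := by ring
  rw [e] at this
  rw [gg, gg, Dv_flip hK h, Mv_flip hK h, Nv_flip hK h, this, G_neg_right, G_neg_a, G_neg_b]

omit hK in
lemma u_Nv_pt (t : ℝ) : ⟪Nv K u p q θ, pt p q t⟫ = sin (t - T K p q θ) := by
  rw [Nv, inner_add_left, real_inner_smul_left, h.u_pt, Ev, h.pt_pt, mul_zero, add_zero,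
    ← cos_pi_div_two_sub]
  congr 1; ring

omit hK in
lemma Nv_ne : Nv K u p q θ ≠ 0 := perp_ne (Ev_ne h θ) (u_Ev h θ) _

omit hK in
lemma Mv_u : ⟪u, Mv K u p q θ⟫ = 1 := by
  rw [Mv, inner_sub_right, real_inner_smul_right, u_Ev h, h.uu]; ring
omit hK in
lemma Mv_Nv : ⟪Nv K u p q θ, Mv K u p q θ⟫ = 0 := by
  simp only [Nv, Mv, inner_sub_right, inner_add_left, real_inner_smul_right, real_inner_smul_left, u_Ev h, h.uu,
    real_inner_comm u (Ev K p q θ), Ev_Ev h]; ring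
omit hK in
lemma Dv_Nv : ⟪Nv K u p q θ, Dv K p q θ⟫ = 0 := by
  rw [Dv, u_Nv_pt h]; simp
omit hK in
lemma Dv_u : ⟪u, Dv K p q θ⟫ = 0 := h.u_pt _
omit hK in
lemma Dv_Mv : ⟪Dv K p q θ, Mv K u p q θ⟫ = 0 := by
  rw [Mv, inner_sub_right, real_inner_smul_right, real_inner_comm, Dv_u h, Dv, Ev, h.pt_pt]
  simp
omit hK in
lemma Dv_Dv : ⟪Dv K p q θ, Dv K p q θ⟫ = 1 := by
  rw [Dv, h.pt_pt]; simp
omit hK in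
lemma Mv_Mv : 1 ≤ ⟪Mv K u p q θ, Mv K u p q θ⟫ := by
  have : ⟪Mv K u p q θ, Mv K u p q θ⟫ = 1 + tau K u (Ev K p q θ) ^ 2 := by
    simp only [Mv, inner_sub_right, inner_sub_left, real_inner_smul_right, real_inner_smul_left, u_Ev h, h.uu,
      real_inner_comm u (Ev K p q θ), Ev_Ev h]; ring
  rw [this]; nlinarith [sq_nonneg (tau K u (Ev K p q θ))]
omit hK in
lemma bas_DM : Bas (Dv K p q θ) (Mv K u p q θ) := bas_of (Dv_Mv h θ) (Dv_Dv h θ).ge (Mv_Mv h θ)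

lemma T_gap : 0 < T K p q (θ + 1) - T K p q θ ∧ T K p q (θ + 1) - T K p q θ < π := by
  constructor
  · have := T_strict hK h.bas (show θ < θ + 1 by linarith)
    linarith
  · have := T_strict hK h.bas (show θ + 1 < θ + 2 by linarith)
    rw [T_add_two hK h.bas] at this
    linarith

lemma Nv1_Dv : ⟪Nv K u p q (θ + 1), Dv K p q θ⟫ ≠ 0 := by
  rw [Dv, u_Nv_pt h, ← neg_sub, sin_neg]
  obtain ⟨h1, h2⟩ := T_gap hK h θ
  have := sin_pos_of_pos_of_lt_pi h1 h2
  linarith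
lemma Nv_Dv1 : ⟪Nv K u p q θ, Dv K p q (θ + 1)⟫ ≠ 0 := by
  rw [Dv, u_Nv_pt h]
  obtain ⟨h1, h2⟩ := T_gap hK h θ
  exact (sin_pos_of_pos_of_lt_pi h1 h2).ne'
end

section
variable (hK : Body K) {X : Type*} [TopologicalSpace X] {u p q : X → E3} {θ : X → ℝ}
  (h : ∀ x, ON (u x) (p x) (q x)) (cu : Continuous u) (cp : Continuous p) (cq : Continuous q)
  (cθ : Continuous θ)
include hK h cp cq cθ

lemma Dv_cont : Continuous fun x => Dv K (p x) (q x) (θ x) := by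
  have := T_cont hK cp cq cθ fun x => (h x).bas
  unfold Dv pt
  fun_prop
lemma Ev_cont : Continuous fun x => Ev K (p x) (q x) (θ x) := by
  have := T_cont hK cp cq cθ fun x => (h x).bas
  unfold Ev pt
  fun_prop
include cu
lemma tau_cont' : Continuous fun x => tau K (u x) (Ev K (p x) (q x) (θ x)) :=
  tau_cont hK (fun x => (h x).u_ne) (fun x => Ev_ne (h x) _) (fun x => u_Ev (h x) _) cu
    (Ev_cont hK h cp cq cθ)
lemma Nv_cont : Continuous fun x => Nv K (u x) (p x) (q x) (θ x) :=
  (Ev_cont hK h cp cq cθ).add ((tau_cont' hK h cu cp cq cθ).smul cu)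
lemma Mv_cont : Continuous fun x => Mv K (u x) (p x) (q x) (θ x) :=
  cu.sub ((tau_cont' hK h cu cp cq cθ).smul (Ev_cont hK h cp cq cθ))
lemma ff_cont : Continuous fun x => ff K (u x) (p x) (q x) (θ x) := by
  rw [continuous_iff_continuousAt]
  intro x
  have c1 := Nv_cont hK h cu cp cq cθ
  have c2 := Nv_cont hK h cu cp cq (cθ.add (continuous_const (y := (1:ℝ))))
  exact ContinuousAt.comp' (f := fun x => (Nv K (u x) (p x) (q x) (θ x), Nv K (u x) (p x) (q x) (θ x + 1)))
    (g := fun w : E3 × E3 => F K w.1 w.2) (F_cont hK (Nv_ne (h x) _) (Nv_ne (h x) _))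
    (c1.prodMk c2).continuousAt
lemma gg_cont [FirstCountableTopology X] : Continuous fun x => gg K (u x) (p x) (q x) (θ x) := by
  have c2 := Nv_cont hK h cu cp cq (cθ.add (continuous_const (y := (1:ℝ))))
  apply G_cont hK (Dv_cont hK h cp cq cθ) (Mv_cont hK h cu cp cq cθ) cu c2
  · exact fun x => bas_DM (h x) _
  · intro x hx
    have := hx.2
    rw [Mv_u (h x)] at this
    norm_num at this
  · intro x hx
    exact Nv1_Dv hK (h x) _ hx.1
end

section
variable (hK : Body K) {p q : E3} (h : Bas p q) (s θ : ℝ)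
include hK h
lemma Dv_rot : Dv K (pt p q (T K p q s)) (pt p q (T K p q s + π / 2)) θ = Dv K p q (s + θ) := by
  rw [Dv, T_rot hK h, pt_rot, Dv]; congr 1; ring
lemma Ev_rot : Ev K (pt p q (T K p q s)) (pt p q (T K p q s + π / 2)) θ = Ev K p q (s + θ) := by
  rw [Ev, T_rot hK h, pt_rot, Ev]; congr 1; ring
lemma ff_rot (u : E3) : ff K u (pt p q (T K p q s)) (pt p q (T K p q s + π / 2)) θ = ff K u p q (s + θ) := by
  simp only [ff, Nv, Ev_rot hK h, add_assoc]
lemma gg_rot (u : E3) : gg K u (pt p q (T K p q s)) (pt p q (T K p q s + π / 2)) θ = gg K u p q (s + θ) := by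
  simp only [gg, Nv, Mv, Ev_rot hK h, Dv_rot hK h, add_assoc]
end

lemma ex_frame (K : Set E3) (hK : Body K) : ∃ u p q θ, ON u p q ∧ ff K u p q θ = 0 ∧ gg K u p q θ = 0 ∧
    gg K u p q (θ + 1) = 0 := by
  obtain ⟨e1, e2, e3, h⟩ : ∃ e1 e2 e3 : E3, ON e3 e1 e2 := by
    refine ⟨EuclideanSpace.single 0 1, EuclideanSpace.single 1 1, EuclideanSpace.single 2 1, ?_⟩
    constructor <;> simp [EuclideanSpace.inner_single_left]
  set Φ : ℝ → ℝ := T K e1 e2 with hΦ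
  have cΦ : Continuous Φ := T_cont hK continuous_const continuous_const continuous_id fun _ => h.bas
  set c : ℝ → E3 := fun s => pt e1 e2 (Φ s) with hc
  set c' : ℝ → E3 := fun s => pt e1 e2 (Φ s + π / 2) with hc'
  have cc : Continuous c := by simp only [hc]; unfold pt; fun_prop
  have cc' : Continuous c' := by simp only [hc']; unfold pt; fun_prop
  have c2 : ∀ s, c (s + 2) = - c s := fun s => Dv_add hK h s
  have c2' : ∀ s, c' (s + 2) = - c' s := fun s => Ev_add hK h s
  set u : ℝ → ℝ → E3 := fun s r => cos (r * π / 2) • e3 + sin (r * π / 2) • c s with hu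
  set p : ℝ → ℝ → E3 := fun s r => (-sin (r * π / 2)) • e3 + cos (r * π / 2) • c s with hp
  have hON : ∀ s r, ON (u s r) (p s r) (c' s) := by
    intro s r
    have h1 : ⟪c s, c s⟫ = 1 := by simp only [hc, h.pt_pt]; simp
    have h2 : ⟪c' s, c' s⟫ = 1 := by simp only [hc', h.pt_pt]; simp
    have h3 : ⟪c s, c' s⟫ = 0 := by simp only [hc, hc', h.pt_pt]; simp
    have h4 : ⟪e3, c s⟫ = 0 := h.u_pt _
    have h5 : ⟪e3, c' s⟫ = 0 := h.u_pt _
    have h6 : ⟪c s, e3⟫ = 0 := by rw [real_inner_comm]; exact h4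
    have h7 := sin_sq_add_cos_sq (r * π / 2)
    constructor <;> simp only [hu, hp, inner_add_left, inner_add_right, real_inner_smul_left, real_inner_smul_right,
      h1, h2, h3, h4, h5, h6, h.uu] <;> linarith
  have cu : Continuous fun x : ℝ × ℝ × ℝ => u x.1 x.2.1 := by simp only [hu]; fun_prop
  have cp : Continuous fun x : ℝ × ℝ × ℝ => p x.1 x.2.1 := by simp only [hp]; fun_prop
  have cq : Continuous fun x : ℝ × ℝ × ℝ => c' x.1 := by fun_prop
  have ct : Continuous fun x : ℝ × ℝ × ℝ => x.2.2 := by fun_prop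
  have u0 : ∀ s, u s 0 = e3 := by intro s; simp [hu]
  have p0 : ∀ s, p s 0 = c s := by intro s; simp [hp]
  have e1' : (1 : ℝ) * π / 2 = π / 2 := by ring
  have u1 : ∀ s, u s 1 = c s := by intro s; simp only [hu, e1']; simp
  have p1 : ∀ s, p s 1 = - e3 := by intro s; simp only [hp, e1']; simp
  have c4 : ∀ s, c (s + 4) = c s := by
    intro s
    have e : s + 4 = s + 2 + 2 := by ring
    rw [e, c2, c2, neg_neg]
  have c4' : ∀ s, c' (s + 4) = c' s := by
    intro s
    have e : s + 4 = s + 2 + 2 := by ring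
    rw [e, c2', c2', neg_neg]
  have rf : ∀ s t, ff K e3 (c s) (c' s) t = ff K e3 e1 e2 (s + t) := fun s t => ff_rot hK h.bas s t e3
  have rg : ∀ s t, gg K e3 (c s) (c' s) t = gg K e3 e1 e2 (s + t) := fun s t => gg_rot hK h.bas s t e3
  obtain ⟨s, r, t, h1, h2, h3⟩ := core (fun s r t => ff K (u s r) (p s r) (c' s) t)
    (fun s r t => gg K (u s r) (p s r) (c' s) t)
    (ff_cont hK (fun x => hON x.1 x.2.1) cu cp cq ct)
    (gg_cont hK (fun x => hON x.1 x.2.1) cu cp cq ct)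
    (by intro s r t; simp only [hu, hp, c4, c4'])
    (by intro s r t; simp only [hu, hp, c4, c4'])
    (by intro s r t; exact ff_add hK (hON s r) t)
    (by intro s r t; exact gg_add hK (hON s r) t)
    (by intro s t; simp only [u0, p0, rf, zero_add])
    (by intro s t; simp only [u0, p0, rg, zero_add])
    (by
      intro s t
      have hh := hON s 1
      simp only [u1, p1] at hh
      simp only [u1, p1, c2, c2']
      exact ff_flip hK hh t)
    (by
      intro s t
      have hh := hON s 1
      simp only [u1, p1] at hh
      simp only [u1, p1, c2, c2']
      exact gg_flip hK hh t)
  exact ⟨u s r, p s r, c' s, t, hON s r, h1, h2, h3⟩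

def Sec (K : Set E3) (u a b : E3) : Prop := ∃ D M : E3, ⟪D, M⟫ = 0 ∧ 1 ≤ ⟪D, D⟫ ∧ 1 ≤ ⟪M, M⟫ ∧
  ⟪u, D⟫ = 0 ∧ ⟪u, M⟫ = 0 ∧ ¬ (⟪a, D⟫ = 0 ∧ ⟪a, M⟫ = 0) ∧ ¬ (⟪b, D⟫ = 0 ∧ ⟪b, M⟫ = 0) ∧ G K D M a b = 0

theorem analytic (K : Set E3) (hK : Body K) : ∃ u v w : E3, u ≠ 0 ∧ v ≠ 0 ∧ w ≠ 0 ∧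
    F K u v = 0 ∧ F K u w = 0 ∧ F K v w = 0 ∧ Sec K u v w ∧ Sec K v u w ∧ Sec K w u v := by
  obtain ⟨u, p, q, θ, h, h1, h2, h3⟩ := ex_frame K hK
  refine ⟨u, Nv K u p q θ, Nv K u p q (θ + 1), h.u_ne, Nv_ne h _, Nv_ne h _,
    tau_spec hK h.u_ne (Ev_ne h _) (u_Ev h _), tau_spec hK h.u_ne (Ev_ne h _) (u_Ev h _), h1, ?_, ?_, ?_⟩
  · refine ⟨p, q, h.pq, h.pp.ge, h.qq.ge, h.up, h.uq, ?_, ?_, ?_⟩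
    · intro hx
      apply Nv_Dv1 hK h θ
      rw [Dv, inner_pt, hx.1, hx.2]; ring
    · intro hx
      apply Nv1_Dv hK h θ
      rw [Dv, inner_pt, hx.1, hx.2]; ring
    · exact G_zero hK h.bas (θ := θ) (fun t => u_Nv_pt h _ t) (fun t => u_Nv_pt h _ t)
  · refine ⟨Dv K p q θ, Mv K u p q θ, Dv_Mv h _, (Dv_Dv h _).ge, Mv_Mv h _, Dv_Nv h _, Mv_Nv h _, ?_, ?_, h2⟩
    · intro hx
      have := hx.2
      rw [Mv_u h] at this
      norm_num at this
    · intro hx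
      exact Nv1_Dv hK h _ hx.1
  · refine ⟨Dv K p q (θ+1), Mv K u p q (θ+1), Dv_Mv h _, (Dv_Dv h _).ge, Mv_Mv h _, Dv_Nv h _, Mv_Nv h _, ?_, ?_, ?_⟩
    · intro hx
      have := hx.2
      rw [Mv_u h] at this
      norm_num at this
    · intro hx
      exact Nv_Dv1 hK h _ hx.1
    · rw [gg, add_assoc, one_add_one_eq_two, Nv_add hK h, G_neg_b] at h3
      linarith

end EqP

namespace EqP
open MeasureTheory Set Filter Topology Real
open scoped RealInnerProductSpace

section
variable {α : Type*} [MeasurableSpace α] [AddCommGroup α] [MeasurableNeg α] (ν : Measure α)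
  [IsFiniteMeasure ν] (hν : ν.map Neg.neg = ν)
include hν

omit [IsFiniteMeasure ν] in
lemma odd_int (f : α → ℝ) (hf : Measurable f) (ho : ∀ x, f (-x) = - f x) : ∫ x, f x ∂ν = 0 := by
  have h : ∫ x, f x ∂(ν.map Neg.neg) = ∫ x, f (-x) ∂ν :=
    integral_map measurable_neg.aemeasurable hf.aestronglyMeasurable
  rw [hν] at h
  simp only [ho, integral_neg] at h
  linarith

omit hν [IsFiniteMeasure ν] [AddCommGroup α] [MeasurableNeg α] in
lemma ind_ae {a : α → ℝ} (ha : ∀ᵐ x ∂ν, a x ≠ 0) (σ : Bool) :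
    ∀ᵐ x ∂ν, (if 0 ≤ (if σ then (1:ℝ) else -1) * a x then (1:ℝ) else 0)
      = (1 + (if σ then (1:ℝ) else -1) * sg (a x)) / 2 := by
  filter_upwards [ha] with x hx
  rcases lt_or_gt_of_ne hx with h | h
  · cases σ
    · rw [sg_neg' h, if_pos (by simp; linarith)]; norm_num
    · rw [sg_neg' h, if_neg (by simp; linarith)]; norm_num
  · cases σ
    · rw [sg_pos h, if_neg (by simp; linarith)]; norm_num
    · rw [sg_pos h, if_pos (by simp; linarith)]; norm_num

omit hν [AddCommGroup α] [MeasurableNeg α] in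
lemma int_bdd {f : α → ℝ} (hf : Measurable f) (hb : ∀ x, |f x| ≤ 1) : Integrable f ν :=
  Integrable.of_bound hf.aestronglyMeasurable 1 (Eventually.of_forall hb)

lemma quad {a b : α → ℝ} (ma : Measurable a) (mb : Measurable b)
    (oa : ∀ x, a (-x) = - a x) (ob : ∀ x, b (-x) = - b x)
    (na : ∀ᵐ x ∂ν, a x ≠ 0) (nb : ∀ᵐ x ∂ν, b x ≠ 0)
    (hab : ∫ x, sg (a x) * sg (b x) ∂ν = 0) (σ τ : Bool) :
    ν {x | 0 ≤ (if σ then (1:ℝ) else -1) * a x ∧ 0 ≤ (if τ then (1:ℝ) else -1) * b x} = ν univ / 4 := by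
  set s : ℝ := if σ then (1:ℝ) else -1 with hs
  set t : ℝ := if τ then (1:ℝ) else -1 with ht
  set A := {x | 0 ≤ s * a x ∧ 0 ≤ t * b x} with hA
  have mA : MeasurableSet A := by
    have e : A = {x | 0 ≤ s * a x} ∩ {x | 0 ≤ t * b x} := by ext x; simp [hA]
    rw [e]
    exact (measurableSet_le measurable_const (by fun_prop)).inter (measurableSet_le measurable_const (by fun_prop))
  have msa : Measurable fun x => sg (a x) := sg_meas.comp ma
  have msb : Measurable fun x => sg (b x) := sg_meas.comp mb
  have e : ν.real A = ν.real univ / 4 := by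
    have e1 : ν.real A = ∫ x, (1 + s * sg (a x) + t * sg (b x) + (s * t) * (sg (a x) * sg (b x))) / 4 ∂ν := by
      rw [← integral_indicator_one mA]
      apply integral_congr_ae
      filter_upwards [ind_ae ν na σ, ind_ae ν nb τ] with x h1 h2
      have : A.indicator (1 : α → ℝ) x = (if 0 ≤ s * a x then (1:ℝ) else 0) * (if 0 ≤ t * b x then (1:ℝ) else 0) := by
        by_cases q1 : 0 ≤ s * a x <;> by_cases q2 : 0 ≤ t * b x <;> simp [hA, indicator, q1, q2]
      rw [this, h1, h2]; ring
    have i1 : Integrable (fun x => sg (a x)) ν := int_bdd ν msa fun x => sg_abs_le _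
    have i2 : Integrable (fun x => sg (b x)) ν := int_bdd ν msb fun x => sg_abs_le _
    have i3 : Integrable (fun x => sg (a x) * sg (b x)) ν := int_bdd ν (msa.mul msb) fun x => by
      rw [abs_mul]; exact mul_le_one₀ (sg_abs_le _) (abs_nonneg _) (sg_abs_le _)
    have o1 := odd_int ν hν _ msa (by intro x; rw [oa, sg_neg])
    have o2 := odd_int ν hν _ msb (by intro x; rw [ob, sg_neg])
    rw [e1, integral_div, integral_add, integral_add, integral_add, integral_const_mul, integral_const_mul,
      integral_const_mul, o1, o2, hab]
    · simp
    · fun_prop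
    · fun_prop
    · fun_prop
    · fun_prop
    · fun_prop
    · fun_prop
  rw [← ENNReal.toReal_eq_toReal_iff' (measure_ne_top _ _) (ENNReal.div_ne_top (measure_ne_top _ _) (by norm_num)),
    ENNReal.toReal_div]
  simpa [Measure.real] using e

lemma oct {a b c : α → ℝ} (ma : Measurable a) (mb : Measurable b) (mc : Measurable c)
    (oa : ∀ x, a (-x) = - a x) (ob : ∀ x, b (-x) = - b x) (oc : ∀ x, c (-x) = - c x)
    (na : ∀ᵐ x ∂ν, a x ≠ 0) (nb : ∀ᵐ x ∂ν, b x ≠ 0) (nc : ∀ᵐ x ∂ν, c x ≠ 0)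
    (hab : ∫ x, sg (a x) * sg (b x) ∂ν = 0) (hac : ∫ x, sg (a x) * sg (c x) ∂ν = 0)
    (hbc : ∫ x, sg (b x) * sg (c x) ∂ν = 0) (σ τ ρ : Bool) :
    ν {x | 0 ≤ (if σ then (1:ℝ) else -1) * a x ∧ 0 ≤ (if τ then (1:ℝ) else -1) * b x ∧
      0 ≤ (if ρ then (1:ℝ) else -1) * c x} = ν univ / 8 := by
  set s : ℝ := if σ then (1:ℝ) else -1 with hs
  set t : ℝ := if τ then (1:ℝ) else -1 with ht
  set r : ℝ := if ρ then (1:ℝ) else -1 with hr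
  set A := {x | 0 ≤ s * a x ∧ 0 ≤ t * b x ∧ 0 ≤ r * c x} with hA
  have mA : MeasurableSet A := by
    have e : A = {x | 0 ≤ s * a x} ∩ ({x | 0 ≤ t * b x} ∩ {x | 0 ≤ r * c x}) := by ext x; simp [hA]
    rw [e]
    exact (measurableSet_le measurable_const (by fun_prop)).inter
      ((measurableSet_le measurable_const (by fun_prop)).inter (measurableSet_le measurable_const (by fun_prop)))
  have msa : Measurable fun x => sg (a x) := sg_meas.comp ma
  have msb : Measurable fun x => sg (b x) := sg_meas.comp mb
  have msc : Measurable fun x => sg (c x) := sg_meas.comp mc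
  have e : ν.real A = ν.real univ / 8 := by
    have e1 : ν.real A = ∫ x, (1 + s * sg (a x) + t * sg (b x) + r * sg (c x) + (s * t) * (sg (a x) * sg (b x))
        + (s * r) * (sg (a x) * sg (c x)) + (t * r) * (sg (b x) * sg (c x))
        + (s * t * r) * (sg (a x) * sg (b x) * sg (c x))) / 8 ∂ν := by
      rw [← integral_indicator_one mA]
      apply integral_congr_ae
      filter_upwards [ind_ae ν na σ, ind_ae ν nb τ, ind_ae ν nc ρ] with x h1 h2 h3
      have : A.indicator (1 : α → ℝ) x = (if 0 ≤ s * a x then (1:ℝ) else 0) *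
          (if 0 ≤ t * b x then (1:ℝ) else 0) * (if 0 ≤ r * c x then (1:ℝ) else 0) := by
        by_cases q1 : 0 ≤ s * a x <;> by_cases q2 : 0 ≤ t * b x <;> by_cases q3 : 0 ≤ r * c x <;>
          simp [hA, indicator, q1, q2, q3]
      rw [this, h1, h2, h3]; ring
    have bd : ∀ x y : ℝ, |x| ≤ 1 → |y| ≤ 1 → |x * y| ≤ 1 := by
      intro x y hx hy
      rw [abs_mul]; exact mul_le_one₀ hx (abs_nonneg _) hy
    have i1 : Integrable (fun x => sg (a x)) ν := int_bdd ν msa fun x => sg_abs_le _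
    have i2 : Integrable (fun x => sg (b x)) ν := int_bdd ν msb fun x => sg_abs_le _
    have i3 : Integrable (fun x => sg (c x)) ν := int_bdd ν msc fun x => sg_abs_le _
    have i4 : Integrable (fun x => sg (a x) * sg (b x)) ν := int_bdd ν (msa.mul msb) fun x =>
      bd _ _ (sg_abs_le _) (sg_abs_le _)
    have i5 : Integrable (fun x => sg (a x) * sg (c x)) ν := int_bdd ν (msa.mul msc) fun x =>
      bd _ _ (sg_abs_le _) (sg_abs_le _)
    have i6 : Integrable (fun x => sg (b x) * sg (c x)) ν := int_bdd ν (msb.mul msc) fun x =>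
      bd _ _ (sg_abs_le _) (sg_abs_le _)
    have i7 : Integrable (fun x => sg (a x) * sg (b x) * sg (c x)) ν := int_bdd ν ((msa.mul msb).mul msc) fun x =>
      bd _ _ (bd _ _ (sg_abs_le _) (sg_abs_le _)) (sg_abs_le _)
    have o1 := odd_int ν hν _ msa (by intro x; rw [oa, sg_neg])
    have o2 := odd_int ν hν _ msb (by intro x; rw [ob, sg_neg])
    have o3 := odd_int ν hν _ msc (by intro x; rw [oc, sg_neg])
    have o4 := odd_int ν hν (fun x => sg (a x) * sg (b x) * sg (c x)) ((msa.mul msb).mul msc)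
      (by intro x; simp only [oa, ob, oc, sg_neg]; ring)
    rw [e1, integral_div, integral_add (by fun_prop) (by fun_prop), integral_add (by fun_prop) (by fun_prop),
      integral_add (by fun_prop) (by fun_prop), integral_add (by fun_prop) (by fun_prop),
      integral_add (by fun_prop) (by fun_prop), integral_add (by fun_prop) (by fun_prop),
      integral_add (by fun_prop) (by fun_prop)]
    simp only [integral_const_mul, o1, o2, o3, o4, hab, hac, hbc]
    simp
  rw [← ENNReal.toReal_eq_toReal_iff' (measure_ne_top _ _) (ENNReal.div_ne_top (measure_ne_top _ _) (by norm_num)),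
    ENNReal.toReal_div]
  simpa [Measure.real] using e
end

lemma restrict_neg {α : Type*} [MeasurableSpace α] [AddCommGroup α] [MeasurableNeg α] (μ : Measure α)
    [μ.IsNegInvariant] {B : Set α} (mB : MeasurableSet B) (hB : ∀ x ∈ B, -x ∈ B) :
    (μ.restrict B).map Neg.neg = μ.restrict B := by
  have e : Neg.neg ⁻¹' B = B := by
    ext x
    constructor
    · intro hx
      have := hB _ hx
      simpa using this
    · exact hB x
  have := Measure.restrict_map (μ := μ) measurable_neg mB
  rw [e] at this
  rw [← this]
  congr 1
  exact Measure.map_neg_eq_self μ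

lemma solid {K : Set E3} (hK : Body K) {u v w : E3} (hu : u ≠ 0) (hv : v ≠ 0) (hw : w ≠ 0)
    (huv : F K u v = 0) (huw : F K u w = 0) (hvw : F K v w = 0) (σ τ ρ : Bool) :
    volume (K ∩ {x | 0 ≤ (if σ then (1:ℝ) else -1) * ⟪u, x⟫ ∧ 0 ≤ (if τ then (1:ℝ) else -1) * ⟪v, x⟫ ∧
      0 ≤ (if ρ then (1:ℝ) else -1) * ⟪w, x⟫}) = volume K / 8 := by
  have hfin : Fact (volume K < ⊤) := ⟨hK.comp.measure_lt_top⟩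
  have hae : ∀ {a : E3}, a ≠ 0 → ∀ᵐ x ∂(volume.restrict K), ⟪a, x⟫ ≠ 0 := by
    intro a ha
    apply ae_restrict_of_ae
    rw [ae_iff]; simpa using hyper_null ha
  have := oct (volume.restrict K) (restrict_neg _ hK.comp.measurableSet hK.symm)
    (a := fun x => ⟪u, x⟫) (b := fun x => ⟪v, x⟫) (c := fun x => ⟪w, x⟫) (by fun_prop) (by fun_prop) (by fun_prop)
    (by simp) (by simp) (by simp) (hae hu) (hae hv) (hae hw) huv huw hvw σ τ ρ
  rw [Measure.restrict_apply' hK.comp.measurableSet, Measure.restrict_apply_univ, inter_comm] at this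
  exact this

end EqP

namespace EqP
open MeasureTheory Set Filter Topology Real
open scoped RealInnerProductSpace

noncomputable def Lm (D M : E3) : ℝ × ℝ →L[ℝ] E3 :=
  (ContinuousLinearMap.fst ℝ ℝ ℝ).smulRight D + (ContinuousLinearMap.snd ℝ ℝ ℝ).smulRight M

lemma Lm_apply (D M : E3) (z : ℝ × ℝ) : Lm D M z = z.1 • D + z.2 • M := by simp [Lm]

section
variable {D M : E3} (h : ⟪D, M⟫ = 0) (hD : 1 ≤ ⟪D, D⟫) (hM : 1 ≤ ⟪M, M⟫)
include h hD hM

lemma Lm_inj : Function.Injective (Lm D M) := by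
  rw [injective_iff_map_eq_zero]
  intro z hz
  rw [Lm_apply] at hz
  have h1 : ⟪D, z.1 • D + z.2 • M⟫ = 0 := by rw [hz]; simp
  have h2 : ⟪M, z.1 • D + z.2 • M⟫ = 0 := by rw [hz]; simp
  rw [inner_add_right, real_inner_smul_right, real_inner_smul_right, h] at h1
  rw [inner_add_right, real_inner_smul_right, real_inner_smul_right, real_inner_comm, h] at h2
  have e1 : z.1 = 0 := by
    rcases mul_eq_zero.1 (show z.1 * ⟪D, D⟫ = 0 by linarith) with h | h
    · exact h
    · linarith
  have e2 : z.2 = 0 := by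
    rcases mul_eq_zero.1 (show z.2 * ⟪M, M⟫ = 0 by linarith) with h | h
    · exact h
    · linarith
  exact Prod.ext e1 e2

lemma Lm_emb : IsClosedEmbedding (Lm D M) :=
  LinearMap.isClosedEmbedding_of_injective (f := (Lm D M).toLinearMap)
    (LinearMap.ker_eq_bot.2 (Lm_inj h hD hM))

lemma Lm_range {u : E3} (hu : u ≠ 0) (huD : ⟪u, D⟫ = 0) (huM : ⟪u, M⟫ = 0) {x : E3} (hx : ⟪u, x⟫ = 0) :
    ∃ z, Lm D M z = x := by
  set y : E3 := x - (⟪D, x⟫ / ⟪D, D⟫) • D - (⟪M, x⟫ / ⟪M, M⟫) • M with hy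
  have hDD : ⟪D, D⟫ ≠ 0 := by linarith
  have hMM : ⟪M, M⟫ ≠ 0 := by linarith
  have hMD : ⟪M, D⟫ = 0 := by rw [real_inner_comm]; exact h
  have y1 : ⟪u, y⟫ = 0 := by
    simp only [hy, inner_sub_right, real_inner_smul_right, hx, huD, huM]; ring
  have y2 : ⟪D, y⟫ = 0 := by
    simp only [hy, inner_sub_right, real_inner_smul_right, h]; field_simp; ring
  have y3 : ⟪M, y⟫ = 0 := by
    simp only [hy, inner_sub_right, real_inner_smul_right, hMD]; field_simp; ring
  have y0 : y = 0 := by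
    by_contra hne
    have hDn : D ≠ 0 := by rintro rfl; simp at hDD
    have hMn : M ≠ 0 := by rintro rfl; simp at hMM
    have li : LinearIndependent ℝ ![u, D, M, y] := by
      apply linearIndependent_of_ne_zero_of_inner_eq_zero
      · intro i; fin_cases i <;> simp [hu, hDn, hMn, hne]
      · intro i j hij
        have q1 := real_inner_comm u D
        have q2 := real_inner_comm u M
        have q3 := real_inner_comm u y
        have q4 := real_inner_comm D y
        have q5 := real_inner_comm M y
        fin_cases i <;> fin_cases j <;> simp_all
    have := li.fintype_card_le_finrank
    simp at this
  refine ⟨(⟪D, x⟫ / ⟪D, D⟫, ⟪M, x⟫ / ⟪M, M⟫), ?_⟩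
  rw [Lm_apply]
  have : x = y + (⟪D, x⟫ / ⟪D, D⟫) • D + (⟪M, x⟫ / ⟪M, M⟫) • M := by rw [hy]; abel
  rw [y0, zero_add] at this
  exact this.symm

lemma haus_image : ∃ c : NNReal, ∀ B : Set (ℝ × ℝ), MeasurableSet B → Bornology.IsBounded B →
    μH[2] (Lm D M '' B) = c • volume B := by
  have emb : MeasurableEmbedding (Lm D M) := (Lm_emb h hD hM).measurableEmbedding
  set ν : Measure (ℝ × ℝ) := Measure.comap (Lm D M) μH[2] with hν
  have hap : ∀ B, ν B = μH[2] (Lm D M '' B) := fun B => emb.comap_apply _ _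
  have i1 : IsFiniteMeasureOnCompacts ν := by
    refine ⟨fun C hC => ?_⟩
    rw [hap]
    refine lt_of_le_of_lt ((Lm D M).lipschitz.hausdorffMeasure_image_le (by norm_num) C) ?_
    rw [hausdorffMeasure_prod_real]
    exact ENNReal.mul_lt_top (by simp) hC.measure_lt_top
  have i2 : ν.IsAddLeftInvariant := by
    refine ⟨fun v => ?_⟩
    ext B hB
    rw [Measure.map_apply (measurable_const_add v) hB, hap, hap]
    have e : Lm D M '' ((fun x => v + x) ⁻¹' B) = (fun x => Lm D M v + x) ⁻¹' (Lm D M '' B) := by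
      ext x
      constructor
      · rintro ⟨z, hz, rfl⟩
        exact ⟨v + z, hz, map_add _ _ _⟩
      · rintro ⟨z, hz, hzx⟩
        refine ⟨z - v, by simpa using hz, ?_⟩
        rw [map_sub, hzx]; simp
    rw [e, measure_preimage_add]
  refine ⟨Measure.addHaarScalarFactor ν volume, fun B hB hb => ?_⟩
  rw [← hap]
  exact Measure.measure_isAddInvariant_eq_smul_of_isCompact_closure_of_measurableSet ν volume hB
    hb.isCompact_closure

lemma Lm_null {a : E3} (ha : ¬ (⟪a, D⟫ = 0 ∧ ⟪a, M⟫ = 0)) : ∀ᵐ z : ℝ × ℝ, ⟪a, Lm D M z⟫ ≠ 0 := by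
  have := Measure.addHaar_submodule (volume : Measure (ℝ × ℝ))
    (LinearMap.ker ((innerSL ℝ a).comp (Lm D M)).toLinearMap)
    (by
      intro ht
      apply ha
      have h1 : ((1:ℝ), (0:ℝ)) ∈ LinearMap.ker ((innerSL ℝ a).comp (Lm D M)).toLinearMap := by rw [ht]; trivial
      have h2 : ((0:ℝ), (1:ℝ)) ∈ LinearMap.ker ((innerSL ℝ a).comp (Lm D M)).toLinearMap := by rw [ht]; trivial
      simp [Lm_apply] at h1 h2
      exact ⟨h1, h2⟩)
  rw [ae_iff]
  convert this using 2
  ext x; simp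

lemma polar_int {K : Set E3} (hK : Body K) {a b : E3} (hG : G K D M a b = 0) :
    ∫ z in Lm D M ⁻¹' K, sg ⟪a, Lm D M z⟫ * sg ⟪b, Lm D M z⟫ = 0 := by
  have hB : Bas D M := bas_of h hD hM
  have mK : MeasurableSet (Lm D M ⁻¹' K) := (Lm D M).continuous.measurable hK.comp.measurableSet
  rw [← integral_indicator mK, ← integral_comp_polarCoord_symm]
  set σ : ℝ → ℝ := fun t => sg ⟪a, pt D M t⟫ * sg ⟪b, pt D M t⟫ with hσ
  have mσ : Measurable σ := (sg_pt_meas _ _ _).mul (sg_pt_meas _ _ _)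
  have bσ : ∀ t, |σ t| ≤ 1 := fun t => by
    rw [hσ, abs_mul]; exact mul_le_one₀ (sg_abs_le _) (abs_nonneg _) (sg_abs_le _)
  set g : ℝ → ℝ := fun t => gauge K (pt D M t) with hg
  have gp : ∀ t, 0 < g t := fun t => gpos hK (hB.ne t)
  have cg : Continuous g := (gcont hK).comp (by unfold pt; fun_prop)
  set H : ℝ × ℝ → ℝ := fun p => {p : ℝ × ℝ | p.1 * g p.2 ≤ 1}.indicator (fun p => p.1 * σ p.2) p with hH
  have mH : Measurable H := by
    apply Measurable.indicator
    · exact measurable_fst.mul (mσ.comp measurable_snd)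
    · exact measurableSet_le (by fun_prop) (by fun_prop)
  have e1 : ∫ p in polarCoord.target, p.1 • (Lm D M ⁻¹' K).indicator
      (fun z => sg ⟪a, Lm D M z⟫ * sg ⟪b, Lm D M z⟫) (polarCoord.symm p) =
      ∫ p in Ioi (0:ℝ) ×ˢ Ioo (-π) π, H p := by
    rw [polarCoord_target]
    apply setIntegral_congr_fun (measurableSet_Ioi.prod measurableSet_Ioo)
    rintro ⟨r, t⟩ ⟨hr, -⟩
    have hr : 0 < r := hr
    have e : Lm D M (polarCoord.symm (r, t)) = r • pt D M t := by
      simp only [polarCoord_symm_apply, Lm_apply, pt, smul_add, smul_smul]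
    have em : r • pt D M t ∈ K ↔ r * g t ≤ 1 := by
      have := gauge_le_one_iff_mem_closure (x := r • pt D M t) hK.conv hK.nhds0
      rw [hK.comp.isClosed.closure_eq, gauge_smul_of_nonneg hr.le] at this
      exact this.symm
    simp only [hH, indicator, mem_preimage, e, em, mem_ofPred_eq, real_inner_smul_right, sg_mul_pos hr, smul_eq_mul, hσ]
    split_ifs <;> simp
  obtain ⟨C, hC⟩ := om_bound hK
  have hCp : 0 < C := lt_of_lt_of_le (om_pos hK hB 0) (hC D M hB 0)
  have rb : ∀ r t, 0 < r → r * g t ≤ 1 → r ≤ C + 1 := by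
    intro r t hr hrt
    have h1 : r ≤ (g t)⁻¹ := by rw [le_inv_comm₀ hr (gp t), ← one_div, le_div_iff₀ hr]; linarith
    have h2 : ((g t)⁻¹)^2 ≤ C := hC D M hB t
    nlinarith
  have iH : IntegrableOn H (Ioi (0:ℝ) ×ˢ Ioo (-π) π) := by
    have : IntegrableOn H (Ioc (0:ℝ) (C+1) ×ˢ Ioo (-π) π) := by
      apply Measure.integrableOn_of_bounded (M := C + 1)
      · rw [Measure.volume_eq_prod, Measure.prod_prod]
        exact ENNReal.mul_ne_top (by simp) (by simp)
      · exact mH.aestronglyMeasurable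
      · rw [ae_restrict_iff' (measurableSet_Ioc.prod measurableSet_Ioo)]
        refine Eventually.of_forall ?_
        rintro ⟨r, t⟩ ⟨⟨hr, hr'⟩, -⟩
        simp only at hr hr'
        refine (norm_indicator_le_norm_self _ _).trans ?_
        rw [norm_mul, Real.norm_of_nonneg hr.le, Real.norm_eq_abs]
        have := bσ t
        have := abs_nonneg (σ t)
        simp only
        nlinarith
    apply this.of_forall_diff_eq_zero (measurableSet_Ioi.prod measurableSet_Ioo)
    rintro ⟨r, t⟩ ⟨⟨hr, ht⟩, hn⟩
    apply indicator_of_notMem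
    intro hrt
    exact hn ⟨⟨hr, rb r t hr hrt⟩, ht⟩
  have e2 : ∀ t, ∫ r in Ioi (0:ℝ), H (r, t) = om K D M t * σ t / 2 := by
    intro t
    have hi : 0 < (g t)⁻¹ := inv_pos.2 (gp t)
    have : ∫ r in Ioi (0:ℝ), H (r, t) = ∫ r in Ioi (0:ℝ), (Iic (g t)⁻¹).indicator (fun r => r * σ t) r := by
      apply setIntegral_congr_fun measurableSet_Ioi
      intro r hr
      have e : r * g t ≤ 1 ↔ r ≤ (g t)⁻¹ := by
        rw [← one_div, le_div_iff₀ (gp t)]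
      simp only [hH, indicator, mem_ofPred_eq, e, mem_Iic]
    rw [this, setIntegral_indicator measurableSet_Iic, Ioi_inter_Iic, ← intervalIntegral.integral_of_le hi.le,
      intervalIntegral.integral_mul_const, integral_id]
    simp only [om, hg]; ring
  rw [e1, Measure.volume_eq_prod, ← Measure.prod_restrict, integral_prod_symm]
  · simp only [e2, integral_div]
    rw [← integral_Ioc_eq_integral_Ioo, ← intervalIntegral.integral_of_le (by linarith [pi_pos])]
    simp only [G] at hG
    rw [hG]; simp
  · rw [Measure.prod_restrict]; exact iH

end

lemma planar {K : Set E3} (hK : Body K) {u a b : E3} (hu : u ≠ 0) (hs : Sec K u a b) (σ τ : Bool) :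
    μH[2] (K ∩ {x | ⟪u, x⟫ = 0} ∩ {x | 0 ≤ (if σ then (1:ℝ) else -1) * ⟪a, x⟫ ∧
      0 ≤ (if τ then (1:ℝ) else -1) * ⟪b, x⟫}) = μH[2] (K ∩ {x | ⟪u, x⟫ = 0}) / 4 := by
  obtain ⟨D, M, h, hD, hM, huD, huM, ha, hb, hG⟩ := hs
  set P : Set (ℝ × ℝ) := Lm D M ⁻¹' K with hP
  have cP : IsCompact P := (Lm_emb h hD hM).isCompact_preimage hK.comp
  have mP : MeasurableSet P := cP.measurableSet
  set Q : Set (ℝ × ℝ) := {z | 0 ≤ (if σ then (1:ℝ) else -1) * ⟪a, Lm D M z⟫ ∧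
      0 ≤ (if τ then (1:ℝ) else -1) * ⟪b, Lm D M z⟫} with hQ
  have mQ : MeasurableSet Q := by
    have e : Q = {z | 0 ≤ (if σ then (1:ℝ) else -1) * ⟪a, Lm D M z⟫} ∩
      {z | 0 ≤ (if τ then (1:ℝ) else -1) * ⟪b, Lm D M z⟫} := by ext x; simp [hQ]
    rw [e]
    exact (measurableSet_le (by fun_prop) (by fun_prop)).inter (measurableSet_le (by fun_prop) (by fun_prop))
  have hLu : ∀ z, ⟪u, Lm D M z⟫ = 0 := by
    intro z
    rw [Lm_apply, inner_add_right, real_inner_smul_right, real_inner_smul_right, huD, huM]; ring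
  have s1 : K ∩ {x | ⟪u, x⟫ = 0} = Lm D M '' P := by
    ext x
    constructor
    · rintro ⟨hx, hx0⟩
      obtain ⟨z, rfl⟩ := Lm_range h hD hM hu huD huM hx0
      exact ⟨z, hx, rfl⟩
    · rintro ⟨z, hz, rfl⟩
      exact ⟨hz, hLu z⟩
  have s2 : K ∩ {x | ⟪u, x⟫ = 0} ∩ {x | 0 ≤ (if σ then (1:ℝ) else -1) * ⟪a, x⟫ ∧
      0 ≤ (if τ then (1:ℝ) else -1) * ⟪b, x⟫} = Lm D M '' (P ∩ Q) := by
    rw [s1]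
    ext x
    constructor
    · rintro ⟨⟨z, hz, rfl⟩, hx⟩
      exact ⟨z, ⟨hz, hx⟩, rfl⟩
    · rintro ⟨z, ⟨hz, hx⟩, rfl⟩
      exact ⟨⟨z, hz, rfl⟩, hx⟩
  have hfin : Fact (volume P < ⊤) := ⟨cP.measure_lt_top⟩
  have hsym : ∀ z ∈ P, -z ∈ P := by
    intro z hz
    simp only [hP, mem_preimage, map_neg]
    exact hK.symm _ hz
  have key := quad (volume.restrict P) (restrict_neg _ mP hsym)
    (a := fun z => ⟪a, Lm D M z⟫) (b := fun z => ⟪b, Lm D M z⟫) (by fun_prop) (by fun_prop)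
    (by simp) (by simp) (ae_restrict_of_ae (Lm_null h hD hM ha)) (ae_restrict_of_ae (Lm_null h hD hM hb))
    (polar_int h hD hM hK hG) σ τ
  rw [Measure.restrict_apply' mP, Measure.restrict_apply_univ, inter_comm] at key
  obtain ⟨c, hc⟩ := haus_image h hD hM
  rw [s2, s1, hc _ (mP.inter mQ) (cP.isBounded.subset inter_subset_left), hc _ mP cP.isBounded, key]
  simp only [ENNReal.smul_def, smul_eq_mul, mul_div_assoc]

end EqP

open MeasureTheory
open scoped RealInnerProductSpace

/-- Equipartition theorem: for every centrally symmetric convex body `K ⊂ ℝ³` there are three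
planes through the origin (given by their normals `u i`) splitting `K` into 8 pieces of equal
volume such that each section `K ∩ H i` is split by the other two planes into 4 parts of
equal area. -/
theorem equipartition_dim3 (K : Set (EuclideanSpace ℝ (Fin 3)))
    (hKcomp : IsCompact K) (hKconv : Convex ℝ K) (hKsymm : K = -K)
    (hKint : (interior K).Nonempty) :
    ∃ u : Fin 3 → EuclideanSpace ℝ (Fin 3),
      (∀ i, u i ≠ 0) ∧
      (∀ σ : Fin 3 → Bool,
        volume (K ∩ {x | ∀ i, 0 ≤ (if σ i then (1 : ℝ) else -1) * ⟪u i, x⟫}) =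
          volume K / 8) ∧
      (∀ i : Fin 3, ∀ σ : Fin 3 → Bool,
        μH[2] (K ∩ {x | ⟪u i, x⟫ = 0} ∩
            {x | ∀ j, j ≠ i → 0 ≤ (if σ j then (1 : ℝ) else -1) * ⟪u j, x⟫}) =
          μH[2] (K ∩ {x | ⟪u i, x⟫ = 0}) / 4) := by
  have hK := EqP.body_of K hKcomp hKconv hKsymm hKint
  obtain ⟨u, v, w, hu, hv, hw, huv, huw, hvw, s1, s2, s3⟩ := EqP.analytic K hK
  refine ⟨![u, v, w], ?_, ?_, ?_⟩
  · intro i; fin_cases i <;> simp [hu, hv, hw]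
  · intro σ
    have := EqP.solid hK hu hv hw huv huw hvw (σ 0) (σ 1) (σ 2)
    simpa [Fin.forall_fin_succ] using this
  · intro i σ
    have h1 := EqP.planar hK hu s1 (σ 1) (σ 2)
    have h2 := EqP.planar hK hv s2 (σ 0) (σ 2)
    have h3 := EqP.planar hK hw s3 (σ 0) (σ 1)
    fin_cases i
    · simpa [Fin.forall_fin_succ] using h1
    · simpa [Fin.forall_fin_succ] using h2
    · simpa [Fin.forall_fin_succ] using h3
end

section
/- Let L ⊂ ℝ² be a centrally symmetric convex body such that e₁, e₂ ∈ ∂L and the coordinate axes split L into four regions of equal area. Then B₁² ⊆ L ⊆ √2·B₂², i.e., the cross-polytope {|x₁|+|x₂| ≤ 1} is contained in L and L is contained in the Euclidean disk of radius √2. -/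
open MeasureTheory
open scoped RealInnerProductSpace

abbrev E2 := EuclideanSpace ℝ (Fin 2)

def tri : Set E2 := {x | 0 ≤ x 0 ∧ 0 < x 1 ∧ x 0 + x 1 ≤ 1}

lemma vol_img (m : Matrix (Fin 2) (Fin 2) ℝ) :
    volume (Matrix.toEuclideanLin m '' tri) = ENNReal.ofReal |m.det| * volume tri := by
  rw [Measure.addHaar_image_linearMap, Matrix.toEuclideanLin_eq_toLin, LinearMap.det_toLin]

lemma app0 (a b c d : ℝ) (x : E2) :
    (Matrix.toEuclideanLin !![a, b; c, d] x) 0 = a * x 0 + b * x 1 := by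
  simp [Matrix.toLpLin_apply, Matrix.mulVec, dotProduct, Fin.sum_univ_two]

lemma app1 (a b c d : ℝ) (x : E2) :
    (Matrix.toEuclideanLin !![a, b; c, d] x) 1 = c * x 0 + d * x 1 := by
  simp [Matrix.toLpLin_apply, Matrix.mulVec, dotProduct, Fin.sum_univ_two]

lemma ext2 {x y : E2} (h0 : x 0 = y 0) (h1 : x 1 = y 1) : x = y := by
  ext i; fin_cases i <;> assumption

lemma tri_pos : volume tri ≠ 0 := by
  have ho : IsOpen {x : E2 | 0 < x 0 ∧ 0 < x 1 ∧ x 0 + x 1 < 1} := by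
    have c0 : Continuous fun x : E2 => x 0 := by fun_prop
    have c1 : Continuous fun x : E2 => x 1 := by fun_prop
    exact (isOpen_lt continuous_const c0).inter ((isOpen_lt continuous_const c1).inter
      (isOpen_lt (c0.add c1) continuous_const))
  have hne : {x : E2 | 0 < x 0 ∧ 0 < x 1 ∧ x 0 + x 1 < 1}.Nonempty :=
    ⟨!₂[1/4, 1/4], by simp; norm_num⟩
  have hp := ho.measure_pos volume hne
  have hsub : {x : E2 | 0 < x 0 ∧ 0 < x 1 ∧ x 0 + x 1 < 1} ⊆ tri :=
    fun x hx => ⟨hx.1.le, hx.2.1, hx.2.2.le⟩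
  exact (hp.trans_le (measure_mono hsub)).ne'

lemma line_null : volume {x : E2 | x 1 = 0} = 0 := by
  let f : E2 →ₗ[ℝ] ℝ := (EuclideanSpace.proj (𝕜 := ℝ) (1 : Fin 2)).toLinearMap
  have := Measure.addHaar_submodule (volume : Measure E2) (LinearMap.ker f) (by
    intro h
    have h1 : (EuclideanSpace.single 1 1 : E2) ∈ LinearMap.ker f := by rw [h]; trivial
    simp [f] at h1)
  convert this using 2
  ext x; simp [f]

lemma tri_meas (m : Matrix (Fin 2) (Fin 2) ℝ) (hm : m.det ≠ 0) :
    MeasurableSet (Matrix.toEuclideanLin m '' tri) := by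
  have ht : MeasurableSet tri := by
    have c0 : Measurable fun x : E2 => x 0 := by fun_prop
    have c1 : Measurable fun x : E2 => x 1 := by fun_prop
    exact (measurableSet_le measurable_const c0).inter
      ((measurableSet_lt measurable_const c1).inter
      (measurableSet_le (c0.add c1) measurable_const))
  have hc : Continuous (Matrix.toEuclideanLin m) := LinearMap.continuous_of_finiteDimensional _
  refine ht.image_of_continuousOn_injOn hc.continuousOn ?_
  have hd : LinearMap.det (Matrix.toEuclideanLin m) ≠ 0 := by
    rwa [Matrix.toEuclideanLin_eq_toLin, LinearMap.det_toLin]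
  exact ((LinearMap.equivOfDetNeZero _ hd).injective).injOn

lemma support (L : Set E2) (hLconv : Convex ℝ L) (hLsymm : L = -L)
    (hLint : (interior L).Nonempty) (v : E2) (hv : v ∈ frontier L) :
    (0 : E2) ∈ interior L ∧ ∃ f : E2 →L[ℝ] ℝ, f v = 1 ∧ ∀ x ∈ L, |f x| ≤ 1 := by
  have h0 : (0 : E2) ∈ interior L := by
    obtain ⟨x, hx⟩ := hLint
    have hx' : -x ∈ interior L := by
      rw [hLsymm, ← Set.image_neg_eq_neg]
      have := (Homeomorph.neg E2).image_interior L
      simp only [Homeomorph.coe_neg] at this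
      rw [← this]
      exact ⟨x, hx, rfl⟩
    have := hLconv.interior hx hx' (a := 1/2) (b := 1/2) (by norm_num) (by norm_num) (by norm_num)
    simpa using this
  refine ⟨h0, ?_⟩
  obtain ⟨f, hf⟩ := geometric_hahn_banach_open_point hLconv.interior isOpen_interior hv.2
  have hpos : 0 < f v := by simpa using hf 0 h0
  have hle : ∀ x ∈ L, f x ≤ f v := by
    intro x hx
    have : x ∈ closure (interior L) := by
      rw [hLconv.closure_interior_eq_closure_of_nonempty_interior hLint]
      exact subset_closure hx
    exact closure_minimal (fun y hy => (hf y hy).le)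
      (isClosed_le f.continuous continuous_const) this
  refine ⟨(f v)⁻¹ • f, by simp [hpos.ne'], fun x hx => ?_⟩
  have h1 := hle x hx
  have h2 := hle (-x) (by rw [hLsymm] at hx; exact hx)
  rw [map_neg] at h2
  simp only [ContinuousLinearMap.smul_apply, smul_eq_mul, abs_mul, abs_inv, abs_of_pos hpos]
  rw [inv_mul_le_iff₀ hpos, mul_one, abs_le]
  constructor <;> linarith

lemma conv3 (L : Set E2) (hLconv : Convex ℝ L) (h0 : (0 : E2) ∈ L) {p q : E2} (hp : p ∈ L)
    (hq : q ∈ L) {α β : ℝ} (ha : 0 ≤ α) (hb : 0 ≤ β) (hab : α + β ≤ 1) : α • p + β • q ∈ L := by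
  have := hLconv.sum_mem (t := Finset.univ) (w := ![α, β, 1 - α - β]) (z := ![p, q, 0])
    (by intro i _; fin_cases i <;> simp <;> linarith)
    (by simp [Fin.sum_univ_three])
    (by intro i _; fin_cases i <;> simp [*])
  simpa [Fin.sum_univ_three] using this

set_option maxHeartbeats 1000000 in
lemma key (L : Set E2) (hLcomp : IsCompact L) (hLconv : Convex ℝ L)
    (h0 : (0 : E2) ∈ L) (ε : ℝ) (hε : ε * ε = 1) (habs : |ε| = 1)
    (he0 : (EuclideanSpace.single 0 ε : E2) ∈ L) (he1 : (EuclideanSpace.single 1 1 : E2) ∈ L)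
    (s t : ℝ) (hs : |s| ≤ 1) (ht : |t| ≤ 1)
    (hsL : ∀ w ∈ L, |w 0 + s * w 1| ≤ 1) (htL : ∀ w ∈ L, |t * w 0 + w 1| ≤ 1)
    (hvol : volume (L ∩ {x | 0 ≤ ε * x 0 ∧ 0 ≤ x 1}) = volume (L ∩ {x | 0 ≤ -ε * x 0 ∧ 0 ≤ x 1}))
    (a b : ℝ) (ha : 0 ≤ a) (hb : 0 ≤ b) (hp : !₂[ε * a, b] ∈ L) : a ^ 2 + b ^ 2 ≤ 2 := by
  have hsε : |ε * s| ≤ 1 := by rw [abs_mul, habs, one_mul]; exact hs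
  have htε : |ε * t| ≤ 1 := by rw [abs_mul, habs, one_mul]; exact ht
  -- normalized functionals
  have hS : ∀ w ∈ L, |ε * w 0 + (ε * s) * w 1| ≤ 1 := by
    intro w hw
    have := hsL w hw
    rw [show ε * w 0 + (ε * s) * w 1 = ε * (w 0 + s * w 1) by ring, abs_mul, habs, one_mul]
    exact this
  have hT : ∀ w ∈ L, |(ε * t) * (ε * w 0) + w 1| ≤ 1 := by
    intro w hw
    rw [show (ε * t) * (ε * w 0) + w 1 = t * w 0 + w 1 by linear_combination t * w 0 * hε]
    exact htL w hw
  generalize ε * s = S at hS hsε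
  generalize ε * t = T at hT htε
  have hpS := (abs_le.1 (hS _ hp)).2
  have hpT := (abs_le.1 (hT _ hp)).2
  have hεa : ε * (ε * a) = a := by linear_combination a * hε
  simp only [Fin.isValue, PiLp.toLp_apply, Matrix.cons_val_zero, Matrix.cons_val_one, hεa] at hpS hpT
  obtain ⟨hS1, hS2⟩ := abs_le.1 hsε
  obtain ⟨hT1, hT2⟩ := abs_le.1 htε
  by_contra! hcon
  have hbig : a + b < a ^ 2 + b ^ 2 := by nlinarith [sq_nonneg (a - 1), sq_nonneg (b - 1)]
  have hab1 : a - b ≤ 1 := by nlinarith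
  have hab2 : b - a ≤ 1 := by nlinarith
  have ha' : 0 < a := by
    rcases ha.eq_or_lt with h | h
    · subst h; nlinarith
    · exact h
  have hb' : 0 < b := by
    rcases hb.eq_or_lt with h | h
    · subst h; nlinarith
    · exact h
  have hsum : 1 < a + b := by nlinarith [mul_pos ha' hb']
  have hd : 0 < a + b - 1 := by linarith
  obtain ⟨u, hu⟩ : ∃ u, u = (b - a + 1) * a / (a + b - 1) := ⟨_, rfl⟩
  obtain ⟨v, hv⟩ : ∃ v, v = (a - b + 1) * b / (a + b - 1) := ⟨_, rfl⟩
  have hu0 : 0 ≤ u := by rw [hu]; exact div_nonneg (mul_nonneg (by linarith) ha) hd.le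
  have hv0 : 0 ≤ v := by rw [hv]; exact div_nonneg (mul_nonneg (by linarith) hb) hd.le
  have hq1 : b * u + (a - 1) * v = b := by rw [hu, hv]; field_simp; ring
  have hq2 : a * v + (b - 1) * u = a := by rw [hu, hv]; field_simp; ring
  have hlt : u + v < a + b := by
    rw [hu, hv, ← add_div, div_lt_iff₀ hd]; nlinarith
  -- lower bound
  have hlow : ENNReal.ofReal (a + b) * volume tri ≤
      volume (L ∩ {x | 0 ≤ ε * x 0 ∧ 0 ≤ x 1}) := by
    have d1 : (!![ε, ε * a; 0, b]).det = ε * b := by simp [Matrix.det_fin_two]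
    have d2 : (!![ε * a, 0; b, 1]).det = ε * a := by simp [Matrix.det_fin_two]
    have hεne : ε ≠ 0 := by rintro rfl; simp at habs
    have v1 := vol_img !![ε, ε * a; 0, b]
    have v2 := vol_img !![ε * a, 0; b, 1]
    rw [d1, abs_mul, habs, one_mul, abs_of_nonneg hb] at v1
    rw [d2, abs_mul, habs, one_mul, abs_of_nonneg ha] at v2
    rw [ENNReal.ofReal_add ha hb, add_mul, ← v1, ← v2, add_comm, ← measure_union]
    · apply measure_mono
      rintro w (⟨x, ⟨h1, h2, h3⟩, rfl⟩ | ⟨x, ⟨h1, h2, h3⟩, rfl⟩)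
      · refine ⟨?_, ?_, ?_⟩
        · convert conv3 L hLconv h0 he0 hp h1 h2.le h3 using 1
          apply ext2
          · rw [app0]; simp; ring
          · rw [app1]; simp; ring
        · rw [app0, show ε * (ε * x 0 + ε * a * x 1) = x 0 + a * x 1 by
            linear_combination (x 0 + a * x 1) * hε]
          positivity
        · rw [app1]; nlinarith
      · refine ⟨?_, ?_, ?_⟩
        · convert conv3 L hLconv h0 hp he1 h1 h2.le h3 using 1
          apply ext2
          · rw [app0]; simp; ring
          · rw [app1]; simp; ring
        · rw [app0, show ε * (ε * a * x 0 + 0 * x 1) = a * x 0 by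
            linear_combination (a * x 0) * hε]
          positivity
        · rw [app1]; positivity
    · rw [Set.disjoint_left]
      rintro w ⟨x, ⟨h1, h2, h3⟩, rfl⟩ ⟨y, ⟨k1, k2, k3⟩, hy⟩
      have e0 := congrArg (fun z : E2 => z 0) hy
      have e1 := congrArg (fun z : E2 => z 1) hy
      simp only [app0, app1] at e0 e1
      have e0' : a * y 0 = x 0 + a * x 1 := by
        linear_combination ε * e0 - (a * y 0 - x 0 - a * x 1) * hε
      nlinarith [mul_pos ha' k2, mul_nonneg hb h1]
    · exact tri_meas _ (by rw [d2]; positivity)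
  have hup : volume (L ∩ {x | 0 ≤ -ε * x 0 ∧ 0 ≤ x 1}) ≤
      ENNReal.ofReal (u + v) * volume tri := by
    have d1 : (!![-ε, -ε * u; 0, v]).det = -(ε * v) := by simp [Matrix.det_fin_two]
    have d2 : (!![-ε * u, 0; v, 1]).det = -(ε * u) := by simp [Matrix.det_fin_two]
    have v1 := vol_img !![-ε, -ε * u; 0, v]
    have v2 := vol_img !![-ε * u, 0; v, 1]
    rw [d1, abs_neg, abs_mul, habs, one_mul, abs_of_nonneg hv0] at v1
    rw [d2, abs_neg, abs_mul, habs, one_mul, abs_of_nonneg hu0] at v2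
    rw [ENNReal.ofReal_add hu0 hv0, add_mul, ← v1, ← v2]
    have hcov : (L ∩ {x | 0 ≤ -ε * x 0 ∧ 0 ≤ x 1}) ⊆
      (Matrix.toEuclideanLin !![-ε * u, 0; v, 1] '' tri ∪
       Matrix.toEuclideanLin !![-ε, -ε * u; 0, v] '' tri) ∪ {x : E2 | x 1 = 0} := by
      rintro w ⟨hwL, hw0, hw1⟩
      have k1 := (abs_le.1 (hS w hwL)).1
      have k2 := (abs_le.1 (hT w hwL)).2
      obtain ⟨c, hc⟩ : ∃ c, c = -ε * w 0 := ⟨_, rfl⟩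
      obtain ⟨d, hdd⟩ : ∃ d, d = w 1 := ⟨_, rfl⟩
      have hc' : ε * w 0 = -c := by rw [hc]; ring
      have hw0c : w 0 = -ε * c := by rw [hc]; linear_combination -w 0 * hε
      rw [hc', ← hdd] at k1 k2
      simp only [← hc, ← hdd] at hw0 hw1
      have m1 : b * c + (a - 1) * d ≤ b := by
        linarith [mul_le_mul_of_nonneg_left k1 hb, mul_le_mul_of_nonneg_left hpS hw1]
      have m2 : a * d + (b - 1) * c ≤ a := by
        linarith [mul_le_mul_of_nonneg_left k2 ha, mul_le_mul_of_nonneg_left hpT hw0]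
      rcases hw1.eq_or_lt with hz | hdpos
      · right; show w 1 = 0; rw [← hdd, ← hz]
      left
      rcases le_or_gt (d * u) (c * v) with hcase | hcase
      · right
        have hvpos : 0 < v := by
          rcases hv0.eq_or_lt with hz | h
          · rw [← hz] at hcase hq1 hq2
            have : u = 0 := by nlinarith
            rw [this] at hq1; linarith
          · exact h
        refine ⟨!₂[c - u * (d / v), d / v], ⟨?_, ?_, ?_⟩, ?_⟩
        · simp only [Fin.isValue, PiLp.toLp_apply, Matrix.cons_val_zero]
          rw [sub_nonneg, ← mul_div_assoc, div_le_iff₀ hvpos]; linarith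
        · show 0 < d / v
          positivity
        · simp only [Fin.isValue, PiLp.toLp_apply, Matrix.cons_val_one, Matrix.cons_val_zero]
          have : d = (d / v) * v := by field_simp
          generalize d / v = g at *
          rw [this] at m1
          have : b * (c - u * g + g) ≤ b * 1 := by
            linarith [congrArg (g * ·) hq1]
          exact le_of_mul_le_mul_left this hb'
        · apply ext2
          · rw [app0, hw0c]; simp; ring
          · rw [app1, ← hdd]; simp; field_simp
      · left
        have hupos : 0 < u := by
          rcases hu0.eq_or_lt with hz | h
          · rw [← hz] at hcase
            nlinarith
          · exact h
        refine ⟨!₂[c / u, d - v * (c / u)], ⟨?_, ?_, ?_⟩, ?_⟩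
        · simp only [Fin.isValue, PiLp.toLp_apply, Matrix.cons_val_zero]
          positivity
        · show 0 < d - v * (c / u)
          rw [sub_pos, ← mul_div_assoc, div_lt_iff₀ hupos]; linarith
        · simp only [Fin.isValue, PiLp.toLp_apply, Matrix.cons_val_one, Matrix.cons_val_zero]
          have : c = (c / u) * u := by field_simp
          generalize c / u = g at *
          rw [this] at m2
          have : a * (g + (d - v * g)) ≤ a * 1 := by
            linarith [congrArg (g * ·) hq2]
          exact le_of_mul_le_mul_left this ha'
        · apply ext2
          · rw [app0, hw0c]; simp; field_simp
          · rw [app1, ← hdd]; simp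
    refine (measure_mono hcov).trans ((measure_union_le _ _).trans ?_)
    rw [line_null, add_zero]
    exact measure_union_le _ _
  have hfin : volume tri ≠ ⊤ := by
    intro h
    rw [h, ENNReal.mul_top (by simpa using by linarith)] at hlow
    have : volume L < ⊤ := hLcomp.measure_lt_top
    exact absurd (hlow.trans (measure_mono Set.inter_subset_left)) (not_le.2 this)
  have hfinal := hlow.trans (hvol.le.trans hup)
  rw [ENNReal.mul_le_mul_iff_left tri_pos hfin, ENNReal.ofReal_le_ofReal_iff (by linarith)] at hfinal
  linarith

/-- A planar symmetric convex body equipartitioned by the standard orthonormal basis satisfies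
`B₁² ⊆ L ⊆ √2 B₂²`. -/
theorem equipartitioned_planar_bounds (L : Set (EuclideanSpace ℝ (Fin 2)))
    (hLcomp : IsCompact L) (hLconv : Convex ℝ L) (hLsymm : L = -L)
    (hLint : (interior L).Nonempty)
    (he : ∀ i : Fin 2, EuclideanSpace.single i (1 : ℝ) ∈ frontier L)
    (hquad : ∀ σ : Fin 2 → Bool,
      volume (L ∩ {x | ∀ i, 0 ≤ (if σ i then (1 : ℝ) else -1) * x i}) = volume L / 4) :
    {x : EuclideanSpace ℝ (Fin 2) | |x 0| + |x 1| ≤ 1} ⊆ L ∧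
    L ⊆ Metric.closedBall 0 (Real.sqrt 2) := by
  have hneg : ∀ x ∈ L, -x ∈ L := fun x hx => by rw [hLsymm] at hx; exact hx
  have hmem : ∀ i : Fin 2, EuclideanSpace.single i (1 : ℝ) ∈ L := fun i =>
    hLcomp.isClosed.frontier_subset (he i)
  have hmem' : ∀ (i : Fin 2) (ε : ℝ), ε = 1 ∨ ε = -1 → (EuclideanSpace.single i ε : E2) ∈ L := by
    rintro i ε (rfl | rfl)
    · exact hmem i
    · have := hneg _ (hmem i)
      convert this using 1
      ext j; by_cases h : j = i <;> simp [h]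
  obtain ⟨h0, f, hf1, hf⟩ := support L hLconv hLsymm hLint _ (he 0)
  obtain ⟨-, g, hg1, hg⟩ := support L hLconv hLsymm hLint _ (he 1)
  have h0L := interior_subset h0
  have hdec : ∀ w : E2, w = w 0 • EuclideanSpace.single 0 (1 : ℝ)
      + w 1 • EuclideanSpace.single 1 (1 : ℝ) := by
    intro w; apply ext2 <;> simp
  constructor
  · intro x hx
    have hx : |x 0| + |x 1| ≤ 1 := hx
    have hsg : ∀ r : ℝ, ∃ ε : ℝ, (ε = 1 ∨ ε = -1) ∧ |r| * ε = r := by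
      intro r
      rcases le_total 0 r with h | h
      · exact ⟨1, Or.inl rfl, by rw [abs_of_nonneg h, mul_one]⟩
      · exact ⟨-1, Or.inr rfl, by rw [abs_of_nonpos h]; ring⟩
    obtain ⟨ε, hε, e1⟩ := hsg (x 0)
    obtain ⟨δ, hδ, e2⟩ := hsg (x 1)
    convert conv3 L hLconv h0L (hmem' 0 ε hε) (hmem' 1 δ hδ) (abs_nonneg _) (abs_nonneg _) hx
    apply ext2
    · simp [e1]
    · simp [e2]
  · have hv1 := hquad ![true, true]
    have hv2 := hquad ![false, true]
    simp only [Fin.forall_fin_two, Fin.isValue, Matrix.cons_val_zero, Matrix.cons_val_one,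
      if_true, Bool.false_eq_true, if_false, one_mul] at hv1 hv2
    have hkey : ∀ ε : ℝ, (ε = 1 ∨ ε = -1) → ∀ a b : ℝ, 0 ≤ a → 0 ≤ b → !₂[ε * a, b] ∈ L →
        a ^ 2 + b ^ 2 ≤ 2 := by
      intro ε hε a b ha hb hp
      refine key L hLcomp hLconv h0L ε (by rcases hε with rfl | rfl <;> norm_num)
        (by rcases hε with rfl | rfl <;> norm_num) (hmem' 0 ε hε) (hmem 1)
        (f (EuclideanSpace.single 1 1)) (g (EuclideanSpace.single 0 1))
        (hf _ (hmem 1)) (hg _ (hmem 0)) ?_ ?_ ?_ a b ha hb hp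
      · intro w hw
        have := hf w hw
        rw [hdec w, map_add, map_smul, map_smul, hf1, smul_eq_mul, smul_eq_mul] at this
        rwa [mul_one, mul_comm (w 1)] at this
      · intro w hw
        have := hg w hw
        rw [hdec w, map_add, map_smul, map_smul, hg1, smul_eq_mul, smul_eq_mul] at this
        rwa [mul_one, mul_comm (w 0)] at this
      · rcases hε with rfl | rfl
        · simp only [one_mul]; rw [hv1, hv2]
        · simp only [neg_neg, one_mul]; rw [hv1, hv2]
    have hup : ∀ x ∈ L, 0 ≤ x 1 → x 0 ^ 2 + x 1 ^ 2 ≤ 2 := by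
      intro x hx h1
      rcases le_total 0 (x 0) with h | h
      · refine hkey 1 (Or.inl rfl) _ _ h h1 ?_
        convert hx using 1
        apply ext2 <;> simp
      · have := hkey (-1) (Or.inr rfl) (-x 0) (x 1) (by linarith) h1 (by
          convert hx using 1
          apply ext2 <;> simp)
        simpa using this
    intro x hx
    rw [mem_closedBall_zero_iff, EuclideanSpace.norm_eq]
    apply Real.sqrt_le_sqrt
    simp only [Fin.sum_univ_two, Real.norm_eq_abs, sq_abs]
    rcases le_total 0 (x 1) with h | h
    · exact hup x hx h
    · have := hup (-x) (hneg x hx) (by simpa using h)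
      simpa using this
end

section
/- Let P ⊂ ℝ² be a centrally symmetric parallelogram with nonempty interior such that ±e₁, ±e₂ ∈ ∂P and the coordinate axes split P into four parts of equal area. Then P is a square (its four vertices are at equal Euclidean distance from the origin and its diagonals are orthogonal), centered at the origin. -/
open MeasureTheory
open scoped RealInnerProductSpace

/-- Core measure-theoretic step: if `K` is a complex structure preserving `P`, then the first
coordinate of `K e₁` is not positive. -/
theorem core_not_pos (P : Set (EuclideanSpace ℝ (Fin 2)))
    (K : EuclideanSpace ℝ (Fin 2) →ₗ[ℝ] EuclideanSpace ℝ (Fin 2))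
    (hK : ∀ x, K (K x) = -x) (hKP : ∀ x ∈ P, K x ∈ P)
    (hfin : volume P ≠ ⊤) (hint : P ∈ nhds (0 : EuclideanSpace ℝ (Fin 2)))
    (hquad : ∀ σ : Fin 2 → Bool,
      volume (P ∩ {x | ∀ i, 0 ≤ (if σ i then (1 : ℝ) else -1) * x i}) = volume P / 4) :
    ¬ 0 < (K (EuclideanSpace.single 0 1)) 0 := by
  intro hx
  obtain ⟨X, hX⟩ : ∃ X, X = (K (EuclideanSpace.single 0 1)) 0 := ⟨_, rfl⟩
  obtain ⟨Y, hY⟩ : ∃ Y, Y = (K (EuclideanSpace.single 0 1)) 1 := ⟨_, rfl⟩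
  rw [← hX] at hx
  have hKe : K (EuclideanSpace.single 0 1) =
      X • EuclideanSpace.single 0 1 + Y • EuclideanSpace.single 1 1 := by
    ext i
    fin_cases i <;> simp [hX, hY]
  have hYne : Y ≠ 0 := by
    intro h0
    have h1 := hK (EuclideanSpace.single 0 1)
    rw [hKe, h0] at h1
    simp only [zero_smul, add_zero, map_smul] at h1
    rw [hKe, h0] at h1
    have h2 := congrArg (fun z : EuclideanSpace ℝ (Fin 2) => z 0) h1
    simp at h2
    nlinarith
  -- coordinates with respect to `e₁, K e₁`
  set β : EuclideanSpace ℝ (Fin 2) → ℝ := fun x => x 1 / Y with hβ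
  set α : EuclideanSpace ℝ (Fin 2) → ℝ := fun x => x 0 - X * (x 1 / Y) with hα
  have hdec : ∀ x, x = α x • EuclideanSpace.single 0 1 +
      β x • K (EuclideanSpace.single 0 1) := by
    intro x
    rw [hKe]
    ext i
    fin_cases i
    · simp [hα, hβ]; ring
    · simp [hα, hβ]; field_simp
  have hKx : ∀ x, K x = (-β x) • EuclideanSpace.single 0 1 +
      α x • K (EuclideanSpace.single 0 1) := by
    intro x
    conv_lhs => rw [hdec x]
    rw [map_add, map_smul, map_smul, hK]
    module
  have hKx' : ∀ x, K x = (-β x + α x * X) • EuclideanSpace.single 0 1 +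
      (α x * Y) • EuclideanSpace.single 1 1 := by
    intro x
    rw [hKx, hKe]; module
  have hβK : ∀ x, β (K x) = α x := by
    intro x
    have : (K x) 1 = α x * Y := by rw [hKx']; simp
    simp only [hβ, this]
    field_simp
  have hαK : ∀ x, α (K x) = - β x := by
    intro x
    have h1 : (K x) 1 = α x * Y := by rw [hKx']; simp
    have h0 : (K x) 0 = -β x + α x * X := by rw [hKx']; simp
    have : α (K x) = (K x) 0 - X * ((K x) 1 / Y) := rfl
    rw [this, h0, h1]
    field_simp
    ring
  have hαn : ∀ x, α (-x) = - α x := by intro x; simp [hα]; ring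
  have hβn : ∀ x, β (-x) = - β x := by intro x; simp [hβ]; ring
  have hdet : |LinearMap.det K| = 1 := by
    have h1 : K ∘ₗ K = (-1 : ℝ) • LinearMap.id := by
      ext1 x; simp [hK]
    have h2 := congrArg LinearMap.det h1
    rw [LinearMap.det_comp, LinearMap.det_smul] at h2
    simp at h2
    have h3 : |LinearMap.det K| * |LinearMap.det K| = 1 := by
      rw [← abs_mul, h2, abs_one]
    nlinarith [abs_nonneg (LinearMap.det K)]
  have hvolK : ∀ s, volume (K ⁻¹' s) = volume s := by
    intro s
    have h0 : LinearMap.det K ≠ 0 := by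
      intro h; rw [h] at hdet; simp at hdet
    rw [Measure.addHaar_preimage_linearMap _ h0, abs_inv, hdet]
    simp
  set S : Set (EuclideanSpace ℝ (Fin 2)) := P ∩ {x | 0 ≤ α x ∧ 0 ≤ β x} with hS
  have hPn : ∀ x ∈ P, -x ∈ P := by
    intro x hxP
    rw [← hK x]; exact hKP _ (hKP _ hxP)
  have hcover : P ⊆ (S ∪ K ⁻¹' S) ∪ (K ⁻¹' (K ⁻¹' S) ∪ K ⁻¹' (K ⁻¹' (K ⁻¹' S))) := by
    intro x hxP
    have m1 := hKP x hxP
    have m2 := hKP _ m1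
    have m3 := hKP _ m2
    simp only [hS, Set.mem_union, Set.mem_preimage, Set.mem_inter_iff, Set.mem_ofPred_eq,
      hxP, m1, m2, m3, hαK, hβK, true_and]
    rcases le_total 0 (α x) with h1 | h1 <;> rcases le_total 0 (β x) with h2 | h2
    · exact Or.inl (Or.inl ⟨h1, h2⟩)
    · exact Or.inl (Or.inr ⟨by linarith, h1⟩)
    · exact Or.inr (Or.inr ⟨by linarith, by linarith⟩)
    · exact Or.inr (Or.inl ⟨by linarith, by linarith⟩)
  have hle : volume P ≤ 4 * volume S := by
    calc volume P ≤ _ := measure_mono hcover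
      _ ≤ (volume S + volume (K ⁻¹' S)) +
          (volume (K ⁻¹' (K ⁻¹' S)) + volume (K ⁻¹' (K ⁻¹' (K ⁻¹' S)))) :=
        (measure_union_le _ _).trans (add_le_add (measure_union_le _ _) (measure_union_le _ _))
      _ = 4 * volume S := by
        simp only [hvolK]; ring
  -- the missing open piece
  have hαc : Continuous α := by simp only [hα]; fun_prop
  set U : Set (EuclideanSpace ℝ (Fin 2)) :=
    interior P ∩ {x | α x < 0 ∧ 0 < x 0 ∧ 0 < Y * x 1} with hU
  have hUo : IsOpen U := by
    refine isOpen_interior.inter ?_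
    have h1 : IsOpen {x | α x < 0} := isOpen_lt hαc continuous_const
    have h2 : IsOpen {x : EuclideanSpace ℝ (Fin 2) | 0 < x 0} :=
      isOpen_lt continuous_const (by fun_prop)
    have h3 : IsOpen {x : EuclideanSpace ℝ (Fin 2) | 0 < Y * x 1} :=
      isOpen_lt continuous_const (by fun_prop)
    convert h1.inter (h2.inter h3) using 1
    ext x; simp
  have hUne : U.Nonempty := by
    have hc : Filter.Tendsto (fun c : ℝ => c • (!₂[X / 2, Y] : EuclideanSpace ℝ (Fin 2)))
        (nhdsWithin 0 (Set.Ioi 0)) (nhds 0) := by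
      have : Continuous (fun c : ℝ => c • (!₂[X / 2, Y] : EuclideanSpace ℝ (Fin 2))) := by
        fun_prop
      have h := this.tendsto 0
      rw [zero_smul] at h
      exact h.mono_left nhdsWithin_le_nhds
    have h1 := hc.eventually (interior_mem_nhds.2 hint)
    obtain ⟨c, hcP, hc0⟩ := (h1.and self_mem_nhdsWithin).exists
    have hc0 : 0 < c := hc0
    refine ⟨_, hcP, ?_, ?_, ?_⟩
    · simp [hα]
      field_simp
      nlinarith
    · simp; positivity
    · simp
      have : 0 < Y * Y := mul_self_pos.2 hYne
      nlinarith
  have hUpos : 0 < volume U := hUo.measure_pos _ hUne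
  have hdisj : Disjoint S U := by
    rw [Set.disjoint_left]
    rintro x ⟨_, h1, _⟩ ⟨_, h2, _⟩
    linarith
  have hsub : ∃ σ : Fin 2 → Bool,
      S ∪ U ⊆ P ∩ {x | ∀ i, 0 ≤ (if σ i then (1 : ℝ) else -1) * x i} := by
    refine ⟨![true, decide (0 < Y)], ?_⟩
    have key : ∀ x : EuclideanSpace ℝ (Fin 2), 0 ≤ x 0 → 0 ≤ Y * x 1 → ∀ i, 
        0 ≤ (if (![true, decide (0 < Y)] : Fin 2 → Bool) i then (1 : ℝ) else -1) * x i := by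
      intro x h0 h1 i
      fin_cases i
      · simpa using h0
      · rcases lt_or_gt_of_ne hYne with h | h
        · have : x 1 ≤ 0 := by by_contra! h'; nlinarith
          simp [not_lt.2 h.le, this]
        · have : 0 ≤ x 1 := by by_contra! h'; nlinarith
          simp [h, this]
    rintro x (⟨hxP, h1, h2⟩ | ⟨hxP, h1, h2, h3⟩)
    · refine ⟨hxP, key x ?_ ?_⟩
      · have : α x = x 0 - X * β x := rfl
        nlinarith [mul_nonneg hx.le h2]
      · have : x 1 = β x * Y := by simp only [hβ]; field_simp
        rw [this]
        nlinarith [mul_nonneg h2 (mul_self_nonneg Y)]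
    · exact ⟨interior_subset hxP, key x h2.le h3.le⟩
  obtain ⟨σ, hσ⟩ := hsub
  have h4 : volume S + volume U ≤ volume P / 4 := by
    rw [← measure_union hdisj hUo.measurableSet, ← hquad σ]
    exact measure_mono hσ
  have hSfin : volume S ≠ ⊤ := ne_top_of_le_ne_top hfin (measure_mono Set.inter_subset_left)
  have h5 : volume P / 4 ≤ volume S := by
    rw [ENNReal.div_le_iff_le_mul (by simp) (by simp), mul_comm]; exact hle
  have h6 : volume S < volume S + volume U := ENNReal.lt_add_right hSfin hUpos.ne'
  exact absurd (h6.trans_le (h4.trans h5)) (lt_irrefl _)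

/-- A centrally symmetric parallelogram `P = {s u + t v : s, t ∈ [-1,1]}` with nonempty
interior which is equipartitioned by the standard orthonormal axes is a square: its diagonals
(along `u + v` and `u - v`) have the same length and are orthogonal. -/
theorem equipartitioned_parallelogram_is_square
    (u v : EuclideanSpace ℝ (Fin 2)) (huv : LinearIndependent ℝ ![u, v])
    (P : Set (EuclideanSpace ℝ (Fin 2)))
    (hP : P = {p | ∃ s ∈ Set.Icc (-1 : ℝ) 1, ∃ t ∈ Set.Icc (-1 : ℝ) 1, p = s • u + t • v})
    (he : ∀ i : Fin 2, EuclideanSpace.single i (1 : ℝ) ∈ frontier P)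
    (hquad : ∀ σ : Fin 2 → Bool,
      volume (P ∩ {x | ∀ i, 0 ≤ (if σ i then (1 : ℝ) else -1) * x i}) = volume P / 4) :
    ‖u + v‖ = ‖u - v‖ ∧ ⟪u + v, u - v⟫ = 0 := by
  let b := basisOfLinearIndependentOfCardEqFinrank huv (by simp)
  have hb0 : b 0 = u := by simp [b]
  have hb1 : b 1 = v := by simp [b]
  let φ : EuclideanSpace ℝ (Fin 2) ≃L[ℝ] (Fin 2 → ℝ) := b.equivFun.toContinuousLinearEquiv
  have hφ : ∀ x, x = φ x 0 • u + φ x 1 • v := by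
    intro x
    have := b.sum_equivFun x
    rw [Fin.sum_univ_two, hb0, hb1] at this
    exact this.symm
  have hφu : φ u = ![1, 0] := by
    have : φ u = b.equivFun (b 0) := by rw [hb0]; rfl
    rw [this]
    ext i; fin_cases i <;> simp [b.equivFun_self]
  have hφv : φ v = ![0, 1] := by
    have : φ v = b.equivFun (b 1) := by rw [hb1]; rfl
    rw [this]
    ext i; fin_cases i <;> simp [b.equivFun_self]
  have hPφ : P = φ ⁻¹' Metric.closedBall 0 1 := by
    rw [hP]
    ext x
    simp only [Set.mem_ofPred_eq, Set.mem_preimage, mem_closedBall_zero_iff,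
      pi_norm_le_iff_of_nonneg zero_le_one, Fin.forall_fin_two, Real.norm_eq_abs, abs_le]
    constructor
    · rintro ⟨s, hs, t, ht, rfl⟩
      simp [hφu, hφv]
      exact ⟨hs, ht⟩
    · rintro ⟨h0, h1⟩
      exact ⟨_, h0, _, h1, hφ x⟩
  have hfr : frontier P = φ ⁻¹' Metric.sphere 0 1 := by
    rw [hPφ, ← frontier_closedBall (0 : Fin 2 → ℝ) one_ne_zero]
    exact (φ.toHomeomorph.preimage_frontier _).symm
  have hnorm : ∀ i : Fin 2, ‖φ (EuclideanSpace.single i (1 : ℝ))‖ = 1 := by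
    intro i
    have := he i
    rw [hfr] at this
    simpa using this
  have hnhds : P ∈ nhds (0 : EuclideanSpace ℝ (Fin 2)) := by
    rw [hPφ]
    apply φ.continuous.continuousAt.preimage_mem_nhds
    rw [map_zero]
    exact Metric.closedBall_mem_nhds _ one_pos
  have hcomp : IsCompact P := by
    rw [hPφ]
    exact φ.toHomeomorph.isCompact_preimage.2 (isCompact_closedBall _ _)
  have hfin : volume P ≠ ⊤ := hcomp.measure_lt_top.ne
  let J : EuclideanSpace ℝ (Fin 2) →ₗ[ℝ] EuclideanSpace ℝ (Fin 2) := b.constr ℝ ![v, -u]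
  have hJu : J u = v := by
    conv_lhs => rw [← hb0]
    simp [J]
  have hJv : J v = -u := by
    conv_lhs => rw [← hb1]
    simp [J]
  have hJJ : ∀ x, J (J x) = -x := by
    intro x
    rw [hφ x]
    simp only [map_add, map_smul, hJu, hJv, map_neg]
    module
  have hφJ : ∀ x, φ (J x) = ![-(φ x 1), φ x 0] := by
    intro x
    conv_lhs => rw [hφ x]
    simp only [map_add, map_smul, hJu, hJv, map_neg, hφu, hφv]
    ext i; fin_cases i <;> simp
  have hφn : ∀ x, ‖φ (J x)‖ = ‖φ x‖ := by
    have hle : ∀ x, ‖φ (J x)‖ ≤ ‖φ x‖ := by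
      intro x
      rw [pi_norm_le_iff_of_nonneg (norm_nonneg _), hφJ, Fin.forall_fin_two]
      constructor
      · simpa using norm_le_pi_norm (φ x) 1
      · simpa using norm_le_pi_norm (φ x) 0
    intro x
    apply le_antisymm (hle x)
    have := hle (J x)
    rwa [hJJ, map_neg, norm_neg] at this
  have hJP : ∀ x ∈ P, J x ∈ P := by
    intro x hx
    rw [hPφ] at hx ⊢
    simpa [hφn] using hx
  have hJP' : ∀ x ∈ P, (-J) x ∈ P := by
    intro x hx
    rw [hPφ] at hx ⊢
    simpa [hφn] using hx
  have c1 := core_not_pos P J hJJ hJP hfin hnhds hquad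
  have c2 := core_not_pos P (-J) (by intro x; simp [hJJ]) hJP' hfin hnhds hquad
  have hX : (J (EuclideanSpace.single 0 1)) 0 = 0 := by
    simp at c1 c2
    linarith
  obtain ⟨y, hy⟩ : ∃ y, y = (J (EuclideanSpace.single 0 1)) 1 := ⟨_, rfl⟩
  have hJe : J (EuclideanSpace.single 0 1) = y • EuclideanSpace.single 1 1 := by
    ext i
    fin_cases i
    · simpa using hX
    · simp [hy]
  have hyabs : |y| = 1 := by
    have h := hφn (EuclideanSpace.single 0 1)
    rw [hJe, map_smul, norm_smul, hnorm, hnorm] at h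
    simpa using h
  have hyy : y * y = 1 := by rw [← abs_mul_abs_self, hyabs, one_mul]
  have hJe1 : J (EuclideanSpace.single 1 1) = (-y) • EuclideanSpace.single 0 1 := by
    have h := hJJ (EuclideanSpace.single 0 1)
    rw [hJe, map_smul] at h
    have h2 := congrArg (fun z => y • z) h
    simp only [smul_smul, hyy, one_smul] at h2
    rw [h2]; module
  have hv : v = (u 0 * y) • EuclideanSpace.single 1 1 +
      (-(u 1 * y)) • EuclideanSpace.single 0 1 := by
    have hu : u = u 0 • EuclideanSpace.single 0 1 + u 1 • EuclideanSpace.single 1 1 := by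
      ext i; fin_cases i <;> simp
    rw [← hJu]
    conv_lhs => rw [hu]
    rw [map_add, map_smul, map_smul, hJe, hJe1]
    module
  have hv0 : v 0 = -(u 1 * y) := by rw [hv]; simp
  have hv1 : v 1 = u 0 * y := by rw [hv]; simp
  constructor
  · rw [EuclideanSpace.norm_eq, EuclideanSpace.norm_eq]
    congr 1
    simp [Fin.sum_univ_two, hv0, hv1]
    ring
  · simp [PiLp.inner_apply, Fin.sum_univ_two, hv0, hv1]
    linear_combination (-(u 0)^2 - (u 1)^2) * hyy
end

section
/- Let K ⊂ ℝ³ be a centrally symmetric convex body equipartitioned by the standard orthonormal basis (±e₁,±e₂,±e₃ ∈ ∂K, the coordinate planes split K into 8 pieces of equal volume, and each coordinate-plane section K ∩ e_i^⊥ is split into 4 pieces of equal area by the other two planes). Then B₁³ ⊆ K ⊆ 54√2 · B₁³. -/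
open MeasureTheory
open scoped RealInnerProductSpace

/-- Volume lower bound for the corner simplex. -/
lemma corner_simplex_volume (n : ℕ) [NeZero n] :
    ENNReal.ofReal (1 / (n.factorial : ℝ)) ≤
      volume {x : Fin n → ℝ | (∀ i, 0 ≤ x i) ∧ ∑ i, x i ≤ 1} := by
  set S := {x : Fin n → ℝ | (∀ i, 0 ≤ x i) ∧ ∑ i, x i ≤ 1} with hS
  have hSc : IsClosed S := by
    have : S = (⋂ i, {x : Fin n → ℝ | 0 ≤ x i}) ∩ {x | ∑ i, x i ≤ 1} := by
      ext x; simp [hS]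
    rw [this]
    exact (isClosed_iInter fun i => isClosed_le continuous_const (continuous_apply i)).inter
      (isClosed_le (by fun_prop) continuous_const)
  have hball := MeasureTheory.volume_sum_rpow_le (Fin n) (p := 1) le_rfl 1
  let f : (Fin n → Bool) → (Fin n → ℝ) → (Fin n → ℝ) :=
    fun σ x i => if σ i then x i else - x i
  have hf : ∀ σ, MeasurePreserving (f σ) := by
    intro σ
    have : ∀ i : Fin n, MeasurePreserving (fun t : ℝ => if σ i then t else -t) := by
      intro i
      by_cases h : σ i
      · simp only [h, if_true]; exact MeasurePreserving.id (volume : Measure ℝ)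
      · simpa [h] using Measure.measurePreserving_neg (volume : Measure ℝ)
    exact volume_preserving_pi this
  have hcov : {x : Fin n → ℝ | (∑ i, |x i| ^ (1:ℝ)) ^ (1 / (1:ℝ)) ≤ 1} ⊆
      ⋃ σ : Fin n → Bool, f σ ⁻¹' S := by
    intro x hx
    simp only [Real.rpow_one, div_one, Set.mem_ofPred_eq] at hx
    refine Set.mem_iUnion.2 ⟨fun i => decide (0 ≤ x i), ?_⟩
    have : f (fun i => decide (0 ≤ x i)) x = fun i => |x i| := by
      funext i
      by_cases h : 0 ≤ x i
      · simp [f, h, abs_of_nonneg h]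
      · simp only [f, h, decide_false, Bool.false_eq_true, if_false]
        rw [abs_of_neg (not_le.1 h)]
    rw [Set.mem_preimage, this]
    exact ⟨fun i => abs_nonneg _, hx⟩
  have h1 : volume {x : Fin n → ℝ | (∑ i, |x i| ^ (1:ℝ)) ^ (1 / (1:ℝ)) ≤ 1} ≤ 2 ^ n * volume S := by
    refine (measure_mono hcov).trans ((measure_iUnion_le _).trans ?_)
    rw [tsum_fintype]
    simp only [fun σ => (hf σ).measure_preimage hSc.measurableSet.nullMeasurableSet]
    simp
  rw [hball] at h1
  have e : (2 * Real.Gamma (1 / 1 + 1)) ^ Fintype.card (Fin n) /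
      Real.Gamma ((Fintype.card (Fin n) : ℝ) / 1 + 1) = 2 ^ n * (1 / (n.factorial : ℝ)) := by
    have h2 : Real.Gamma (1 + 1 : ℝ) = 1 := by
      simpa using Real.Gamma_nat_eq_factorial 1
    simp only [div_one, Fintype.card_fin, Real.Gamma_nat_eq_factorial, h2]
    ring
  rw [e, ENNReal.ofReal_mul (by positivity), ENNReal.ofReal_pow (by norm_num)] at h1
  simp only [ENNReal.ofReal_one, one_pow, one_mul, ENNReal.ofReal_ofNat] at h1
  exact (ENNReal.mul_le_mul_iff_right (by simp) (by simp)).1 h1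

/-- Planar lemma. -/
lemma planar_bound (L : Set (Fin 2 → ℝ)) (hc : Convex ℝ L) (hs : ∀ x ∈ L, -x ∈ L)
    (h10 : ![1, 0] ∈ L) (h01 : ![0, 1] ∈ L)
    (b1 : ∀ t : ℝ, ![t, 0] ∈ L → t ≤ 1) (b2 : ∀ t : ℝ, ![0, t] ∈ L → t ≤ 1)
    (hv : volume (L ∩ {x | 0 ≤ x 0 ∧ 0 ≤ x 1}) = volume (L ∩ {x | 0 ≤ x 0 ∧ x 1 ≤ 0}))
    (p q : ℝ) (hp : 0 ≤ p) (hq : 0 ≤ q) (hpq : ![p, q] ∈ L) : p ≤ 2 := by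
  by_contra! hp2
  rcases hq.eq_or_lt with rfl | hq0
  · linarith [b1 p hpq]
  -- lower bound
  have low : ENNReal.ofReal ((p + q - 1) / 2) ≤ volume (L ∩ {x | 0 ≤ x 0 ∧ 0 ≤ x 1}) := by
    let A : Matrix (Fin 2) (Fin 2) ℝ := !![-1, p - 1; 1, q]
    have hdet : |LinearMap.det (Matrix.toLin' A)| = p + q - 1 := by
      rw [LinearMap.det_toLin', Matrix.det_fin_two_of, abs_of_neg] <;> linarith
    have him := Measure.addHaar_image_linearMap (volume : Measure (Fin 2 → ℝ)) (Matrix.toLin' A)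
      {x : Fin 2 → ℝ | (∀ i, 0 ≤ x i) ∧ ∑ i, x i ≤ 1}
    have hsub : (fun y => ![1, 0] + y) '' (Matrix.toLin' A ''
        {x : Fin 2 → ℝ | (∀ i, 0 ≤ x i) ∧ ∑ i, x i ≤ 1}) ⊆ L ∩ {x | 0 ≤ x 0 ∧ 0 ≤ x 1} := by
      rintro _ ⟨_, ⟨u, ⟨hu, hu1⟩, rfl⟩, rfl⟩
      rw [Fin.sum_univ_two] at hu1
      have h0 := hu 0
      have h1 := hu 1
      have e : (![1, 0] : Fin 2 → ℝ) + Matrix.toLin' A u =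
          ![1 - u 0 - u 1 + u 1 * p, u 0 + u 1 * q] := by
        funext i
        fin_cases i <;> simp [A, Matrix.toLin'_apply, dotProduct, Fin.sum_univ_two] <;> ring
      change (![1, 0] : Fin 2 → ℝ) + Matrix.toLin' A u ∈ _
      rw [e]
      refine ⟨?_, ?_, ?_⟩
      · have := hc.sum_mem (t := Finset.univ) (w := ![1 - u 0 - u 1, u 0, u 1])
          (z := ![![1, 0], ![0, 1], ![p, q]])
          (by intro i _; fin_cases i <;> simp <;> linarith)
          (by simp [Fin.sum_univ_three]; ring)
          (by intro i _; fin_cases i <;> simp [h10, h01, hpq])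
        convert this using 1
        funext i
        fin_cases i <;> simp [Fin.sum_univ_three]
      · simp; nlinarith
      · simp; nlinarith
    calc ENNReal.ofReal ((p + q - 1) / 2)
        = ENNReal.ofReal (p + q - 1) * ENNReal.ofReal (1 / ((Nat.factorial 2 : ℕ) : ℝ)) := by
          rw [← ENNReal.ofReal_mul (by linarith)]; congr 1; simp [Nat.factorial]; ring
      _ ≤ ENNReal.ofReal (p + q - 1) * volume {x : Fin 2 → ℝ | (∀ i, 0 ≤ x i) ∧ ∑ i, x i ≤ 1} := by
          gcongr; exact corner_simplex_volume 2
      _ = _ := by rw [← hdet, ← him, ← measure_preimage_add volume (-![1, 0]), ← Set.image_add_left]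
      _ ≤ _ := measure_mono hsub
  -- constraints on the other quadrant
  have cons1 : ∀ x ∈ L, 0 ≤ x 0 → x 1 ≤ 0 → (p - 1) * (- x 1) + q * (x 0 - 1) ≤ 0 := by
    intro x hx h0 h1
    have hqy : 0 < q - x 1 := by linarith
    have := hc hpq hx (a := - x 1 / (q - x 1)) (b := q / (q - x 1))
      (div_nonneg (by linarith) hqy.le) (div_nonneg hq hqy.le) (by field_simp; ring)
    have h := b1 ((p * (- x 1) + q * x 0) / (q - x 1)) (by
      convert this using 1
      funext i
      fin_cases i <;> simp <;> field_simp <;> ring)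
    rw [div_le_one hqy] at h
    linarith
  have cons2 : ∀ x ∈ L, 0 ≤ x 0 → x 1 ≤ 0 → p * (- x 1 - 1) + (q - 1) * x 0 ≤ 0 := by
    intro x hx h0 h1
    have hpx : 0 < p + x 0 := by linarith
    have := hc hpq (hs x hx) (a := x 0 / (p + x 0)) (b := p / (p + x 0))
      (div_nonneg (by linarith) hpx.le) (div_nonneg hp hpx.le) (by field_simp; ring)
    have h := b2 ((p * (- x 1) + q * x 0) / (p + x 0)) (by
      convert this using 1
      funext i
      fin_cases i <;> simp <;> field_simp <;> ring)
    rw [div_le_one hpx] at h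
    linarith
  have box : ∀ B : ℝ, 0 ≤ B → (∀ x ∈ L, 0 ≤ x 0 → x 1 ≤ 0 → - x 1 ≤ B) →
      (p + q - 1) / 2 ≤ B := by
    intro B hB hbd
    have hsub : L ∩ {x | 0 ≤ x 0 ∧ x 1 ≤ 0} ⊆ Set.Icc ![0, -B] ![1, 0] := by
      rintro x ⟨hx, h0, h1⟩
      have h3 := hbd x hx h0 h1
      have h4 := cons1 x hx h0 h1
      have h5 : x 0 ≤ 1 := by
        by_contra! h
        have : 0 < q * (x 0 - 1) := mul_pos hq0 (by linarith)
        nlinarith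
      constructor <;> intro i <;> fin_cases i <;> simp <;> linarith
    have := low.trans (hv.le.trans (measure_mono hsub))
    rw [Real.volume_Icc_pi] at this
    simp only [Fin.prod_univ_two] at this
    simp at this
    exact (ENNReal.ofReal_le_ofReal_iff hB).1 this
  rcases le_total q 1 with hq1 | hq1
  · have := box (q / (p - 1)) (div_nonneg hq (by linarith)) (by
      intro x hx h0 h1
      rw [le_div_iff₀ (by linarith)]
      nlinarith [cons1 x hx h0 h1, mul_nonneg hq h0])
    rw [le_div_iff₀ (by linarith)] at this
    nlinarith [mul_nonneg hq (sub_nonneg.2 hp2.le)]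
  · have := box 1 zero_le_one (by
      intro x hx h0 h1
      have := cons2 x hx h0 h1
      have : 0 ≤ (q - 1) * x 0 := mul_nonneg (by linarith) h0
      by_contra! h
      nlinarith)
    linarith

/-- Spatial lemma. -/
lemma spatial_bound (L : Set (Fin 3 → ℝ)) (hc : Convex ℝ L)
    (h1 : ![1, 0, 0] ∈ L) (h2 : ![0, 1, 0] ∈ L) (h3 : ![0, 0, 1] ∈ L)
    (b1 : ∀ s t : ℝ, ![s, 0, t] ∈ L → s ≤ 2) (b2 : ∀ s t : ℝ, ![s, t, 0] ∈ L → s ≤ 2)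
    (hv : volume (L ∩ {x | 0 ≤ x 0 ∧ 0 ≤ x 1 ∧ 0 ≤ x 2}) =
      volume (L ∩ {x | 0 ≤ x 0 ∧ x 1 ≤ 0 ∧ x 2 ≤ 0}))
    (p q r : ℝ) (hq : 0 ≤ q) (hr : 0 ≤ r) (hqp : q ≤ p) (hrp : r ≤ p)
    (hpq : ![p, q, r] ∈ L) : p + q + r ≤ 76 := by
  by_contra! hbig
  have hp25 : 25 < p := by linarith
  rcases hq.eq_or_lt with rfl | hq0
  · linarith [b1 p r hpq]
  rcases hr.eq_or_lt with rfl | hr0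
  · linarith [b2 p q hpq]
  have low : ENNReal.ofReal ((p + q + r - 1) / 6) ≤
      volume (L ∩ {x | 0 ≤ x 0 ∧ 0 ≤ x 1 ∧ 0 ≤ x 2}) := by
    let A : Matrix (Fin 3) (Fin 3) ℝ := !![-1, -1, p - 1; 1, 0, q; 0, 1, r]
    have hdet : |LinearMap.det (Matrix.toLin' A)| = p + q + r - 1 := by
      have : A.det = p + q + r - 1 := by
        simp [A, Matrix.det_fin_three]; ring
      rw [LinearMap.det_toLin', this, abs_of_pos]; linarith
    have him := Measure.addHaar_image_linearMap (volume : Measure (Fin 3 → ℝ)) (Matrix.toLin' A)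
      {x : Fin 3 → ℝ | (∀ i, 0 ≤ x i) ∧ ∑ i, x i ≤ 1}
    have hsub : (fun y => ![1, 0, 0] + y) '' (Matrix.toLin' A ''
        {x : Fin 3 → ℝ | (∀ i, 0 ≤ x i) ∧ ∑ i, x i ≤ 1}) ⊆
        L ∩ {x | 0 ≤ x 0 ∧ 0 ≤ x 1 ∧ 0 ≤ x 2} := by
      rintro _ ⟨_, ⟨u, ⟨hu, hu1⟩, rfl⟩, rfl⟩
      rw [Fin.sum_univ_three] at hu1
      have k0 := hu 0
      have k1 := hu 1
      have k2 := hu 2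
      have e : (![1, 0, 0] : Fin 3 → ℝ) + Matrix.toLin' A u =
          ![1 - u 0 - u 1 - u 2 + u 2 * p, u 0 + u 2 * q, u 1 + u 2 * r] := by
        funext i
        fin_cases i <;>
          simp [A, Matrix.toLin'_apply, dotProduct, Fin.sum_univ_three] <;> ring
      change (![1, 0, 0] : Fin 3 → ℝ) + Matrix.toLin' A u ∈ _
      rw [e]
      refine ⟨?_, ?_, ?_, ?_⟩
      · have := hc.sum_mem (t := Finset.univ) (w := ![1 - u 0 - u 1 - u 2, u 0, u 1, u 2])
          (z := ![![1, 0, 0], ![0, 1, 0], ![0, 0, 1], ![p, q, r]])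
          (by intro i _; fin_cases i <;> simp <;> linarith)
          (by simp [Fin.sum_univ_four]; ring)
          (by intro i _; fin_cases i <;> simp [h1, h2, h3, hpq])
        convert this using 1
        funext i
        fin_cases i <;> simp [Fin.sum_univ_four]
      · simp; nlinarith
      · simp; nlinarith
      · simp; nlinarith
    calc ENNReal.ofReal ((p + q + r - 1) / 6)
        = ENNReal.ofReal (p + q + r - 1) * ENNReal.ofReal (1 / ((Nat.factorial 3 : ℕ) : ℝ)) := by
          rw [← ENNReal.ofReal_mul (by linarith)]; congr 1; simp [Nat.factorial]; ring
      _ ≤ ENNReal.ofReal (p + q + r - 1) *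
            volume {x : Fin 3 → ℝ | (∀ i, 0 ≤ x i) ∧ ∑ i, x i ≤ 1} := by
          gcongr; exact corner_simplex_volume 3
      _ = _ := by rw [← hdet, ← him, ← measure_preimage_add volume (-![1, 0, 0]), ← Set.image_add_left]
      _ ≤ _ := measure_mono hsub
  have cons1 : ∀ x ∈ L, 0 ≤ x 0 → x 1 ≤ 0 → (p - 2) * (- x 1) + q * (x 0 - 2) ≤ 0 := by
    intro x hx k0 k1
    have hqy : 0 < q - x 1 := by linarith
    have := hc hpq hx (a := - x 1 / (q - x 1)) (b := q / (q - x 1))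
      (div_nonneg (by linarith) hqy.le) (div_nonneg hq hqy.le) (by field_simp; ring)
    have h := b1 ((p * (- x 1) + q * x 0) / (q - x 1)) ((r * (- x 1) + q * x 2) / (q - x 1)) (by
      convert this using 1
      funext i
      fin_cases i <;> simp <;> field_simp <;> ring)
    rw [div_le_iff₀ hqy] at h
    linarith
  have cons2 : ∀ x ∈ L, 0 ≤ x 0 → x 2 ≤ 0 → (p - 2) * (- x 2) + r * (x 0 - 2) ≤ 0 := by
    intro x hx k0 k1
    have hqy : 0 < r - x 2 := by linarith
    have := hc hpq hx (a := - x 2 / (r - x 2)) (b := r / (r - x 2))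
      (div_nonneg (by linarith) hqy.le) (div_nonneg hr hqy.le) (by field_simp; ring)
    have h := b2 ((p * (- x 2) + r * x 0) / (r - x 2)) ((q * (- x 2) + r * x 1) / (r - x 2)) (by
      convert this using 1
      funext i
      fin_cases i <;> simp <;> field_simp <;> ring)
    rw [div_le_iff₀ hqy] at h
    linarith
  have hp2 : 0 < p - 2 := by linarith
  have ratio : p / (p - 2) ≤ 25 / 23 := by
    rw [div_le_div_iff₀ hp2 (by norm_num)]; linarith
  have hB : ∀ a x0 y : ℝ, 0 ≤ a → a ≤ p → 0 ≤ x0 → (p - 2) * y + a * (x0 - 2) ≤ 0 →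
      y ≤ 50 / 23 := by
    intro a x0 y ha hap hx0 h
    have : y ≤ 2 * p / (p - 2) := by
      rw [le_div_iff₀ hp2]
      nlinarith [mul_nonneg ha hx0]
    have e : 2 * p / (p - 2) = 2 * (p / (p - 2)) := by ring
    linarith
  have hsub : L ∩ {x | 0 ≤ x 0 ∧ x 1 ≤ 0 ∧ x 2 ≤ 0} ⊆
      Set.Icc ![0, -(50 / 23), -(50 / 23)] ![2, 0, 0] := by
    rintro x ⟨hx, k0, k1, k2⟩
    have h4 := cons1 x hx k0 k1
    have h5 := cons2 x hx k0 k2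
    have h6 := hB q _ _ hq hqp k0 h4
    have h7 := hB r _ _ hr hrp k0 h5
    have h8 : x 0 ≤ 2 := by
      by_contra! h
      have : 0 < q * (x 0 - 2) := mul_pos hq0 (by linarith)
      nlinarith
    constructor <;> intro i <;> fin_cases i <;> simp <;> linarith
  have := low.trans (hv.le.trans (measure_mono hsub))
  rw [Real.volume_Icc_pi] at this
  simp only [Fin.prod_univ_three] at this
  rw [← ENNReal.ofReal_mul (by norm_num), ← ENNReal.ofReal_mul (by norm_num),
    ENNReal.ofReal_le_ofReal_iff (by simp; norm_num)] at this
  simp at this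
  linarith

/-- Sign attached to a boolean. -/
noncomputable def sgn3 (σ : Fin 3 → Bool) (m : Fin 3) : ℝ := if σ m then (1 : ℝ) else -1

lemma sgn3_mul_self (σ : Fin 3 → Bool) (m : Fin 3) (t : ℝ) :
    sgn3 σ m * (sgn3 σ m * t) = t := by
  unfold sgn3; split_ifs <;> ring

lemma sgn3_sq (σ : Fin 3 → Bool) (m : Fin 3) : sgn3 σ m ^ 2 = 1 := by
  unfold sgn3; split_ifs <;> ring

lemma sgn3_abs (x : Fin 3 → ℝ) (m : Fin 3) :
    sgn3 (fun m => decide (0 ≤ x m)) m * x m = |x m| := by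
  unfold sgn3
  by_cases h : 0 ≤ x m
  · simp [h, abs_of_nonneg h]
  · simp only [h, decide_false, Bool.false_eq_true, if_false]
    rw [abs_of_neg (not_le.1 h)]; ring

lemma fin3_cases {i j k : Fin 3} (hij : i ≠ j) (hik : i ≠ k) (hjk : j ≠ k) (m : Fin 3) :
    m = i ∨ m = j ∨ m = k := by
  omega

lemma fin3_sum {i j k : Fin 3} (hij : i ≠ j) (hik : i ≠ k) (hjk : j ≠ k) (f : Fin 3 → ℝ) :
    ∑ m, f m = f i + f j + f k := by
  have : (Finset.univ : Finset (Fin 3)) = {i, j, k} := by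
    ext m; simpa using fin3_cases hij hik hjk m
  rw [this, Finset.sum_insert (by simp [hij, hik]), Finset.sum_pair hjk]; ring

/-- Signed embedding of the plane. -/
noncomputable def emb2 (σ : Fin 3 → Bool) (i j k : Fin 3) (hij : i ≠ j) (hik : i ≠ k)
    (hjk : j ≠ k) : EuclideanSpace ℝ (Fin 2) →ₗᵢ[ℝ] EuclideanSpace ℝ (Fin 3) where
  toFun y := WithLp.toLp 2 (fun m => if m = i then sgn3 σ i * y 0 else
    if m = j then sgn3 σ j * y 1 else 0)
  map_add' x y := by
    ext m; simp; split_ifs <;> ring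
  map_smul' c y := by
    ext m; simp; split_ifs <;> ring
  norm_map' y := by
    simp only [EuclideanSpace.norm_eq, LinearMap.coe_mk, AddHom.coe_mk, fin3_sum hij hik hjk,
      Fin.sum_univ_two]
    simp [hij.symm, hik.symm, hjk.symm, mul_pow, sgn3_sq]

/-- Signed permutation of coordinates. -/
noncomputable def emb3 (σ : Fin 3 → Bool) (i j k : Fin 3) (hij : i ≠ j) (hik : i ≠ k)
    (hjk : j ≠ k) : EuclideanSpace ℝ (Fin 3) →ₗᵢ[ℝ] EuclideanSpace ℝ (Fin 3) where
  toFun y := WithLp.toLp 2 (fun m => if m = i then sgn3 σ i * y 0 else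
    if m = j then sgn3 σ j * y 1 else sgn3 σ k * y 2)
  map_add' x y := by
    ext m; simp; split_ifs <;> ring
  map_smul' c y := by
    ext m; simp; split_ifs <;> ring
  norm_map' y := by
    rw [EuclideanSpace.norm_eq, EuclideanSpace.norm_eq, fin3_sum hij hik hjk, Fin.sum_univ_three]
    simp [hij.symm, hik.symm, hjk.symm, mul_pow, sgn3_sq]

lemma sgn3_single_mem {K : Set (EuclideanSpace ℝ (Fin 3))} (hs : ∀ x ∈ K, -x ∈ K)
    (hK : ∀ i : Fin 3, EuclideanSpace.single i (1 : ℝ) ∈ K) (σ : Fin 3 → Bool) (i : Fin 3) :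
    EuclideanSpace.single i (sgn3 σ i) ∈ K := by
  unfold sgn3
  split_ifs
  · exact hK i
  · have := hs _ (hK i)
    convert this using 1
    ext m; simp [Pi.single_apply]; split_ifs <;> simp

lemma volume_eq_of_hausdorff (A B : Set (EuclideanSpace ℝ (Fin 2))) (h : μH[2] A = μH[2] B) :
    volume A = volume B := by
  have hH : Measure.IsAddHaarMeasure (μH[2] : Measure (EuclideanSpace ℝ (Fin 2))) := by
    simpa using MeasureTheory.isAddHaarMeasure_hausdorffMeasure (E := EuclideanSpace ℝ (Fin 2))
  rw [Measure.isAddLeftInvariant_eq_smul (volume : Measure (EuclideanSpace ℝ (Fin 2))) μH[2]]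
  simp [h]

lemma volume_toLp_preimage (n : ℕ) (A : Set (EuclideanSpace ℝ (Fin n))) :
    volume ((fun y : Fin n → ℝ => (WithLp.toLp 2 y : EuclideanSpace ℝ (Fin n))) ⁻¹' A) =
      volume A :=
  (EuclideanSpace.volume_preserving_symm_measurableEquiv_toLp (Fin n)).symm.measure_preimage_equiv A

lemma section_bound (K : Set (EuclideanSpace ℝ (Fin 3)))
    (hc : Convex ℝ K) (hs : ∀ x ∈ K, -x ∈ K)
    (hK : ∀ i : Fin 3, EuclideanSpace.single i (1 : ℝ) ∈ K)
    (hb : ∀ (i : Fin 3) (t : ℝ), EuclideanSpace.single i t ∈ K → t ≤ 1)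
    (hsec : ∀ i : Fin 3, ∀ σ : Fin 3 → Bool,
      μH[2] (K ∩ {x | x i = 0} ∩
          {x | ∀ j, j ≠ i → 0 ≤ (if σ j then (1 : ℝ) else -1) * x j}) =
        μH[2] (K ∩ {x | x i = 0}) / 4)
    {i j k : Fin 3} (hij : i ≠ j) (hik : i ≠ k) (hjk : j ≠ k)
    (x : EuclideanSpace ℝ (Fin 3)) (hx : x ∈ K) (hxk : x k = 0) : |x i| ≤ 2 := by
  set σ : Fin 3 → Bool := fun m => decide (0 ≤ x m) with hσ
  set f := emb2 σ i j k hij hik hjk with hf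
  have fi : ∀ y, f y i = sgn3 σ i * y 0 := by intro y; simp [hf, emb2]
  have fj : ∀ y, f y j = sgn3 σ j * y 1 := by intro y; simp [hf, emb2, hij.symm]
  have fk : ∀ y, f y k = 0 := by intro y; simp [hf, emb2, hik.symm, hjk.symm]
  have fext : ∀ y (z : EuclideanSpace ℝ (Fin 3)), z i = sgn3 σ i * y 0 → z j = sgn3 σ j * y 1 →
      z k = 0 → f y = z := by
    intro y z h1 h2 h3
    ext m
    rcases fin3_cases hij hik hjk m with rfl | rfl | rfl
    · rw [fi, h1]
    · rw [fj, h2]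
    · rw [fk, h3]
  let L : Set (Fin 2 → ℝ) := {y | f (WithLp.toLp 2 y) ∈ K}
  have him : ∀ (τ : Fin 3 → Bool) (Q : Set (EuclideanSpace ℝ (Fin 2))),
      (∀ y, y ∈ Q ↔ 0 ≤ sgn3 τ i * f y i ∧ 0 ≤ sgn3 τ j * f y j) →
      f '' (f ⁻¹' K ∩ Q) = K ∩ {x | x k = 0} ∩
        {x | ∀ j, j ≠ k → 0 ≤ (if τ j then (1 : ℝ) else -1) * x j} := by
    intro τ Q hQ
    ext z
    constructor
    · rintro ⟨y, ⟨hy, hyQ⟩, rfl⟩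
      refine ⟨⟨hy, fk y⟩, ?_⟩
      intro m hm
      rcases fin3_cases hij hik hjk m with rfl | rfl | rfl
      · exact ((hQ y).1 hyQ).1
      · exact ((hQ y).1 hyQ).2
      · exact absurd rfl hm
    · rintro ⟨⟨hz, hzk⟩, hzq⟩
      have e : f !₂[sgn3 σ i * z i, sgn3 σ j * z j] = z :=
        fext _ _ (by simp [sgn3_mul_self]) (by simp [sgn3_mul_self]) hzk
      refine ⟨_, ⟨?_, ?_⟩, e⟩
      · rw [Set.mem_preimage, e]; exact hz
      · rw [hQ, e]; exact ⟨hzq i hik, hzq j hjk⟩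
  have hv : volume (f ⁻¹' K ∩ {y | 0 ≤ y 0 ∧ 0 ≤ y 1}) =
      volume (f ⁻¹' K ∩ {y | 0 ≤ y 0 ∧ y 1 ≤ 0}) := by
    apply volume_eq_of_hausdorff
    rw [← f.isometry.hausdorffMeasure_image (Or.inl (by norm_num)),
      ← f.isometry.hausdorffMeasure_image (Or.inl (by norm_num)),
      him σ _ (by intro y; rw [fi, fj, sgn3_mul_self, sgn3_mul_self]; rfl),
      him (Function.update σ j (!σ j)) _ (by
        intro y
        have e1 : sgn3 (Function.update σ j (!σ j)) i = sgn3 σ i := by simp [sgn3, hij]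
        have e2 : sgn3 (Function.update σ j (!σ j)) j = - sgn3 σ j := by
          simp only [sgn3, Function.update_self]
          cases σ j <;> simp
        rw [fi, fj, e1, e2, sgn3_mul_self, neg_mul, sgn3_mul_self, neg_nonneg]; rfl),
      hsec, hsec]
  have key := planar_bound L
    (hc.linear_preimage (f.toLinearMap ∘ₗ (WithLp.linearEquiv 2 ℝ (Fin 2 → ℝ)).symm.toLinearMap))
    (by
      intro y hy
      have := hs _ hy
      rw [← map_neg] at this
      exact this)
    (by
      change f _ ∈ K
      rw [fext (WithLp.toLp 2 ![1, 0]) (EuclideanSpace.single i (sgn3 σ i)) (by simp)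
        (by simp [hij.symm]) (by simp [hik.symm])]
      exact sgn3_single_mem hs hK σ i)
    (by
      change f _ ∈ K
      rw [fext (WithLp.toLp 2 ![0, 1]) (EuclideanSpace.single j (sgn3 σ j)) (by simp [hij])
        (by simp) (by simp [hjk.symm])]
      exact sgn3_single_mem hs hK σ j)
    (by
      intro t ht
      change f _ ∈ K at ht
      rw [fext (WithLp.toLp 2 ![t, 0]) (EuclideanSpace.single i (sgn3 σ i * t)) (by simp)
        (by simp [hij.symm]) (by simp [hik.symm])] at ht
      refine hb i t ?_
      by_cases h : σ i
      · simpa [sgn3, h] using ht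
      · have := hs _ ht
        convert this using 1
        ext m; simp [sgn3, h, Pi.single_apply]; split_ifs <;> simp)
    (by
      intro t ht
      change f _ ∈ K at ht
      rw [fext (WithLp.toLp 2 ![0, t]) (EuclideanSpace.single j (sgn3 σ j * t)) (by simp [hij])
        (by simp) (by simp [hjk.symm])] at ht
      refine hb j t ?_
      by_cases h : σ j
      · simpa [sgn3, h] using ht
      · have := hs _ ht
        convert this using 1
        ext m; simp [sgn3, h, Pi.single_apply]; split_ifs <;> simp)
    (by
      rw [← volume_toLp_preimage, ← volume_toLp_preimage] at hv
      exact hv)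
    |x i| |x j| (abs_nonneg _) (abs_nonneg _)
    (by
      change f _ ∈ K
      rw [fext (WithLp.toLp 2 ![|x i|, |x j|]) x]
      · exact hx
      · simp [← sgn3_abs, ← hσ, sgn3_mul_self]
      · simp [← sgn3_abs, ← hσ, sgn3_mul_self]
      · exact hxk)
  exact key

lemma body_bound (K : Set (EuclideanSpace ℝ (Fin 3)))
    (hc : Convex ℝ K) (hs : ∀ x ∈ K, -x ∈ K)
    (hK : ∀ i : Fin 3, EuclideanSpace.single i (1 : ℝ) ∈ K)
    (hS : ∀ (i j k : Fin 3), i ≠ j → i ≠ k → j ≠ k → ∀ x ∈ K, x k = 0 → |x i| ≤ 2)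
    (hoct : ∀ σ : Fin 3 → Bool,
      volume (K ∩ {x | ∀ i, 0 ≤ (if σ i then (1 : ℝ) else -1) * x i}) = volume K / 8)
    {i j k : Fin 3} (hij : i ≠ j) (hik : i ≠ k) (hjk : j ≠ k)
    (x : EuclideanSpace ℝ (Fin 3)) (hx : x ∈ K) (hxj : |x j| ≤ |x i|) (hxk : |x k| ≤ |x i|) :
    ∑ m, |x m| ≤ 76 := by
  set σ : Fin 3 → Bool := fun m => decide (0 ≤ x m) with hσ
  set f := emb3 σ i j k hij hik hjk with hf
  have fi : ∀ y, f y i = sgn3 σ i * y 0 := by intro y; simp [hf, emb3]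
  have fj : ∀ y, f y j = sgn3 σ j * y 1 := by intro y; simp [hf, emb3, hij.symm]
  have fk : ∀ y, f y k = sgn3 σ k * y 2 := by intro y; simp [hf, emb3, hik.symm, hjk.symm]
  have fext : ∀ y (z : EuclideanSpace ℝ (Fin 3)), z i = sgn3 σ i * y 0 → z j = sgn3 σ j * y 1 →
      z k = sgn3 σ k * y 2 → f y = z := by
    intro y z h1 h2 h3
    ext m
    rcases fin3_cases hij hik hjk m with rfl | rfl | rfl
    · rw [fi, h1]
    · rw [fj, h2]
    · rw [fk, h3]
  have hsa : ∀ m (t : ℝ), |sgn3 σ m * t| = |t| := by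
    intro m t; unfold sgn3; split_ifs <;> simp
  let L : Set (Fin 3 → ℝ) := {y | f (WithLp.toLp 2 y) ∈ K}
  have hmp : ∀ A, volume (f ⁻¹' A) = volume A := by
    intro A
    let g := f.toLinearIsometryEquiv rfl
    have := g.measurePreserving.measure_preimage_equiv (f := g.toHomeomorph.toMeasurableEquiv) A
    exact this
  have him : ∀ (τ : Fin 3 → Bool) (Q : Set (EuclideanSpace ℝ (Fin 3))),
      (∀ y, y ∈ Q ↔ 0 ≤ sgn3 τ i * f y i ∧ 0 ≤ sgn3 τ j * f y j ∧ 0 ≤ sgn3 τ k * f y k) →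
      f ⁻¹' K ∩ Q = f ⁻¹' (K ∩
        {x | ∀ j, 0 ≤ (if τ j then (1 : ℝ) else -1) * x j}) := by
    intro τ Q hQ
    ext y
    rw [Set.mem_inter_iff, hQ]
    refine and_congr Iff.rfl ⟨?_, fun h => ⟨h i, h j, h k⟩⟩
    rintro ⟨h1, h2, h3⟩ m
    rcases fin3_cases hij hik hjk m with rfl | rfl | rfl
    · exact h1
    · exact h2
    · exact h3
  have hv : volume (f ⁻¹' K ∩ {y | 0 ≤ y 0 ∧ 0 ≤ y 1 ∧ 0 ≤ y 2}) =
      volume (f ⁻¹' K ∩ {y | 0 ≤ y 0 ∧ y 1 ≤ 0 ∧ y 2 ≤ 0}) := by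
    rw [him σ _ (by intro y; rw [fi, fj, fk, sgn3_mul_self, sgn3_mul_self, sgn3_mul_self]; rfl),
      him (fun m => if m = i then σ m else !σ m) _ (by
        intro y
        have e1 : sgn3 (fun m => if m = i then σ m else !σ m) i = sgn3 σ i := by simp [sgn3]
        have e2 : ∀ m, m ≠ i → sgn3 (fun m => if m = i then σ m else !σ m) m = - sgn3 σ m := by
          intro m hm
          simp only [sgn3, hm, if_false]
          cases σ m <;> simp
        rw [fi, fj, fk, e1, e2 j hij.symm, e2 k hik.symm, sgn3_mul_self, neg_mul, sgn3_mul_self,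
          neg_mul, sgn3_mul_self, neg_nonneg, neg_nonneg]; rfl),
      hmp, hmp, hoct, hoct]
  have key := spatial_bound L
    (hc.linear_preimage (f.toLinearMap ∘ₗ (WithLp.linearEquiv 2 ℝ (Fin 3 → ℝ)).symm.toLinearMap))
    (by
      change f _ ∈ K
      rw [fext (WithLp.toLp 2 ![1, 0, 0]) (EuclideanSpace.single i (sgn3 σ i)) (by simp)
        (by simp [hij.symm]) (by simp [hik.symm])]
      exact sgn3_single_mem hs hK σ i)
    (by
      change f _ ∈ K
      rw [fext (WithLp.toLp 2 ![0, 1, 0]) (EuclideanSpace.single j (sgn3 σ j)) (by simp [hij])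
        (by simp) (by simp [hjk.symm])]
      exact sgn3_single_mem hs hK σ j)
    (by
      change f _ ∈ K
      rw [fext (WithLp.toLp 2 ![0, 0, 1]) (EuclideanSpace.single k (sgn3 σ k)) (by simp [hik])
        (by simp [hjk]) (by simp)]
      exact sgn3_single_mem hs hK σ k)
    (by
      intro s t h
      have := hS i k j hik hij hjk.symm _ h (by rw [fj]; simp)
      rw [fi, hsa] at this
      exact (le_abs_self _).trans this)
    (by
      intro s t h
      have := hS i j k hij hik hjk _ h (by rw [fk]; simp)
      rw [fi, hsa] at this
      exact (le_abs_self _).trans this)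
    (by
      rw [← volume_toLp_preimage, ← volume_toLp_preimage] at hv
      exact hv)
    |x i| |x j| |x k| (abs_nonneg _) (abs_nonneg _) hxj hxk
    (by
      change f _ ∈ K
      rw [fext (WithLp.toLp 2 ![|x i|, |x j|, |x k|]) x]
      · exact hx
      · simp [← sgn3_abs, ← hσ, sgn3_mul_self]
      · simp [← sgn3_abs, ← hσ, sgn3_mul_self]
      · simp [← sgn3_abs, ← hσ, sgn3_mul_self])
  rw [fin3_sum hij hik hjk]
  exact key

/-- A symmetric convex body `K ⊂ ℝ³` equipartitioned by the standard orthonormal basis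
satisfies `B₁³ ⊆ K ⊆ 54√2 · B₁³`. -/
theorem equipartitioned_body_bounds (K : Set (EuclideanSpace ℝ (Fin 3)))
    (hKcomp : IsCompact K) (hKconv : Convex ℝ K) (hKsymm : K = -K)
    (hKint : (interior K).Nonempty)
    (he : ∀ i : Fin 3, EuclideanSpace.single i (1 : ℝ) ∈ frontier K)
    (hoct : ∀ σ : Fin 3 → Bool,
      volume (K ∩ {x | ∀ i, 0 ≤ (if σ i then (1 : ℝ) else -1) * x i}) = volume K / 8)
    (hsec : ∀ i : Fin 3, ∀ σ : Fin 3 → Bool,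
      μH[2] (K ∩ {x | x i = 0} ∩
          {x | ∀ j, j ≠ i → 0 ≤ (if σ j then (1 : ℝ) else -1) * x j}) =
        μH[2] (K ∩ {x | x i = 0}) / 4) :
    {x : EuclideanSpace ℝ (Fin 3) | ∑ i, |x i| ≤ 1} ⊆ K ∧
    K ⊆ {x : EuclideanSpace ℝ (Fin 3) | ∑ i, |x i| ≤ 54 * Real.sqrt 2} := by
  have hs : ∀ x ∈ K, -x ∈ K := by
    intro x hx
    rw [hKsymm]
    simpa using hx
  have hK : ∀ i : Fin 3, EuclideanSpace.single i (1 : ℝ) ∈ K := fun i =>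
    hKcomp.isClosed.frontier_subset (he i)
  have h0 : (0 : EuclideanSpace ℝ (Fin 3)) ∈ interior K := by
    obtain ⟨x, hx⟩ := hKint
    have hx' : -x ∈ interior K := by
      have : interior K = -interior K := by
        conv_lhs => rw [hKsymm]
        exact ((Homeomorph.neg _).preimage_interior K).symm
      rw [this]; simpa using hx
    have := hKconv.interior hx hx' (a := 1 / 2) (b := 1 / 2) (by norm_num) (by norm_num)
      (by norm_num)
    simpa using this
  have hb : ∀ (i : Fin 3) (t : ℝ), EuclideanSpace.single i t ∈ K → t ≤ 1 := by
    intro i t ht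
    by_contra! h1
    have hmem : EuclideanSpace.single i (1 : ℝ) ∈ interior K := by
      apply hKconv.openSegment_interior_self_subset_interior h0 ht
      refine ⟨1 - 1 / t, 1 / t, ?_, by positivity, by ring, ?_⟩
      · rw [sub_pos, div_lt_one (by linarith)]; exact h1
      · have : t ≠ 0 := by linarith
        ext m; simp [Pi.single_apply]; field_simp
    exact (he i).2 hmem
  constructor
  · intro x hx
    change ∑ i, |x i| ≤ 1 at hx
    rw [Fin.sum_univ_three] at hx
    set σ : Fin 3 → Bool := fun m => decide (0 ≤ x m) with hσ
    have hm := sgn3_single_mem hs hK σ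
    have := hKconv.sum_mem (t := Finset.univ)
      (w := ![1 - |x 0| - |x 1| - |x 2|, |x 0|, |x 1|, |x 2|])
      (z := ![0, EuclideanSpace.single 0 (sgn3 σ 0), EuclideanSpace.single 1 (sgn3 σ 1),
        EuclideanSpace.single 2 (sgn3 σ 2)])
      (by intro i _; fin_cases i <;> simp <;> linarith)
      (by simp [Fin.sum_univ_four]; ring)
      (by intro i _; fin_cases i <;> simp [hm, interior_subset h0])
    convert this using 1
    have e : ∀ m, |x m| * sgn3 σ m = x m := by
      intro m
      rw [← sgn3_abs, ← hσ, mul_comm, sgn3_mul_self]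
    ext m
    fin_cases m <;> simp [Fin.sum_univ_four, e]
  · intro x hx
    change ∑ i, |x i| ≤ 54 * Real.sqrt 2
    have hsq : (76 : ℝ) ≤ 54 * Real.sqrt 2 := by
      have : (76 / 54 : ℝ) ≤ Real.sqrt 2 := Real.le_sqrt_of_sq_le (by norm_num)
      linarith
    refine le_trans ?_ hsq
    have hB := fun (i j k : Fin 3) (hij : i ≠ j) (hik : i ≠ k) (hjk : j ≠ k) =>
      body_bound K hKconv hs hK
      (fun i j k hij hik hjk x hx hxk =>
        section_bound K hKconv hs hK hb hsec hij hik hjk x hx hxk) hoct hij hik hjk x hx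
    rcases le_total |x 0| |x 1| with h01 | h01 <;> rcases le_total |x 1| |x 2| with h12 | h12 <;>
      rcases le_total |x 0| |x 2| with h02 | h02
    · exact hB 2 0 1 (by decide) (by decide) (by decide) h02 h12
    · exact hB 2 0 1 (by decide) (by decide) (by decide) (h01.trans h12) h12
    · exact hB 1 0 2 (by decide) (by decide) (by decide) h01 h12
    · exact hB 1 0 2 (by decide) (by decide) (by decide) h01 h12
    · exact hB 2 0 1 (by decide) (by decide) (by decide) h02 h12
    · exact hB 0 1 2 (by decide) (by decide) (by decide) h01 h02
    · exact hB 0 1 2 (by decide) (by decide) (by decide) h01 (h12.trans h01)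
    · exact hB 0 1 2 (by decide) (by decide) (by decide) h01 h02
end
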